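/- Let K be an algebraically closed field of characteristic 0, d ≥ 1, and n = d + 1. There exist A-module homomorphisms f_s : Õ_{s,d,d+1} → Õ_{s+1,d,d+1} for 1 ≤ s ≤ d − 1 such that the sequence of A-modules 0 → O_{1,d,d+1} → Õ_{1,d,d+1} → Õ_{2,d,d+1} → ⋯ → Õ_{d,d,d+1} → 0 is exact, where the first map is the inclusion of O_{1,d,d+1} into its integral closure (in the paper the maps respect the gradings after suitable degree shifts). -/

import Mathlib

set_option synthInstance.maxHeartbeats 1000000
set_option maxHeartbeats 4000000

open Matrix

/-- The span of the first `d` standard basis vectors of `K^n`. -/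
def firstCoordsSubspace (K : Type*) [Field K] (n d : ℕ) : Submodule K (Fin n → K) where
  carrier := {v | ∀ i : Fin n, d ≤ (i : ℕ) → v i = 0}
  add_mem' := fun hv hw i hi => by simp [hv i hi, hw i hi]
  zero_mem' := fun i _ => rfl
  smul_mem' := fun c v hv i hi => by simp [hv i hi]

/-- The Kalman variety `K_{s,d,n}`: matrices having an `s`-dimensional invariant
subspace contained in the span `L` of the first `d` standard basis vectors. -/
def kalmanSet (K : Type*) [Field K] (n d s : ℕ) : Set (Matrix (Fin n) (Fin n) K) :=
  {M | ∃ U : Submodule K (Fin n → K), U ≤ firstCoordsSubspace K n d ∧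
    Module.finrank K U = s ∧ ∀ v ∈ U, M.mulVec v ∈ U}

/-- The upper-left `d × d` block `α` of an `n × n` matrix. -/
def alphaBlock {K : Type*} [Field K] {n : ℕ} (d : ℕ) (h : d ≤ n)
    (M : Matrix (Fin n) (Fin n) K) : Matrix (Fin d) (Fin d) K :=
  fun i j => M (Fin.castLE h i) (Fin.castLE h j)

/-- The lower-left `(n-d) × d` block `γ` of an `n × n` matrix. -/
def gammaBlock {K : Type*} [Field K] {n : ℕ} (d : ℕ) (h : d ≤ n)
    (M : Matrix (Fin n) (Fin n) K) : Matrix (Fin (n - d)) (Fin d) K :=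
  fun i j => M ⟨d + (i : ℕ), by have := i.isLt; omega⟩ (Fin.castLE h j)

/-- The reduced Kalman matrix: the `d(n-d) × d` matrix obtained by stacking
`γ, γα, γα², …, γα^{d-1}`; row `(k, i)` is row `i` of the block `γ * α^k`. -/
def redKalman {K : Type*} [Field K] {n : ℕ} (d : ℕ) (h : d ≤ n)
    (M : Matrix (Fin n) (Fin n) K) : Matrix (Fin d × Fin (n - d)) (Fin d) K :=
  fun p j => (gammaBlock d h M * (alphaBlock d h M) ^ (p.1 : ℕ)) p.2 j

/-- The vanishing ideal of a set of `n × n` matrices, inside the polynomial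
coordinate ring `A = K[x_{ij}]` of the matrix space. -/
def matVanishingIdeal (K : Type*) [Field K] (n : ℕ)
    (S : Set (Matrix (Fin n) (Fin n) K)) : Ideal (MvPolynomial (Fin n × Fin n) K) where
  carrier := {f | ∀ M ∈ S, MvPolynomial.eval (fun p => M p.1 p.2) f = 0}
  add_mem' := fun ha hb M hM => by simp [ha M hM, hb M hM]
  zero_mem' := fun M hM => by simp
  smul_mem' := fun c f hf M hM => by simp [smul_eq_mul, hf M hM]

/-- The coordinate ring `A` of the space of `n × n` matrices. -/
abbrev MatCoordRing (K : Type*) [Field K] (n : ℕ) := MvPolynomial (Fin n × Fin n) K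

/-- The vanishing ideal `I_{s,d,n}` of the Kalman variety. -/
noncomputable def kalmanIdeal (K : Type*) [Field K] (n d s : ℕ) :
    Ideal (MatCoordRing K n) :=
  matVanishingIdeal K n (kalmanSet K n d s)

/-- The irrelevant (maximal graded) ideal `A₊` of the polynomial ring,
generated by all the variables. -/
noncomputable def irrelevantIdeal (K : Type*) [Field K] (n : ℕ) :
    Ideal (MatCoordRing K n) :=
  Ideal.span (Set.range MvPolynomial.X)

/-- The coordinate ring `O_{s,d,n} = A/I_{s,d,n}` of the Kalman variety. -/
abbrev KalmanCoordRing (K : Type*) [Field K] (n d s : ℕ) :=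
  MatCoordRing K n ⧸ kalmanIdeal K n d s

/-- The normalization `Õ_{s,d,n}`: the integral closure of `O_{s,d,n}` in its
total ring of fractions (which is its field of fractions when `O_{s,d,n}` is a
domain, e.g. when `K` is algebraically closed). -/
def KalmanNormalization (K : Type*) [Field K] (n d s : ℕ) : Type _ :=
  ↥(integralClosure (KalmanCoordRing K n d s) (FractionRing (KalmanCoordRing K n d s)))

noncomputable instance (K : Type*) [Field K] (n d s : ℕ) :
    CommRing (KalmanNormalization K n d s) :=
  Subalgebra.toCommRing (R := KalmanCoordRing K n d s)
    (A := FractionRing (KalmanCoordRing K n d s)) (integralClosure _ _)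

noncomputable instance (K : Type*) [Field K] (n d s : ℕ) :
    Algebra (KalmanCoordRing K n d s) (KalmanNormalization K n d s) :=
  Subalgebra.algebra (R := KalmanCoordRing K n d s)
    (A := FractionRing (KalmanCoordRing K n d s)) (integralClosure _ _)

noncomputable instance (K : Type*) [Field K] (n d s : ℕ) :
    Algebra (MatCoordRing K n) (KalmanNormalization K n d s) :=
  ((algebraMap (KalmanCoordRing K n d s) (KalmanNormalization K n d s)).comp
    (algebraMap (MatCoordRing K n) (KalmanCoordRing K n d s))).toAlgebra

instance (K : Type*) [Field K] (n d s : ℕ) :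
    IsScalarTower (MatCoordRing K n) (KalmanCoordRing K n d s)
      (KalmanNormalization K n d s) :=
  IsScalarTower.of_algebraMap_eq' (R := MatCoordRing K n)
    (S := KalmanCoordRing K n d s) (A := KalmanNormalization K n d s) rfl

noncomputable instance (K : Type*) [Field K] (n d s : ℕ) :
    Algebra K (KalmanNormalization K n d s) :=
  ((algebraMap (KalmanCoordRing K n d s) (KalmanNormalization K n d s)).comp
    (algebraMap K (KalmanCoordRing K n d s))).toAlgebra

instance (K : Type*) [Field K] (n d s : ℕ) :
    IsScalarTower K (MatCoordRing K n) (KalmanNormalization K n d s) :=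
  IsScalarTower.of_algebraMap_eq fun x => by
    show algebraMap (KalmanCoordRing K n d s) _ (algebraMap K _ x) =
      algebraMap (KalmanCoordRing K n d s) _
        (algebraMap (MatCoordRing K n) _ (algebraMap K (MatCoordRing K n) x))
    rw [← IsScalarTower.algebraMap_apply K (MatCoordRing K n) (KalmanCoordRing K n d s)]

/-- The inclusion of `O_{s,d,n}` into its normalization `Õ_{s,d,n}`,
as an `A`-module map. -/
noncomputable def kalmanNormInclusion (K : Type*) [Field K] (n d s : ℕ) :
    KalmanCoordRing K n d s →ₗ[MatCoordRing K n] KalmanNormalization K n d s :=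
  (IsScalarTower.toAlgHom (MatCoordRing K n) (KalmanCoordRing K n d s)
    (KalmanNormalization K n d s)).toLinearMap

section Depth

open CategoryTheory Abelian Pointwise

universe u

variable {A : Type u} [CommRing A]

/-- `DepthGE I r M` says that the `I`-depth of the `A`-module `M` is at least `r`,
in the sense of the vanishing of `Ext^i(A/I, M)` for `i < r`. -/
def DepthGE (I : Ideal A) (r : ℕ) (M : Type u) [AddCommGroup M] [Module A M] : Prop :=
  ∀ i < r, Subsingleton (Ext (ModuleCat.of A (A ⧸ I)) (ModuleCat.of A M) i)

variable {I : Ideal A} {r : ℕ} {X Y Z : Type u} [AddCommGroup X] [Module A X]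
  [AddCommGroup Y] [Module A Y] [AddCommGroup Z] [Module A Z]

lemma DepthGE.mono {r' : ℕ} (h : DepthGE I r X) (hr : r' ≤ r) : DepthGE I r' X :=
  fun i hi => h i (lt_of_lt_of_le hi hr)

lemma DepthGE.zero : DepthGE I 0 X := fun i hi => absurd hi (Nat.not_lt_zero i)

lemma shortExact_of_linearMap (f : X →ₗ[A] Y) (g : Y →ₗ[A] Z) (hf : Function.Injective f)
    (hfg : Function.Exact f g) (hg : Function.Surjective g) :
    (ModuleCat.shortComplexOfCompEqZero f g hfg.linearMap_comp_eq_zero).ShortExact :=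
  ModuleCat.shortComplex_shortExact _ hfg hf hg

lemma DepthGE.of_exact_right (f : X →ₗ[A] Y) (g : Y →ₗ[A] Z) (hf : Function.Injective f)
    (hfg : Function.Exact f g) (hg : Function.Surjective g)
    (hX : DepthGE I (r + 1) X) (hY : DepthGE I r Y) : DepthGE I r Z := by
  intro i hi
  have h := shortExact_of_linearMap f g hf hfg hg
  refine subsingleton_of_forall_eq 0 fun x => ?_
  have := hX (i + 1) (by omega)
  have := hY i hi
  obtain ⟨y, rfl⟩ := Ext.covariant_sequence_exact₃ _ h x rfl (Subsingleton.elim _ _)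
  rw [show y = 0 from Subsingleton.elim _ _]
  simp

lemma DepthGE.of_exact_mid (f : X →ₗ[A] Y) (g : Y →ₗ[A] Z) (hf : Function.Injective f)
    (hfg : Function.Exact f g) (hg : Function.Surjective g)
    (hX : DepthGE I r X) (hZ : DepthGE I r Z) : DepthGE I r Y := by
  intro i hi
  have h := shortExact_of_linearMap f g hf hfg hg
  refine subsingleton_of_forall_eq 0 fun x => ?_
  have := hX i hi
  have := hZ i hi
  obtain ⟨y, rfl⟩ := Ext.covariant_sequence_exact₂ _ h x (Subsingleton.elim _ _)
  rw [show y = 0 from Subsingleton.elim _ _]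
  simp

lemma DepthGE.of_subsingleton [Subsingleton X] : DepthGE I r X := by
  intro i _
  refine subsingleton_of_forall_eq 0 fun x => ?_
  have : (𝟙 (ModuleCat.of A X)) = 0 := by ext y; exact Subsingleton.elim _ _
  rw [← Ext.comp_mk₀_id x, this]
  simp

lemma DepthGE.equiv (e : X ≃ₗ[A] Y) (h : DepthGE I r X) : DepthGE I r Y :=
  DepthGE.of_exact_mid (Z := PUnit) e.toLinearMap 0 e.injective
    (fun y => ⟨fun _ => e.surjective y, fun _ => rfl⟩) (fun _ => ⟨0, Subsingleton.elim _ _⟩) h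
    DepthGE.of_subsingleton

lemma DepthGE.eq_zero_of_mem (h : DepthGE I 1 X) (x : X) (hx : ∀ a ∈ I, a • x = 0) : x = 0 := by
  have h0 := h 0 one_pos
  have := (Ext.addEquiv₀.trans (ModuleCat.homAddEquiv (M := ModuleCat.of A (A ⧸ I))
    (N := ModuleCat.of A X))).symm.injective.subsingleton
  have h1 : (Submodule.liftQ I (LinearMap.toSpanSingleton A X x)
      (fun a ha => hx a ha) : (A ⧸ I) →ₗ[A] X) = 0 := this.elim _ _
  have h2 := LinearMap.congr_fun h1 (Submodule.Quotient.mk 1)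
  exact (one_smul A x).symm.trans h2

lemma DepthGE.of_isSMulRegular {a : A} (ha : a ∈ I) (hreg : IsSMulRegular X a)
    (h : DepthGE I r (QuotSMulTop a X)) : DepthGE I (r + 1) X := by
  intro i hi
  refine subsingleton_of_forall_eq 0 fun x => ?_
  have hSE := hreg.smulShortComplex_shortExact (M := ModuleCat.of A X)
  have hkill : a • x = 0 := by
    have h0 : a • 𝟙 (ModuleCat.of A (A ⧸ I)) = 0 := by
      refine ModuleCat.hom_ext (LinearMap.ext fun y => ?_)
      obtain ⟨y, rfl⟩ := Ideal.Quotient.mk_surjective y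
      change Ideal.Quotient.mk I (a * y) = 0
      exact Ideal.Quotient.eq_zero_iff_mem.mpr (I.mul_mem_right _ ha)
    have : a • x = (Ext.mk₀ (a • 𝟙 (ModuleCat.of A (A ⧸ I)))).comp x (zero_add i) := by
      simp [Ext.mk₀_smul]
    rw [this, h0]
    simp
  have hk : x.comp (Ext.mk₀ (ModuleCat.smulShortComplex (ModuleCat.of A X) a).f)
      (add_zero i) = 0 := by
    change x.comp (Ext.mk₀ (a • 𝟙 (ModuleCat.of A X))) (add_zero i) = 0
    rw [Ext.mk₀_smul, Ext.comp_smul, Ext.comp_mk₀_id, hkill]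
  rcases i with _ | i
  · obtain ⟨x, rfl⟩ := Ext.addEquiv₀.symm.surjective x
    have h1 := Ext.postcomp_mk₀_injective_of_mono (ModuleCat.of A (A ⧸ I))
      (ModuleCat.smulShortComplex (ModuleCat.of A X) a).f (hf := hSE.mono_f)
    exact h1 (hk.trans (map_zero _).symm)
  · have := h i (by omega)
    obtain ⟨y, rfl⟩ := Ext.covariant_sequence_exact₁ _ hSE x hk rfl
    rw [show y = 0 from @Subsingleton.elim _ (h i (by omega)) _ _]
    exact Ext.zero_comp (C := ModuleCat A) _ _ hSE.extClass (i + 1) rfl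

/-- Converse direction: the depth drops by at most one modulo a nonzerodivisor. -/
lemma DepthGE.quotSMulTop {a : A} (hreg : IsSMulRegular X a)
    (h : DepthGE I (r + 1) X) : DepthGE I r (QuotSMulTop a X) :=
  DepthGE.of_exact_right (LinearMap.lsmul A X a) (a • (⊤ : Submodule A X)).mkQ hreg
    (LinearMap.exact_lsmul_mkQ_smul_top X a) (Submodule.mkQ_surjective _) h
    (h.mono (Nat.le_succ r))

lemma DepthGE.eq_zero_of_pow {σ : Type*} (T : Finset σ) (g : σ → A)
    (h : DepthGE (Ideal.span (g '' T)) 1 X) (x : X)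
    (hx : ∀ j ∈ T, ∃ N : ℕ, g j ^ N • x = 0) : x = 0 := by
  classical
  by_contra hne
  have key : ∃ N : ℕ, ∀ a ∈ Ideal.span (g '' T) ^ N, a • x = 0 := by
    have hrad : Ideal.span (g '' T) ≤ Ideal.radical (LinearMap.ker (LinearMap.toSpanSingleton A X x) : Ideal A) := by
      rw [Ideal.span_le]
      rintro _ ⟨j, hj, rfl⟩
      obtain ⟨N, hN⟩ := hx j hj
      exact ⟨N, by simpa using hN⟩
    obtain ⟨N, hN⟩ := Ideal.exists_pow_le_of_le_radical_of_fg hrad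
      ⟨T.image g, by simp [Ideal.span]⟩
    exact ⟨N, fun a ha => by simpa using hN ha⟩
  have hm := Nat.find_spec key
  rcases hN : Nat.find key with _ | N
  · rw [hN] at hm
    exact hne (by simpa using hm 1 (by simp))
  · rw [hN] at hm
    refine Nat.find_min key (m := N) (by omega) fun a ha => h.eq_zero_of_mem _ fun b hb => ?_
    rw [smul_smul, mul_comm]
    exact hm _ (by rw [pow_succ]; exact Ideal.mul_mem_mul ha hb)

end Depth

/-- The symmetric algebra of a module (a wrapper around `SymmetricAlgebra`). -/
def SymA.{u, v} (A : Type u) (C : Type v) [CommRing A] [AddCommGroup C] [Module A C] :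
    Type (max u v) := SymmetricAlgebra A C

namespace SymA

section Basic

variable {A C : Type*} [CommRing A] [AddCommGroup C] [Module A C]

noncomputable instance : CommRing (SymA A C) := inferInstanceAs (CommRing (SymmetricAlgebra A C))

noncomputable instance : Algebra A (SymA A C) :=
  inferInstanceAs (Algebra A (SymmetricAlgebra A C))

variable (A C) in
/-- The canonical map of a module into its symmetric algebra. -/
noncomputable def ι : C →ₗ[A] SymA A C := SymmetricAlgebra.ι A C

@[elab_as_elim]
theorem induction {motive : SymA A C → Prop}
    (algebraMap : ∀ r, motive (algebraMap A (SymA A C) r)) (ι : ∀ x, motive (ι A C x))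
    (mul : ∀ a b, motive a → motive b → motive (a * b))
    (add : ∀ a b, motive a → motive b → motive (a + b)) (a : SymA A C) : motive a :=
  SymmetricAlgebra.induction (R := A) (M := C) (motive := motive) algebraMap ι mul add a

variable {R : Type*} [CommRing R]

lemma exists_lift (θ : A →+* R) (f : C →+ R) (h : ∀ a c, f (a • c) = θ a * f c) :
    ∃ F : SymA A C →+* R, (∀ a, F (algebraMap A _ a) = θ a) ∧ ∀ c, F (ι A C c) = f c := by
  let := θ.toAlgebra
  let f' : C →ₗ[A] R := { f with map_smul' := fun a c => (h a c).trans (Algebra.smul_def a _).symm }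
  refine ⟨(SymmetricAlgebra.lift f').toRingHom, fun a => ?_, fun c => ?_⟩
  · exact (SymmetricAlgebra.lift f').commutes a
  · exact SymmetricAlgebra.lift_ι_apply f' c

/-- Universal property of the symmetric algebra, in semilinear form. -/
noncomputable def lift (θ : A →+* R) (f : C →+ R) (h : ∀ a c, f (a • c) = θ a * f c) :
    SymA A C →+* R := (exists_lift θ f h).choose

@[simp]
lemma lift_algebraMap (θ : A →+* R) (f : C →+ R) (h : ∀ a c, f (a • c) = θ a * f c) (a : A) :
    lift θ f h (algebraMap A _ a) = θ a := (exists_lift θ f h).choose_spec.1 a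

@[simp]
lemma lift_ι (θ : A →+* R) (f : C →+ R) (h : ∀ a c, f (a • c) = θ a * f c) (c : C) :
    lift θ f h (ι A C c) = f c := (exists_lift θ f h).choose_spec.2 c

lemma hom_ext {F G : SymA A C →+* R} (h1 : ∀ a, F (algebraMap A _ a) = G (algebraMap A _ a))
    (h2 : ∀ c, F (ι A C c) = G (ι A C c)) (x : SymA A C) : F x = G x := by
  induction x using SymA.induction with
  | algebraMap r => exact h1 r
  | ι x => exact h2 x
  | mul a b ha hb => rw [map_mul, map_mul, ha, hb]
  | add a b ha hb => rw [map_add, map_add, ha, hb]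

lemma algebraMap_injective : Function.Injective (algebraMap A (SymA A C)) := by
  have : ∀ a, lift (C := C) (RingHom.id A) 0 (by simp) (algebraMap A _ a) = a := fun a => by simp
  exact Function.LeftInverse.injective this

lemma ι_injective : Function.Injective (ι A C) := by
  let : Module Aᵐᵒᵖ C := Module.compHom C ((RingHom.id A).fromOpposite fun x y => mul_comm _ _)
  have : IsCentralScalar A C := ⟨fun a c => rfl⟩
  have h : ∀ c, lift (R := TrivSqZeroExt A C) (algebraMap A _) (TrivSqZeroExt.inrHom A C).toAddMonoidHom
    (fun a c => by simp [TrivSqZeroExt.algebraMap_eq_inl, TrivSqZeroExt.inl_mul_inr]) (ι A C c) =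
      TrivSqZeroExt.inr c := fun c => by rw [lift_ι]; rfl
  intro x y hxy
  apply TrivSqZeroExt.inr_injective (R := A)
  rw [← h, ← h, hxy]

variable (A C) in
/-- The degree `u` part of the symmetric algebra. -/
noncomputable def deg (u : ℕ) : Submodule A (SymA A C) := (LinearMap.range (ι A C)) ^ u

lemma ι_mem (c : C) : ι A C c ∈ deg A C 1 := by
  rw [deg, pow_one]; exact ⟨c, rfl⟩

lemma mem_deg_zero {x : SymA A C} : x ∈ deg A C 0 ↔ ∃ a, algebraMap A _ a = x := by
  rw [deg, pow_zero, Submodule.mem_one]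

lemma mul_mem {u v : ℕ} {x y : SymA A C} (hx : x ∈ deg A C u) (hy : y ∈ deg A C v) :
    x * y ∈ deg A C (u + v) := by
  rw [deg, pow_add]; exact Submodule.mul_mem_mul hx hy

lemma ι_mul_mem {u : ℕ} (c : C) {y : SymA A C} (hy : y ∈ deg A C u) :
    ι A C c * y ∈ deg A C (u + 1) := by
  rw [add_comm]; exact mul_mem (ι_mem c) hy

lemma ι_pow_mem (u : ℕ) (c : C) : ι A C c ^ u ∈ deg A C u := by
  induction u with
  | zero => rw [pow_zero, mem_deg_zero]; exact ⟨1, map_one _⟩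
  | succ u ih => rw [pow_succ']; exact ι_mul_mem c ih

@[elab_as_elim]
lemma deg_succ_induction {u : ℕ} {p : SymA A C → Prop} {x : SymA A C} (hx : x ∈ deg A C (u + 1))
    (hmul : ∀ c, ∀ y ∈ deg A C u, p (ι A C c * y)) (hadd : ∀ y z, p y → p z → p (y + z)) : p x := by
  rw [deg, pow_succ'] at hx
  refine Submodule.mul_induction_on hx ?_ hadd
  rintro _ ⟨c, rfl⟩ y hy
  exact hmul c y hy

lemma deg_eq_bot [Subsingleton C] {u : ℕ} (hu : u ≠ 0) {x : SymA A C} (hx : x ∈ deg A C u) :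
    x = 0 := by
  obtain ⟨u, rfl⟩ := Nat.exists_eq_succ_of_ne_zero hu
  refine deg_succ_induction hx (fun c y _ => ?_) (fun y z hy hz => by rw [hy, hz, add_zero])
  rw [Subsingleton.elim c 0, map_zero, zero_mul]

open Polynomial in
/-- The grading coaction `ι c ↦ ι c * X`. -/
noncomputable def coact : SymA A C →+* Polynomial (SymA A C) :=
  lift (Polynomial.C.comp (algebraMap A (SymA A C)))
    (((LinearMap.mulRight (Polynomial (SymA A C)) Polynomial.X).toAddMonoidHom.comp
      (Polynomial.C : SymA A C →+* _).toAddMonoidHom).comp (ι A C).toAddMonoidHom)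
    (by intro a c; simp [Algebra.smul_def, mul_assoc])

lemma coact_ι (c : C) : coact (ι A C c) = Polynomial.C (ι A C c) * Polynomial.X := by
  simp [coact]

lemma coact_algebraMap (a : A) :
    coact (algebraMap A (SymA A C) a) = Polynomial.C (algebraMap A (SymA A C) a) := by
  simp [coact]

lemma coact_of_mem {u : ℕ} {x : SymA A C} (hx : x ∈ deg A C u) :
    coact x = Polynomial.C x * Polynomial.X ^ u := by
  induction u generalizing x with
  | zero =>
    obtain ⟨a, rfl⟩ := mem_deg_zero.mp hx
    simp [coact_algebraMap]
  | succ u ih =>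
    refine deg_succ_induction hx (fun c y hy => ?_) (fun y z hy hz => ?_)
    · rw [map_mul, coact_ι, ih hy, map_mul]; ring
    · rw [map_add, hy, hz, map_add]; ring

lemma coeff_coact_mem (x : SymA A C) (u : ℕ) : (coact x).coeff u ∈ deg A C u := by
  induction x using SymA.induction generalizing u with
  | algebraMap r =>
    rw [coact_algebraMap, Polynomial.coeff_C]
    split_ifs with h
    · subst h; exact mem_deg_zero.mpr ⟨r, rfl⟩
    · exact Submodule.zero_mem _
  | ι x =>
    rw [coact_ι, Polynomial.coeff_C_mul, Polynomial.coeff_X]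
    split_ifs with h
    · subst h; rw [mul_one]; exact ι_mem x
    · rw [mul_zero]; exact Submodule.zero_mem _
  | mul a b ha hb =>
    rw [map_mul, Polynomial.coeff_mul]
    refine Submodule.sum_mem _ fun p hp => ?_
    rw [← Finset.HasAntidiagonal.mem_antidiagonal.mp hp]
    exact mul_mem (ha _) (hb _)
  | add a b ha hb => rw [map_add, Polynomial.coeff_add]; exact Submodule.add_mem _ (ha u) (hb u)

lemma exists_of_mem_deg_succ {u : ℕ} {x w : SymA A C} {c : C} (hx : x ∈ deg A C (u + 1))
    (h : x = ι A C c * w) : ∃ z ∈ deg A C u, x = ι A C c * z := by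
  refine ⟨(coact w).coeff u, coeff_coact_mem w u, ?_⟩
  have := congrArg (fun p => (coact p).coeff (u + 1)) h
  simpa [coact_of_mem hx, map_mul, coact_ι, mul_assoc, Polynomial.coeff_X_mul] using this

lemma eq_zero_of_mem_deg_zero {x w : SymA A C} {c : C} (hx : x ∈ deg A C 0)
    (h : x = ι A C c * w) : x = 0 := by
  have := congrArg (fun p => (coact p).coeff 0) h
  simpa [coact_of_mem hx, map_mul, coact_ι, mul_assoc] using this

end Basic

section Map

variable {A C B D : Type*} [CommRing A] [AddCommGroup C] [Module A C] [CommRing B]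
  [AddCommGroup D] [Module B D]

/-- Functoriality of the symmetric algebra along a semilinear map. -/
noncomputable def map (θ : A →+* B) (f : C →+ D) (h : ∀ a c, f (a • c) = θ a • f c) :
    SymA A C →+* SymA B D :=
  lift ((algebraMap B _).comp θ) ((ι B D).toAddMonoidHom.comp f)
    (by intro a c; simp [h, Algebra.smul_def])

variable (θ : A →+* B) (f : C →+ D) (h : ∀ a c, f (a • c) = θ a • f c)

@[simp]
lemma map_ι (c : C) : map θ f h (ι A C c) = ι B D (f c) := lift_ι _ _ _ c

@[simp]
lemma map_algebraMap (a : A) : map θ f h (algebraMap A _ a) = algebraMap B _ (θ a) :=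
  lift_algebraMap _ _ _ a

lemma map_smul (a : A) (x : SymA A C) : map θ f h (a • x) = θ a • map θ f h x := by
  rw [Algebra.smul_def, map_mul, map_algebraMap, Algebra.smul_def]

lemma map_mem {u : ℕ} {x : SymA A C} (hx : x ∈ deg A C u) : map θ f h x ∈ deg B D u := by
  induction u generalizing x with
  | zero =>
    obtain ⟨a, rfl⟩ := mem_deg_zero.mp hx
    rw [map_algebraMap]; exact mem_deg_zero.mpr ⟨_, rfl⟩
  | succ u ih =>
    refine deg_succ_induction hx (fun c y hy => ?_) (fun y z hy hz => ?_)
    · rw [map_mul, map_ι]; exact ι_mul_mem _ (ih hy)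
    · rw [map_add]; exact Submodule.add_mem _ hy hz

end Map

section LinMap

variable {A C D : Type*} [CommRing A] [AddCommGroup C] [Module A C]
  [AddCommGroup D] [Module A D]

/-- Functoriality of the symmetric algebra along a linear map. -/
noncomputable def lmap (f : C →ₗ[A] D) : SymA A C →+* SymA A D :=
  map (RingHom.id A) f.toAddMonoidHom (by intro a c; simp)

variable (f : C →ₗ[A] D)

@[simp] lemma lmap_ι (c : C) : lmap f (ι A C c) = ι A D (f c) := map_ι _ _ _ c

@[simp] lemma lmap_algebraMap (a : A) : lmap f (algebraMap A _ a) = algebraMap A _ a :=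
  map_algebraMap _ _ _ a

lemma lmap_smul (a : A) (x : SymA A C) : lmap f (a • x) = a • lmap f x := map_smul _ _ _ a x

lemma lmap_mem {u : ℕ} {x : SymA A C} (hx : x ∈ deg A C u) : lmap f x ∈ deg A D u :=
  map_mem _ _ _ hx

lemma lmap_surj (hf : Function.Surjective f) {u : ℕ} {y : SymA A D} (hy : y ∈ deg A D u) :
    ∃ x ∈ deg A C u, lmap f x = y := by
  induction u generalizing y with
  | zero =>
    obtain ⟨a, rfl⟩ := mem_deg_zero.mp hy
    exact ⟨algebraMap A _ a, mem_deg_zero.mpr ⟨_, rfl⟩, by simp⟩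
  | succ u ih =>
    refine deg_succ_induction hy (fun d y hy => ?_) ?_
    · obtain ⟨x, hx, rfl⟩ := ih hy
      obtain ⟨c, rfl⟩ := hf d
      exact ⟨ι A C c * x, ι_mul_mem c hx, by simp⟩
    · rintro _ _ ⟨x, hx, rfl⟩ ⟨x', hx', rfl⟩
      exact ⟨x + x', Submodule.add_mem _ hx hx', map_add _ _ _⟩

lemma exists_mul_of_lmap_eq_zero (hf : Function.Surjective f) (c : C)
    (hc : LinearMap.ker f ≤ Submodule.span A {c}) {x : SymA A C} (hx : lmap f x = 0) :
    ∃ w, x = ι A C c * w := by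
  let Q := SymA A C ⧸ Ideal.span {ι A C c}
  let q : C →ₗ[A] Q := (Ideal.Quotient.mkₐ A (Ideal.span {ι A C c})).toLinearMap ∘ₗ ι A C
  have hq : LinearMap.ker f ≤ LinearMap.ker q := by
    refine hc.trans ?_
    rw [Submodule.span_singleton_le_iff_mem, LinearMap.mem_ker]
    exact Ideal.Quotient.eq_zero_iff_mem.mpr (Ideal.mem_span_singleton_self _)
  let g : D →ₗ[A] Q := (Submodule.liftQ _ q hq) ∘ₗ (f.quotKerEquivOfSurjective hf).symm.toLinearMap
  have hg : ∀ c, g (f c) = q c := by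
    intro c
    have : (f.quotKerEquivOfSurjective hf).symm (f c) = Submodule.Quotient.mk c := by
      rw [LinearEquiv.symm_apply_eq]; rfl
    simp only [g, LinearMap.comp_apply, LinearEquiv.coe_coe, this]
    rfl
  obtain ⟨G, hG1, hG2⟩ := exists_lift (C := D) (algebraMap A Q) g.toAddMonoidHom
    (by intro a c; simp [Algebra.smul_def])
  have key : ∀ x, (G.comp (lmap f)) x = Ideal.Quotient.mk (Ideal.span {ι A C c}) x := by
    refine hom_ext (fun a => ?_) (fun c => ?_)
    · rw [RingHom.comp_apply, lmap_algebraMap, hG1]; rfl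
    · rw [RingHom.comp_apply, lmap_ι, hG2]
      exact hg c
  have h0 := key x
  rw [RingHom.comp_apply, hx, map_zero, eq_comm, Ideal.Quotient.eq_zero_iff_mem,
    Ideal.mem_span_singleton] at h0
  exact h0

lemma exists_mul_of_lmap_eq_zero_deg (hf : Function.Surjective f) (c : C)
    (hc : LinearMap.ker f ≤ Submodule.span A {c}) {u : ℕ} {x : SymA A C}
    (hxu : x ∈ deg A C (u + 1)) (hx : lmap f x = 0) :
    ∃ w ∈ deg A C u, x = ι A C c * w := by
  obtain ⟨w, hw⟩ := exists_mul_of_lmap_eq_zero f hf c hc hx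
  exact exists_of_mem_deg_succ hxu hw

/-- Restriction of `lmap` to degree `u`. -/
noncomputable def degMap (u : ℕ) : deg A C u →ₗ[A] deg A D u where
  toFun x := ⟨lmap f x, lmap_mem f x.2⟩
  map_add' _ _ := Subtype.ext (map_add _ _ _)
  map_smul' a x := Subtype.ext (lmap_smul f a x)

variable (A) in
/-- Multiplication by `ι c` from degree `u` to degree `u + 1`. -/
noncomputable def mulMap (c : C) (u : ℕ) : deg A C u →ₗ[A] deg A C (u + 1) where
  toFun x := ⟨ι A C c * x, ι_mul_mem c x.2⟩
  map_add' x y := Subtype.ext (mul_add _ _ _)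
  map_smul' a x := Subtype.ext (by simp)

@[simp] lemma degMap_coe (u : ℕ) (x : deg A C u) : (degMap f u x : SymA A D) = lmap f x := rfl

@[simp] lemma mulMap_coe (c : C) (u : ℕ) (x : deg A C u) :
    (mulMap A c u x : SymA A C) = ι A C c * x := rfl

lemma degMap_surjective (hf : Function.Surjective f) (u : ℕ) :
    Function.Surjective (degMap f u) := by
  rintro ⟨y, hy⟩
  obtain ⟨x, hx, rfl⟩ := lmap_surj f hf hy
  exact ⟨⟨x, hx⟩, rfl⟩

lemma exact_mulMap_degMap (hf : Function.Surjective f) (c : C)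
    (hc : LinearMap.ker f = Submodule.span A {c}) (u : ℕ) :
    Function.Exact (mulMap A c u) (degMap f (u + 1)) := by
  rintro ⟨x, hx⟩
  constructor
  · intro h
    obtain ⟨w, hw, h⟩ := exists_mul_of_lmap_eq_zero_deg f hf c hc.le hx (congrArg Subtype.val h)
    exact ⟨⟨w, hw⟩, Subtype.ext h.symm⟩
  · rintro ⟨w, hw⟩
    have : f c = 0 := by
      rw [← LinearMap.mem_ker, hc]; exact Submodule.mem_span_singleton_self c
    rw [← hw]
    exact Subtype.ext (by simp [this])

end LinMap

/-- The degree zero part of the symmetric algebra is the base ring. -/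
noncomputable def degZeroEquiv (A C : Type*) [CommRing A] [AddCommGroup C] [Module A C] :
    A ≃ₗ[A] deg A C 0 :=
  LinearEquiv.ofBijective
    ((Algebra.linearMap A (SymA A C)).codRestrict (deg A C 0)
      (fun a => mem_deg_zero.mpr ⟨a, rfl⟩))
    ⟨fun a b h => algebraMap_injective (C := C) (congrArg Subtype.val h), fun ⟨x, hx⟩ => by
      obtain ⟨a, rfl⟩ := mem_deg_zero.mp hx
      exact ⟨a, rfl⟩⟩

instance {A C : Type*} [CommRing A] [IsDomain A] [AddCommGroup C] [Module A C] [Module.Free A C] :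
    IsDomain (SymA A C) := inferInstanceAs (IsDomain (SymmetricAlgebra A C))

end SymA

/-- A semilinear map exhibiting its target as the localization of its source away from `g`. -/
structure IsLocMap {A M M' : Type*} [CommRing A] [AddCommGroup M] [Module A M] (g : A)
    (B : Type*) [CommRing B] [Algebra A B] [AddCommGroup M'] [Module B M'] (f : M →+ M') :
    Prop where
  smul : ∀ (a : A) (x : M), f (a • x) = algebraMap A B a • f x
  ker : ∀ x, f x = 0 → ∃ N : ℕ, g ^ N • x = 0
  surj : ∀ y, ∃ (N : ℕ) (x : M), f x = algebraMap A B g ^ N • y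

namespace SymA

section Loc

variable {A M M' B : Type*} [CommRing A] [AddCommGroup M] [Module A M] {g : A}
    [CommRing B] [Algebra A B] [IsLocalization.Away g B] [AddCommGroup M'] [Module B M']
    {f : M →+ M'}

lemma exists_pow_smul_of_map_eq_zero (hf : IsLocMap g B f) {x : SymA A M}
    (hx : map (algebraMap A B) f hf.smul x = 0) : ∃ N : ℕ, g ^ N • x = 0 := by
  let S := SymA A M
  let gS : S := algebraMap A S g
  let SL := Localization.Away gS
  let gL : SL := algebraMap S SL gS
  have hunit : IsUnit gL := IsLocalization.Away.algebraMap_isUnit gS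
  have hreg : ∀ (n : ℕ) (a b : SL), gL ^ n * a = gL ^ n * b → a = b := fun n a b h =>
    (hunit.pow n).mul_left_cancel h
  let θ' : B →+* SL := IsLocalization.Away.lift g
    (g := (algebraMap S SL).comp (algebraMap A S)) hunit
  have hθ : ∀ a, θ' (algebraMap A B a) = algebraMap S SL (algebraMap A S a) := fun a =>
    IsLocalization.Away.lift_eq g hunit a
  have hιsmul : ∀ (a : A) (x : M), algebraMap S SL (ι A M (a • x)) =
      algebraMap S SL (algebraMap A S a) * algebraMap S SL (ι A M x) := fun a x => by
    rw [_root_.map_smul, Algebra.smul_def, map_mul]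
  have hιpow : ∀ (n : ℕ) (x : M), algebraMap S SL (ι A M (g ^ n • x)) =
      gL ^ n * algebraMap S SL (ι A M x) := fun n x => by rw [hιsmul, map_pow, map_pow]
  have hfpow : ∀ (n : ℕ) (x : M), f (g ^ n • x) = algebraMap A B g ^ n • f x := fun n x => by
    rw [hf.smul, map_pow]
  have hex : ∀ y : M', ∃ z : SL, ∀ (N : ℕ) (x : M), f x = algebraMap A B g ^ N • y →
      algebraMap S SL (ι A M x) = gL ^ N * z := by
    intro y
    obtain ⟨N, x, hx⟩ := hf.surj y
    obtain ⟨v, hv⟩ := (hunit.pow N).exists_right_inv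
    refine ⟨v * algebraMap S SL (ι A M x), fun N' x' hx' => ?_⟩
    have : f (g ^ N • x' - g ^ N' • x) = 0 := by
      rw [map_sub, hfpow, hfpow, hx, hx', smul_smul, smul_smul, mul_comm, sub_self]
    obtain ⟨k, hk⟩ := hf.ker _ this
    apply hreg N
    apply hreg k
    have h2 : algebraMap S SL (ι A M (g ^ k • (g ^ N • x' - g ^ N' • x))) = 0 := by
      rw [hk, map_zero, map_zero]
    rw [hιpow, map_sub, map_sub, hιpow, hιpow] at h2
    linear_combination h2 - gL ^ k * gL ^ N' * (algebraMap S SL (ι A M x)) * hv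
  choose f' hf' using hex
  let F : M' →+ SL := AddMonoidHom.mk' f' (by
    intro y1 y2
    obtain ⟨N1, x1, h1⟩ := hf.surj y1
    obtain ⟨N2, x2, h2⟩ := hf.surj y2
    have h3 := hf' (y1 + y2) (N1 + N2) (g ^ N2 • x1 + g ^ N1 • x2) (by
      rw [map_add, hfpow, hfpow, h1, h2, smul_smul, smul_smul, smul_add, ← pow_add, ← pow_add,
        add_comm N2 N1])
    rw [map_add, map_add, hιpow, hιpow, hf' y1 N1 x1 h1, hf' y2 N2 x2 h2] at h3
    apply hreg (N1 + N2)
    rw [← h3]; ring)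
  have hF : ∀ (b : B) (y : M'), F (b • y) = θ' b * F y := by
    intro b y
    obtain ⟨N, x, h1⟩ := hf.surj y
    obtain ⟨n, a, h2⟩ := IsLocalization.Away.surj g b
    have h3 := hf' (b • y) (n + N) (a • x) (by
      rw [hf.smul, h1, ← h2, smul_smul, smul_smul]; congr 1; ring)
    rw [hιsmul, hf' y N x h1, ← hθ, ← h2, map_mul, map_pow, hθ] at h3
    apply hreg (n + N)
    change gL ^ (n + N) * f' (b • y) = gL ^ (n + N) * (θ' b * f' y)
    rw [← h3]; ring
  have key : ∀ x, ((lift θ' F hF).comp (map (algebraMap A B) f hf.smul)) x =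
      algebraMap S SL x := by
    refine hom_ext (fun a => ?_) (fun c => ?_)
    · rw [RingHom.comp_apply, map_algebraMap, lift_algebraMap, hθ]
    · rw [RingHom.comp_apply, map_ι, lift_ι, hf' (f c) 0 c (by simp)]
      simp [F]
  have h0 := key x
  rw [RingHom.comp_apply, hx, map_zero, eq_comm,
    IsLocalization.map_eq_zero_iff (Submonoid.powers gS)] at h0
  obtain ⟨⟨_, N, rfl⟩, hN⟩ := h0
  refine ⟨N, ?_⟩
  rw [Algebra.smul_def, map_pow]
  exact hN

lemma exists_map_eq_pow_smul (hf : IsLocMap g B f) {u : ℕ} {y : SymA B M'}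
    (hy : y ∈ deg B M' u) : ∃ N : ℕ, ∃ x ∈ deg A M u,
      map (algebraMap A B) f hf.smul x = algebraMap A B g ^ N • y := by
  induction u generalizing y with
  | zero =>
    obtain ⟨b, rfl⟩ := mem_deg_zero.mp hy
    obtain ⟨n, a, h2⟩ := IsLocalization.Away.surj g b
    refine ⟨n, algebraMap A _ a, mem_deg_zero.mpr ⟨a, rfl⟩, ?_⟩
    rw [map_algebraMap, ← h2, Algebra.smul_def, ← map_mul, mul_comm]
  | succ u ih =>
    refine deg_succ_induction hy (fun c y hy => ?_) (fun y z hy hz => ?_)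
    · obtain ⟨N, x, hx, h1⟩ := ih hy
      obtain ⟨N', x', h2⟩ := hf.surj c
      refine ⟨N + N', ι A M x' * x, ι_mul_mem _ hx, ?_⟩
      rw [map_mul, h1, map_ι, h2, _root_.map_smul, smul_mul_smul_comm, pow_add, mul_comm]
    · obtain ⟨N, x, hx, h1⟩ := hy
      obtain ⟨N', x', hx', h2⟩ := hz
      refine ⟨N + N', g ^ N' • x + g ^ N • x', Submodule.add_mem _ (Submodule.smul_mem _ _ hx)
        (Submodule.smul_mem _ _ hx'), ?_⟩
      rw [map_add, map_smul, map_smul, h1, h2, map_pow, map_pow, smul_smul, smul_smul, smul_add,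
        ← pow_add, ← pow_add, add_comm N' N]

end Loc

universe u

lemma depthGE_deg_free {A : Type u} [CommRing A] [IsDomain A] {I : Ideal A} {r : ℕ}
    (h : DepthGE I r A) (m u : ℕ) : DepthGE I r (deg A (Fin m → A) u) := by
  induction m generalizing u with
  | zero =>
    rcases u with _ | u
    · exact h.equiv (degZeroEquiv A _)
    · have : Subsingleton (deg A (Fin 0 → A) (u + 1)) :=
        ⟨fun x y => Subtype.ext ((deg_eq_bot (Nat.succ_ne_zero u) x.2).trans
          (deg_eq_bot (Nat.succ_ne_zero u) y.2).symm)⟩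
      exact DepthGE.of_subsingleton
  | succ m ih =>
    induction u with
    | zero => exact h.equiv (degZeroEquiv A _)
    | succ u ihu =>
      let f : (Fin (m + 1) → A) →ₗ[A] (Fin m → A) := LinearMap.funLeft A A Fin.succ
      let c : Fin (m + 1) → A := Pi.single 0 1
      have hfs : Function.Surjective f := fun y => ⟨Fin.cons 0 y, by
        funext j; simp [f, LinearMap.funLeft]⟩
      have hker : LinearMap.ker f = Submodule.span A {c} := by
        ext y
        rw [LinearMap.mem_ker, Submodule.mem_span_singleton]
        constructor
        · intro hy
          refine ⟨y 0, ?_⟩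
          funext i
          refine Fin.cases ?_ (fun j => ?_) i
          · simp [c]
          · have := congrFun hy j
            simp [f, LinearMap.funLeft] at this
            simp [c, this]
        · rintro ⟨a, rfl⟩
          funext j
          simp [f, c, LinearMap.funLeft]
      refine DepthGE.of_exact_mid (mulMap A c u) (degMap f (u + 1)) ?_
        (exact_mulMap_degMap f hfs c hker u) (degMap_surjective f hfs _) ihu (ih _)
      intro x y hxy
      have hc : ι A (Fin (m + 1) → A) c ≠ 0 := by
        rw [Ne, map_eq_zero_iff _ ι_injective]
        intro h0
        have := congrFun h0 0
        simp [c] at this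
      exact Subtype.ext (mul_left_cancel₀ hc (congrArg Subtype.val hxy))

end SymA

section Obs

variable {A : Type*} [CommRing A] {σ : Type} [Fintype σ] [DecidableEq σ]

/-- The vector of the first `m` entries `(γ α^k)_j`, `k < m`, of the observability matrix. -/
def obsVec (α : Matrix σ σ A) (γ : σ → A) (m : ℕ) (j : σ) : Fin m → A :=
  fun k => (γ ᵥ* α ^ (k : ℕ)) j

/-- The quotient of `A^m` by the vectors `obsVec α γ m j` with `j ∈ T`. -/
abbrev ObsMod (α : Matrix σ σ A) (γ : σ → A) (m : ℕ) (T : Finset σ) : Type _ :=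
  (Fin m → A) ⧸ Submodule.span A (obsVec α γ m '' (T : Set σ))

/-- The class of the last basis vector in `ObsMod`. -/
def obsLast (α : Matrix σ σ A) (γ : σ → A) (m : ℕ) (T : Finset σ) : ObsMod α γ (m + 1) T :=
  Submodule.Quotient.mk (Pi.single (Fin.last m) 1)

end Obs

section Chart

variable {A : Type*} [CommRing A] {σ : Type} [Fintype σ] [DecidableEq σ]
  (B : Type*) [CommRing B] [Algebra A B] (α : Matrix σ σ A) (γ : σ → A) (i : σ)
  [IsLocalization.Away (γ i) B]

/-- The ratio `γ_j / γ_i`. -/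
noncomputable def chartRatio (j : σ) : B :=
  algebraMap A B (γ j) * IsLocalization.Away.invSelf (γ i)

/-- The transformed matrix on the chart `γ_i ≠ 0`. -/
noncomputable def chartMat : Matrix {j // j ≠ i} {j // j ≠ i} B :=
  fun k j => algebraMap A B (α k j) - chartRatio B γ i j * algebraMap A B (α k i)

/-- The transformed covector on the chart `γ_i ≠ 0`. -/
noncomputable def chartVec : {j // j ≠ i} → B :=
  fun j => algebraMap A B ((γ ᵥ* α) j) - chartRatio B γ i j * algebraMap A B ((γ ᵥ* α) i)

lemma chartRatio_self : chartRatio B γ i i = 1 := IsLocalization.Away.mul_invSelf (γ i)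

lemma chartRatio_mul (j : σ) : chartRatio B γ i j * algebraMap A B (γ i) = algebraMap A B (γ j) := by
  have := chartRatio_self B γ i
  unfold chartRatio at *
  linear_combination algebraMap A B (γ j) * this

/-- The reduction of a row vector on the chart. -/
noncomputable def chartRed (r : σ → A) : {j // j ≠ i} → B :=
  fun j => algebraMap A B (r j) - chartRatio B γ i j * algebraMap A B (r i)

lemma chartRed_vecMul (r : σ → A) : chartRed B γ i (r ᵥ* α) =
    chartRed B γ i r ᵥ* chartMat B α γ i +
      (algebraMap A B (r i) * IsLocalization.Away.invSelf (γ i)) • chartVec B α γ i := by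
  funext l
  have h1 := chartRatio_self B γ i
  simp only [chartRed, chartVec, Pi.add_apply, Pi.smul_apply, smul_eq_mul, vecMul, dotProduct,
    map_sum, map_mul, chartMat]
  rw [Fintype.sum_eq_add_sum_subtype_ne _ i, Fintype.sum_eq_add_sum_subtype_ne _ i,
    Fintype.sum_eq_add_sum_subtype_ne _ i, Fintype.sum_eq_add_sum_subtype_ne _ i]
  have h2 : ∀ x : {j // j ≠ i}, (algebraMap A B (r x) - chartRatio B γ i x * algebraMap A B (r i)) *
      (algebraMap A B (α x l) - chartRatio B γ i l * algebraMap A B (α x i)) =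
      (algebraMap A B (r x) * algebraMap A B (α x l) - chartRatio B γ i l *
        (algebraMap A B (r x) * algebraMap A B (α x i))) -
      (algebraMap A B (r i) * IsLocalization.Away.invSelf (γ i)) *
        (algebraMap A B (γ x) * algebraMap A B (α x l) - chartRatio B γ i l *
        (algebraMap A B (γ x) * algebraMap A B (α x i))) := by
    intro x; unfold chartRatio; ring
  rw [Finset.sum_congr rfl fun x _ => h2 x, Finset.sum_sub_distrib, Finset.sum_sub_distrib,
    ← Finset.mul_sum, ← Finset.mul_sum, Finset.sum_sub_distrib, ← Finset.mul_sum]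
  unfold chartRatio at h1
  linear_combination -(algebraMap A B (r i) * (algebraMap A B (α i l) -
    chartRatio B γ i l * algebraMap A B (α i i))) * h1

/-- The coefficient sequence `(γ α^k)_i / γ_i`. -/
noncomputable def chartSeq (k : ℕ) : B :=
  algebraMap A B ((γ ᵥ* α ^ k) i) * IsLocalization.Away.invSelf (γ i)

lemma chartSeq_zero : chartSeq B α γ i 0 = 1 := by
  simp [chartSeq]

lemma chartRed_pow (k : ℕ) : chartRed B γ i (γ ᵥ* α ^ k) =
    ∑ j ∈ Finset.range k, chartSeq B α γ i (k - 1 - j) •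
      (chartVec B α γ i ᵥ* chartMat B α γ i ^ j) := by
  induction k with
  | zero =>
    funext l
    simp [chartRed, chartRatio_mul]
  | succ k ih =>
    rw [pow_succ, ← vecMul_vecMul, chartRed_vecMul, ih, Finset.sum_range_succ', Matrix.sum_vecMul]
    congr 1
    · refine Finset.sum_congr rfl fun j hj => ?_
      rw [smul_vecMul, vecMul_vecMul, ← pow_succ]
      congr 2
      omega
    · simp [chartSeq]

lemma algebraMap_obs (k : ℕ) (l : {j // j ≠ i}) : algebraMap A B ((γ ᵥ* α ^ k) l) =
    algebraMap A B (γ l) * chartSeq B α γ i k + ∑ j ∈ Finset.range k,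
      chartSeq B α γ i (k - 1 - j) * (chartVec B α γ i ᵥ* chartMat B α γ i ^ j) l := by
  have h := congrFun (chartRed_pow B α γ i k) l
  rw [Finset.sum_apply] at h
  simp only [Pi.smul_apply, smul_eq_mul] at h
  rw [← h, chartRed, chartSeq, chartRatio]
  ring

open PowerSeries

/-- The generating series of `chartSeq`. -/
noncomputable def chartSer : PowerSeries B := PowerSeries.mk (chartSeq B α γ i)

/-- The inverse of `chartSer`. -/
noncomputable def chartInv : PowerSeries B := PowerSeries.invOfUnit (chartSer B α γ i) 1

lemma chartSer_mul_inv : chartSer B α γ i * chartInv B α γ i = 1 := by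
  refine PowerSeries.mul_invOfUnit _ _ ?_
  rw [chartSer, ← PowerSeries.coeff_zero_eq_constantCoeff_apply, PowerSeries.coeff_mk,
    chartSeq_zero]
  simp

lemma coeff_zero_chartInv : coeff 0 (chartInv B α γ i) = 1 := by
  simp [chartInv]

variable {B} in
/-- Extension by zero of a vector to a power series. -/
noncomputable def vecSer {m : ℕ} (v : Fin m → B) : PowerSeries B :=
  PowerSeries.mk fun k => if h : k < m then v ⟨k, h⟩ else 0

variable {B} in
lemma coeff_mul_congr {P Q b : PowerSeries B} {n : ℕ} (h : ∀ k ≤ n, coeff k P = coeff k Q) :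
    coeff n (P * b) = coeff n (Q * b) := by
  rw [coeff_mul, coeff_mul]
  refine Finset.sum_congr rfl fun p hp => ?_
  rw [h _ (by have := Finset.HasAntidiagonal.mem_antidiagonal.mp hp; omega)]

variable {B} in
lemma coeff_vecSer {m : ℕ} (v : Fin m → B) (k : Fin m) : coeff k (vecSer v) = v k := by
  simp [vecSer]

/-- The chart map on vectors. -/
noncomputable def chartLin (m : ℕ) : (Fin (m + 1) → B) →ₗ[B] (Fin m → B) where
  toFun v k := coeff (k + 1) (vecSer v * chartInv B α γ i)
  map_add' v w := by
    funext k
    rw [Pi.add_apply, ← map_add, ← add_mul]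
    refine coeff_mul_congr fun n hn => ?_
    have hn' : n ≤ m := by omega
    simp [vecSer, hn']
  map_smul' c v := by
    funext k
    simp only [RingHom.id_apply, Pi.smul_apply]
    rw [← map_smul, ← smul_mul_assoc]
    refine coeff_mul_congr fun n hn => ?_
    simp [vecSer]

lemma chartLin_apply_of {m : ℕ} {v : Fin (m + 1) → B} {P : PowerSeries B}
    (h : ∀ k : Fin (m + 1), coeff k P = v k) (k : Fin m) :
    chartLin B α γ i m v k = coeff (k + 1) (P * chartInv B α γ i) := by
  refine coeff_mul_congr fun n hn => ?_
  have hn' : n < m + 1 := by omega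
  rw [vecSer, coeff_mk, dif_pos hn', ← h ⟨n, hn'⟩]

lemma chartLin_surjective (m : ℕ) : Function.Surjective (chartLin B α γ i m) := by
  intro w
  refine ⟨fun k => coeff k (X * vecSer w * chartSer B α γ i), ?_⟩
  funext k
  rw [chartLin_apply_of B α γ i (fun _ => rfl), mul_assoc, chartSer_mul_inv, mul_one,
    coeff_succ_X_mul, coeff_vecSer]

lemma chartLin_eq_zero {m : ℕ} {v : Fin (m + 1) → B} (h : chartLin B α γ i m v = 0) :
    ∃ c : B, ∀ k, v k = c * chartSeq B α γ i k := by
  refine ⟨v 0, fun k => ?_⟩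
  have h1 : vecSer v = (vecSer v * chartInv B α γ i) * chartSer B α γ i := by
    rw [mul_assoc, mul_comm (chartInv B α γ i), chartSer_mul_inv, mul_one]
  rw [← coeff_vecSer v k, h1, coeff_mul, Finset.sum_eq_single (0, (k : ℕ))]
  · have h2 := coeff_zero_chartInv B α γ i
    rw [PowerSeries.coeff_zero_eq_constantCoeff_apply] at h2
    dsimp only
    rw [PowerSeries.coeff_zero_eq_constantCoeff_apply, map_mul, h2, mul_one,
      ← PowerSeries.coeff_zero_eq_constantCoeff_apply, ← coeff_vecSer v 0, chartSer, coeff_mk]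
    rfl
  · rintro ⟨p, q⟩ hp hne
    have hpq := Finset.HasAntidiagonal.mem_antidiagonal.mp hp
    dsimp only at hpq ⊢
    rcases p with _ | p
    · exact absurd (by rw [← hpq]; simp) hne
    · have := congrFun h ⟨p, by omega⟩
      change coeff (p + 1) (vecSer v * chartInv B α γ i) = 0 at this
      rw [this, zero_mul]
  · intro h
    exact absurd (Finset.HasAntidiagonal.mem_antidiagonal.mpr (by simp)) h

lemma chartLin_obs_ne (m : ℕ) (l : {j // j ≠ i}) :
    chartLin B α γ i m (algebraMap A B ∘ obsVec α γ (m + 1) l) =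
      obsVec (chartMat B α γ i) (chartVec B α γ i) m l := by
  funext k
  let W : PowerSeries B := PowerSeries.mk fun k =>
    (chartVec B α γ i ᵥ* chartMat B α γ i ^ k) l
  have hP : ∀ n : ℕ, coeff n ((C (algebraMap A B (γ l)) + X * W) * chartSer B α γ i) =
      algebraMap A B ((γ ᵥ* α ^ n) l) := by
    intro n
    rw [algebraMap_obs, add_mul, map_add, coeff_C_mul, chartSer, coeff_mk, mul_assoc]
    congr 1
    rcases n with _ | n
    · simp
    · rw [coeff_succ_X_mul, mul_comm, coeff_mul,
        Finset.Nat.sum_antidiagonal_eq_sum_range_succ_mk, ← Finset.sum_range_reflect]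
      refine Finset.sum_congr rfl fun j hj => ?_
      have := Finset.mem_range.mp hj
      simp only [coeff_mk, W]
      congr 2
      · congr 2; omega
  rw [chartLin_apply_of B α γ i (v := algebraMap A B ∘ obsVec α γ (m + 1) l)
    (P := (C (algebraMap A B (γ l)) + X * W) * chartSer B α γ i)
    (fun k => hP k), mul_assoc, chartSer_mul_inv, mul_one, map_add, coeff_succ_X_mul]
  simp [W, obsVec]

lemma chartLin_obs_self (m : ℕ) :
    chartLin B α γ i m (algebraMap A B ∘ obsVec α γ (m + 1) i) = 0 := by
  funext k
  have h : ∀ n : ℕ, coeff n (C (algebraMap A B (γ i)) * chartSer B α γ i) =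
      algebraMap A B ((γ ᵥ* α ^ n) i) := by
    intro n
    have := chartRatio_self B γ i
    unfold chartRatio at this
    rw [coeff_C_mul, chartSer, coeff_mk, chartSeq]
    linear_combination algebraMap A B ((γ ᵥ* α ^ n) i) * this
  rw [chartLin_apply_of B α γ i (v := algebraMap A B ∘ obsVec α γ (m + 1) i)
    (P := C (algebraMap A B (γ i)) * chartSer B α γ i)
    (fun k => h k), mul_assoc, chartSer_mul_inv, mul_one]
  simp

lemma chartLin_single_last (m : ℕ) :
    chartLin B α γ i (m + 1) (algebraMap A B ∘ Pi.single (Fin.last (m + 1)) 1) =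
      Pi.single (Fin.last m) 1 := by
  funext k
  have h : ∀ n : Fin (m + 1 + 1), coeff n (X ^ (m + 1) : PowerSeries B) =
      (algebraMap A B ∘ Pi.single (Fin.last (m + 1)) 1 : Fin (m + 1 + 1) → B) n := by
    intro n
    rw [coeff_X_pow, Function.comp_apply, Pi.single_apply]
    have : (n : ℕ) = m + 1 ↔ n = Fin.last (m + 1) := by rw [Fin.ext_iff, Fin.val_last]
    simp only [this]
    split_ifs <;> simp
  rw [chartLin_apply_of B α γ i h, mul_comm, coeff_mul_X_pow', Pi.single_apply]
  have h1 : m + 1 ≤ (k : ℕ) + 1 ↔ k = Fin.last m := by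
    rw [Fin.ext_iff, Fin.val_last]; omega
  simp only [h1]
  split_ifs with hk
  · subst hk
    simp [coeff_zero_chartInv]
  · rfl

end Chart

section ChartMap

variable {A : Type*} [CommRing A] {σ : Type} [Fintype σ] [DecidableEq σ]
  (B : Type*) [CommRing B] [Algebra A B] (α : Matrix σ σ A) (γ : σ → A) (i : σ)
  [IsLocalization.Away (γ i) B]

/-- Entrywise application of the algebra map, as a semilinear map. -/
def vecMap (A B : Type*) [CommRing A] [CommRing B] [Algebra A B] (m : ℕ) :
    (Fin m → A) →ₛₗ[algebraMap A B] (Fin m → B) where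
  toFun v := algebraMap A B ∘ v
  map_add' v w := by funext k; simp
  map_smul' a v := by funext k; simp

/-- The semilinear map from vectors over `A` to the observability module on the chart. -/
noncomputable def chartVecMap (m : ℕ) (T : Finset σ) : (Fin (m + 1) → A) →ₛₗ[algebraMap A B]
    ObsMod (chartMat B α γ i) (chartVec B α γ i) m (T.subtype (· ≠ i)) :=
  ((Submodule.mkQ _).comp (chartLin B α γ i m)).comp (vecMap A B (m + 1))

lemma chartVecMap_obs_ne (m : ℕ) (T : Finset σ) (l : {j // j ≠ i}) :
    chartVecMap B α γ i m T (obsVec α γ (m + 1) l) =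
      Submodule.Quotient.mk (obsVec (chartMat B α γ i) (chartVec B α γ i) m l) :=
  congrArg Submodule.Quotient.mk (chartLin_obs_ne B α γ i m l)

lemma chartVecMap_obs_of_mem (m : ℕ) (T : Finset σ) {l : σ} (hl : l ∈ T) :
    chartVecMap B α γ i m T (obsVec α γ (m + 1) l) = 0 := by
  by_cases h : l = i
  · subst h
    refine (congrArg Submodule.Quotient.mk (chartLin_obs_self B α γ l m)).trans ?_
    exact Submodule.Quotient.mk_zero _
  · rw [chartVecMap_obs_ne B α γ i m T ⟨l, h⟩]
    refine (Submodule.Quotient.mk_eq_zero _).mpr (Submodule.subset_span ⟨_, ?_, rfl⟩)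
    simpa using hl

/-- The comparison map from an observability module to the one on the chart `γ_i ≠ 0`. -/
noncomputable def chartMap (m : ℕ) (T : Finset σ) : ObsMod α γ (m + 1) T →+
    ObsMod (chartMat B α γ i) (chartVec B α γ i) m (T.subtype (· ≠ i)) :=
  (Submodule.liftQ _ (chartVecMap B α γ i m T) (Submodule.span_le.mpr (by
    rintro _ ⟨l, hl, rfl⟩
    exact chartVecMap_obs_of_mem B α γ i m T hl))).toAddMonoidHom

lemma chartMap_mk (m : ℕ) (T : Finset σ) (v : Fin (m + 1) → A) :
    chartMap B α γ i m T (Submodule.Quotient.mk v) = chartVecMap B α γ i m T v := rfl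

lemma chartMap_last (m : ℕ) (T : Finset σ) :
    chartMap B α γ i (m + 1) T (obsLast α γ (m + 1) T) =
      obsLast (chartMat B α γ i) (chartVec B α γ i) m (T.subtype (· ≠ i)) :=
  congrArg Submodule.Quotient.mk (chartLin_single_last B α γ i m)

lemma exists_pow_smul_eq_vecMap {g : A} [IsLocalization.Away g B] {m : ℕ} (y : Fin m → B) :
    ∃ (N : ℕ) (x : Fin m → A), vecMap A B m x = algebraMap A B g ^ N • y := by
  obtain ⟨b, hb⟩ := IsLocalization.exist_integer_multiples_of_finite (Submonoid.powers g) y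
  obtain ⟨N, hN⟩ := b.2
  choose x hx using hb
  refine ⟨N, x, ?_⟩
  funext k
  change algebraMap A B (x k) = algebraMap A B g ^ N * y k
  rw [hx k, ← hN, Algebra.smul_def]
  simp

lemma exists_pow_smul_mem_span {g : A} [IsLocalization.Away g B] {m : ℕ} (S : Set (Fin m → A))
    {y : Fin m → B} (hy : y ∈ Submodule.span B (vecMap A B m '' S)) :
    ∃ (N : ℕ), ∃ x ∈ Submodule.span A S, vecMap A B m x = algebraMap A B g ^ N • y := by
  induction hy using Submodule.span_induction with
  | mem y hy =>
    obtain ⟨x, hx, rfl⟩ := hy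
    exact ⟨0, x, Submodule.subset_span hx, by simp⟩
  | zero => exact ⟨0, 0, Submodule.zero_mem _, by simp⟩
  | add y z _ _ hy hz =>
    obtain ⟨N, x, hx, h1⟩ := hy
    obtain ⟨N', x', hx', h2⟩ := hz
    refine ⟨N + N', g ^ N' • x + g ^ N • x', Submodule.add_mem _ (Submodule.smul_mem _ _ hx)
      (Submodule.smul_mem _ _ hx'), ?_⟩
    rw [map_add, LinearMap.map_smulₛₗ, LinearMap.map_smulₛₗ, h1, h2, map_pow, map_pow, smul_smul,
      smul_smul, smul_add, pow_add, mul_comm]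
  | smul b y _ hy =>
    obtain ⟨N, x, hx, h1⟩ := hy
    obtain ⟨⟨a, ⟨_, n, rfl⟩⟩, hb⟩ := IsLocalization.surj (Submonoid.powers g) b
    refine ⟨n + N, a • x, Submodule.smul_mem _ _ hx, ?_⟩
    simp only [map_pow] at hb
    rw [LinearMap.map_smulₛₗ, h1, ← hb, smul_smul, smul_smul]
    congr 1
    ring

lemma isLocMap_chartMap (hinj : Function.Injective (algebraMap A B)) (m : ℕ) (T : Finset σ)
    (hi : i ∈ T) : IsLocMap (γ i) B (chartMap B α γ i m T) where
  smul a x := by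
    obtain ⟨v, rfl⟩ := Submodule.Quotient.mk_surjective _ x
    exact LinearMap.map_smulₛₗ (chartVecMap B α γ i m T) a v
  surj y := by
    obtain ⟨w, rfl⟩ := Submodule.Quotient.mk_surjective _ y
    obtain ⟨v, rfl⟩ := chartLin_surjective B α γ i m w
    obtain ⟨N, x, hx⟩ := exists_pow_smul_eq_vecMap B (g := γ i) v
    refine ⟨N, Submodule.Quotient.mk x, ?_⟩
    rw [chartMap_mk, chartVecMap, LinearMap.comp_apply, hx, LinearMap.map_smul]
    rfl
  ker x hx := by
    obtain ⟨v, rfl⟩ := Submodule.Quotient.mk_surjective _ x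
    have h1 : chartLin B α γ i m (vecMap A B (m + 1) v) ∈ Submodule.span B
        (obsVec (chartMat B α γ i) (chartVec B α γ i) m '' (T.subtype (· ≠ i) : Set _)) :=
      (Submodule.Quotient.mk_eq_zero _).mp hx
    let W := Submodule.span B (vecMap A B (m + 1) '' (obsVec α γ (m + 1) '' (T : Set σ)))
    have h2 : Submodule.span B
        (obsVec (chartMat B α γ i) (chartVec B α γ i) m '' (T.subtype (· ≠ i) : Set _)) ≤
        W.map (chartLin B α γ i m) := by
      rw [Submodule.span_le]
      rintro _ ⟨l, hl, rfl⟩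
      exact ⟨_, Submodule.subset_span ⟨_, ⟨l, by simpa using hl, rfl⟩, rfl⟩,
        chartLin_obs_ne B α γ i m l⟩
    obtain ⟨w, hw, hw2⟩ := h2 h1
    obtain ⟨c, hc⟩ := chartLin_eq_zero B α γ i (v := vecMap A B (m + 1) v - w)
      (by rw [map_sub, hw2, sub_self])
    have h3 : vecMap A B (m + 1) v = w +
        (c * IsLocalization.Away.invSelf (γ i)) • vecMap A B (m + 1) (obsVec α γ (m + 1) i) := by
      rw [← sub_eq_iff_eq_add']
      funext k
      rw [hc k, Pi.smul_apply, chartSeq, smul_eq_mul]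
      change _ = c * _ * algebraMap A B ((γ ᵥ* α ^ (k : ℕ)) i)
      ring
    have h4 : vecMap A B (m + 1) v ∈ W := by
      rw [h3]
      exact Submodule.add_mem _ hw (Submodule.smul_mem _ _
        (Submodule.subset_span ⟨_, ⟨i, hi, rfl⟩, rfl⟩))
    obtain ⟨N, x, hx, hxv⟩ := exists_pow_smul_mem_span B (g := γ i) _ h4
    refine ⟨N, (Submodule.Quotient.mk_eq_zero _).mpr ?_⟩
    have h5 : γ i ^ N • v = x := by
      funext k
      apply hinj
      have := congrFun hxv k
      change algebraMap A B (x k) = algebraMap A B (γ i) ^ N * algebraMap A B (v k) at this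
      rw [this, Pi.smul_apply, smul_eq_mul, map_mul, map_pow]
    change γ i ^ N • v ∈ _
    rw [h5]
    exact hx

/-- The map of symmetric algebras induced by passing to the chart `γ_i ≠ 0`. -/
noncomputable def chartSym (m : ℕ) (T : Finset σ) : SymA A (ObsMod α γ (m + 1) T) →+*
    SymA B (ObsMod (chartMat B α γ i) (chartVec B α γ i) m (T.subtype (· ≠ i))) :=
  SymA.map (algebraMap A B) (chartMap B α γ i m T) (fun a x => by
    obtain ⟨v, rfl⟩ := Submodule.Quotient.mk_surjective _ x
    exact LinearMap.map_smulₛₗ (chartVecMap B α γ i m T) a v)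

variable {m : ℕ} {T : Finset σ}

lemma chartSym_smul (a : A) (x : SymA A (ObsMod α γ (m + 1) T)) :
    chartSym B α γ i m T (a • x) = algebraMap A B a • chartSym B α γ i m T x :=
  SymA.map_smul _ _ _ a x

lemma chartSym_mem {u : ℕ} {x : SymA A (ObsMod α γ (m + 1) T)} (hx : x ∈ SymA.deg A _ u) :
    chartSym B α γ i m T x ∈ SymA.deg B _ u :=
  SymA.map_mem _ _ _ hx

lemma chartSym_obs (l : {j // j ≠ i}) :
    chartSym B α γ i m T (SymA.ι A _ (Submodule.Quotient.mk (obsVec α γ (m + 1) l))) =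
      SymA.ι B _ (Submodule.Quotient.mk (obsVec (chartMat B α γ i) (chartVec B α γ i) m l)) :=
  (SymA.map_ι _ _ _ _).trans (congrArg _ (chartVecMap_obs_ne B α γ i m T l))

lemma chartSym_last :
    chartSym B α γ i (m + 1) T (SymA.ι A _ (obsLast α γ (m + 1) T)) =
      SymA.ι B _ (obsLast (chartMat B α γ i) (chartVec B α γ i) m (T.subtype (· ≠ i))) :=
  (SymA.map_ι _ _ _ _).trans (congrArg _ (chartMap_last B α γ i m T))

variable {B α γ i}

lemma exists_pow_smul_of_chartSym_eq_zero (hinj : Function.Injective (algebraMap A B))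
    (hi : i ∈ T) {x : SymA A (ObsMod α γ (m + 1) T)} (hx : chartSym B α γ i m T x = 0) :
    ∃ N : ℕ, γ i ^ N • x = 0 :=
  SymA.exists_pow_smul_of_map_eq_zero (isLocMap_chartMap B α γ i hinj m T hi) hx

lemma exists_chartSym_eq_pow_smul (hinj : Function.Injective (algebraMap A B))
    (hi : i ∈ T) {u : ℕ}
    {y : SymA B (ObsMod (chartMat B α γ i) (chartVec B α γ i) m (T.subtype (· ≠ i)))}
    (hy : y ∈ SymA.deg B _ u) :
    ∃ N : ℕ, ∃ x ∈ SymA.deg A _ u, chartSym B α γ i m T x = algebraMap A B (γ i) ^ N • y :=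
  SymA.exists_map_eq_pow_smul (isLocMap_chartMap B α γ i hinj m T hi) hy

end ChartMap

/-- The entries of `α` and `γ` are independent variables of a polynomial ring over a factorial
domain of characteristic zero. -/
def IsGen {A : Type u} [CommRing A] {σ : Type} (α : Matrix σ σ A) (γ : σ → A) : Prop :=
  ∃ (k : Type u) (_ : CommRing k) (_ : IsDomain k) (_ : UniqueFactorizationMonoid k)
    (_ : CharZero k) (e : MvPolynomial ((σ × σ) ⊕ σ) k ≃+* A),
    (∀ i j, e (MvPolynomial.X (Sum.inl (i, j))) = α i j) ∧
    ∀ j, e (MvPolynomial.X (Sum.inr j)) = γ j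

namespace IsGen

variable {A : Type u} [CommRing A] {σ : Type} {α : Matrix σ σ A} {γ : σ → A}

lemma isDomain (h : IsGen α γ) : IsDomain A := by
  obtain ⟨k, _, _, _, _, e, -, -⟩ := h
  exact MulEquiv.isDomain _ e.symm.toMulEquiv

lemma ufd (h : IsGen α γ) : UniqueFactorizationMonoid A := by
  obtain ⟨k, _, _, _, _, e, -, -⟩ := h
  exact e.toMulEquiv.uniqueFactorizationMonoid inferInstance

lemma exists_eval (h : IsGen α γ) : ∃ (k : Type u) (_ : CommRing k) (_ : IsDomain k)
    (_ : CharZero k), ∀ (α₀ : Matrix σ σ k) (γ₀ : σ → k), ∃ θ : A →+* k,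
      (∀ i j, θ (α i j) = α₀ i j) ∧ ∀ j, θ (γ j) = γ₀ j := by
  obtain ⟨k, _, _, _, _, e, hα, hγ⟩ := h
  refine ⟨k, inferInstance, inferInstance, inferInstance, fun α₀ γ₀ =>
    ⟨((MvPolynomial.aeval (Sum.elim (fun p => α₀ p.1 p.2) γ₀)).toRingHom).comp
      e.symm.toRingHom, fun i j => ?_, fun j => ?_⟩⟩
  · simp [← hα]
  · simp [← hγ]

lemma exists_residue (h : IsGen α γ) : ∃ (A₀ : Type u) (_ : CommRing A₀) (_ : IsDomain A₀)
    (_ : UniqueFactorizationMonoid A₀) (_ : CharZero A₀) (ρ : A →+* A₀),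
    Function.Surjective ρ ∧ RingHom.ker ρ = Ideal.span (Set.range γ) ∧
    ∃ (k : Type u) (_ : CommRing k) (_ : IsDomain k) (_ : CharZero k),
      ∀ α₀ : Matrix σ σ k, ∃ θ : A₀ →+* k, ∀ i j, θ (ρ (α i j)) = α₀ i j := by
  obtain ⟨k, _, _, _, _, e, hα, hγ⟩ := h
  let ρ₁ : MvPolynomial ((σ × σ) ⊕ σ) k →ₐ[k] MvPolynomial (σ × σ) k :=
    MvPolynomial.aeval (Sum.elim MvPolynomial.X 0)
  let sec : MvPolynomial (σ × σ) k →ₐ[k] MvPolynomial ((σ × σ) ⊕ σ) k := MvPolynomial.rename Sum.inl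
  have hsec : ∀ x, ρ₁ (sec x) = x := fun x => by
    have : ρ₁.comp sec = AlgHom.id k _ := MvPolynomial.algHom_ext (fun p => by simp [ρ₁, sec])
    exact DFunLike.congr_fun this x
  refine ⟨MvPolynomial (σ × σ) k, inferInstance, inferInstance, inferInstance, inferInstance,
    ρ₁.toRingHom.comp e.symm.toRingHom, fun x => ⟨e (sec x), by simp [hsec]⟩, ?_,
    k, inferInstance, inferInstance, inferInstance, fun α₀ =>
    ⟨(MvPolynomial.aeval (fun p : σ × σ => α₀ p.1 p.2)).toRingHom, fun i j => ?_⟩⟩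
  · apply le_antisymm
    · intro a ha
      have ha : ρ₁ (e.symm a) = 0 := ha
      have key : ∀ p : MvPolynomial ((σ × σ) ⊕ σ) k,
          e p - e (sec (ρ₁ p)) ∈ Ideal.span (Set.range γ) := by
        intro p
        induction p using MvPolynomial.induction_on with
        | C c => simp [ρ₁, sec]
        | add p q hp hq =>
          have := add_mem hp hq
          rw [map_add, map_add, map_add, map_add]
          convert this using 1
          ring
        | mul_X p n hp =>
          rw [map_mul, map_mul, map_mul, map_mul]
          rcases n with n | n
          · have := Ideal.mul_mem_right (e (MvPolynomial.X (Sum.inl n))) _ hp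
            convert this using 1
            simp [ρ₁, sec]
            ring
          · have h0 : ρ₁ (MvPolynomial.X (Sum.inr n)) = 0 := by simp [ρ₁]
            rw [h0, map_zero, map_zero, mul_zero, sub_zero, hγ]
            exact Ideal.mul_mem_left _ _ (Ideal.subset_span ⟨n, rfl⟩)
      have := key (e.symm a)
      simpa [ha] using this
    · rw [Ideal.span_le]
      rintro _ ⟨j, rfl⟩
      simp [← hγ, ρ₁]
  · simp [← hα, ρ₁]

lemma regular (h : IsGen α γ) {j : σ} {Q : Set σ} (hj : j ∉ Q) {x : A}
    (hx : γ j * x ∈ Ideal.span (γ '' Q)) : x ∈ Ideal.span (γ '' Q) := by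
  obtain ⟨k, _, _, _, _, e, hα, hγ⟩ := h
  have himg : Ideal.span (γ '' Q) = (Ideal.span (MvPolynomial.X '' (Sum.inr '' Q) :
      Set (MvPolynomial ((σ × σ) ⊕ σ) k))).map e := by
    rw [Ideal.map_span, Set.image_image, Set.image_image]
    congr 1
    refine Set.image_congr fun l _ => (hγ l).symm
  have hmem : ∀ y, y ∈ Ideal.span (γ '' Q) ↔ e.symm y ∈ (Ideal.span (MvPolynomial.X ''
      (Sum.inr '' Q) : Set (MvPolynomial ((σ × σ) ⊕ σ) k))) := by
    intro y
    rw [himg, ← Ideal.mem_comap, Ideal.comap_symm]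
  rw [hmem] at hx ⊢
  rw [map_mul, ← hγ, RingEquiv.symm_apply_apply, MvPolynomial.mem_ideal_span_X_image] at hx
  rw [MvPolynomial.mem_ideal_span_X_image]
  intro m hm
  obtain ⟨i, hi, hne⟩ := hx (m + Finsupp.single (Sum.inr j) 1) (by
    rw [MvPolynomial.mem_support_iff, mul_comm, MvPolynomial.coeff_mul_X]
    exact MvPolynomial.mem_support_iff.mp hm)
  refine ⟨i, hi, ?_⟩
  obtain ⟨l, hl, rfl⟩ := hi
  have : (Sum.inr j : (σ × σ) ⊕ σ) ≠ Sum.inr l := fun hjl => hj (Sum.inr_injective hjl ▸ hl)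
  simpa [Finsupp.single_apply, this] using hne

end IsGen

section

open scoped Pointwise

lemma chartVec_eq {A B : Type*} [CommRing A] {σ : Type} [Fintype σ] [DecidableEq σ]
    [CommRing B] [Algebra A B] (α : Matrix σ σ A) (γ : σ → A) (i : σ)
    [IsLocalization.Away (γ i) B] (j : {j // j ≠ i}) :
    chartVec B α γ i j = algebraMap A B (γ i) *
      (algebraMap A B (α i j) - chartRatio B γ i j * algebraMap A B (α i i)) +
      ∑ k : {j // j ≠ i}, algebraMap A B (γ k) * chartMat B α γ i k j := by
  simp only [chartVec, vecMul, dotProduct, map_sum, map_mul, chartMat]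
  rw [Fintype.sum_eq_add_sum_subtype_ne _ i, Fintype.sum_eq_add_sum_subtype_ne _ i, mul_add,
    Finset.mul_sum, add_sub_add_comm, ← Finset.sum_sub_distrib]
  congr 1
  · ring
  · exact Finset.sum_congr rfl fun k _ => by ring

section

variable (k : Type u) [CommRing k] (σ : Type) [DecidableEq σ] [Fintype σ] (i : σ)

/-- The coefficient ring of the chart `γ_i ≠ 0`. -/
abbrev ChartBase : Type u :=
  Localization.Away (MvPolynomial.X (Sum.inr i) : MvPolynomial (σ ⊕ σ) k)

/-- The polynomial ring of the chart `γ_i ≠ 0`. -/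
abbrev ChartPoly : Type u :=
  MvPolynomial (({j : σ // j ≠ i} × {j : σ // j ≠ i}) ⊕ {j : σ // j ≠ i}) (ChartBase k σ i)

variable {σ}

noncomputable def baseVar (n : σ ⊕ σ) : ChartBase k σ i :=
  algebraMap (MvPolynomial (σ ⊕ σ) k) _ (MvPolynomial.X n)

noncomputable def baseInv : ChartBase k σ i :=
  IsLocalization.Away.invSelf (MvPolynomial.X (Sum.inr i) : MvPolynomial (σ ⊕ σ) k)

lemma baseVar_mul_inv : baseVar k i (Sum.inr i) * baseInv k i = 1 :=
  IsLocalization.Away.mul_invSelf _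

/-- Images of the original variables `α` in the chart polynomial ring. -/
noncomputable def polyMat (a b : σ) : ChartPoly k σ i :=
  if hb : b = i then MvPolynomial.C (baseVar k i (Sum.inl a)) else
  if ha : a = i then MvPolynomial.C (baseVar k i (Sum.inr b) * baseInv k i *
      baseVar k i (Sum.inl i)) + MvPolynomial.C (baseInv k i) *
      (MvPolynomial.X (Sum.inr ⟨b, hb⟩) - ∑ l : {j // j ≠ i},
        MvPolynomial.C (baseVar k i (Sum.inr l)) * MvPolynomial.X (Sum.inl (l, ⟨b, hb⟩)))
  else MvPolynomial.X (Sum.inl (⟨a, ha⟩, ⟨b, hb⟩)) +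
    MvPolynomial.C (baseVar k i (Sum.inr b) * baseInv k i * baseVar k i (Sum.inl a))

end

lemma IsGen.chart {A B : Type u} [CommRing A] {σ : Type} [Fintype σ] [DecidableEq σ]
    [CommRing B] [Algebra A B] {α : Matrix σ σ A} {γ : σ → A} (h : IsGen α γ) (i : σ)
    [IsLocalization.Away (γ i) B] : IsGen (chartMat B α γ i) (chartVec B α γ i) := by
  obtain ⟨k, _, _, _, _, e, hα, hγ⟩ := h
  have hne : Submonoid.powers (MvPolynomial.X (Sum.inr i) : MvPolynomial (σ ⊕ σ) k) ≤
      nonZeroDivisors _ := powers_le_nonZeroDivisors_of_noZeroDivisors (MvPolynomial.X_ne_zero _)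
  have hdom : IsDomain (ChartBase k σ i) := IsLocalization.isDomain_localization hne
  have hchar : CharZero (ChartBase k σ i) := by
    have : Function.Injective ((algebraMap (MvPolynomial (σ ⊕ σ) k) (ChartBase k σ i)).comp
      MvPolynomial.C) := (IsLocalization.injective _ hne).comp (MvPolynomial.C_injective _ _)
    exact charZero_of_injective_ringHom this
  have hunitB : IsUnit (algebraMap A B (γ i)) := IsLocalization.Away.algebraMap_isUnit _
  have hinvB : algebraMap A B (γ i) * IsLocalization.Away.invSelf (γ i) = 1 :=
    IsLocalization.Away.mul_invSelf _
  -- the map from the chart polynomial ring to `B`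
  let φ₀ : MvPolynomial (σ ⊕ σ) k →+* B := MvPolynomial.eval₂Hom
    (((algebraMap A B).comp e.toRingHom).comp MvPolynomial.C)
    (Sum.elim (fun a => algebraMap A B (α a i)) (fun b => algebraMap A B (γ b)))
  have hφ₀u : IsUnit (φ₀ (MvPolynomial.X (Sum.inr i))) := by simpa [φ₀] using hunitB
  let φ₁ : ChartBase k σ i →+* B :=
    IsLocalization.Away.lift (MvPolynomial.X (Sum.inr i) : MvPolynomial (σ ⊕ σ) k) hφ₀u
  have hφ₁ : ∀ p, φ₁ (algebraMap _ _ p) = φ₀ p := fun p =>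
    IsLocalization.Away.lift_eq _ hφ₀u p
  have hφ₁v : ∀ n, φ₁ (baseVar k i n) = Sum.elim (fun a => algebraMap A B (α a i))
      (fun b => algebraMap A B (γ b)) n := fun n => by
    rw [baseVar, hφ₁]; simp [φ₀]
  have hφ₁i : φ₁ (baseInv k i) = IsLocalization.Away.invSelf (γ i) := by
    apply hunitB.mul_left_cancel
    have := congrArg φ₁ (baseVar_mul_inv k i)
    rw [map_mul, hφ₁v, map_one] at this
    rw [hinvB]; exact this
  let Φ : ChartPoly k σ i →+* B := MvPolynomial.eval₂Hom φ₁
    (Sum.elim (fun p => chartMat B α γ i p.1 p.2) (chartVec B α γ i))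
  have hΦC : ∀ c, Φ (MvPolynomial.C c) = φ₁ c := fun c => by simp [Φ]
  have hΦX : ∀ n, Φ (MvPolynomial.X n) = Sum.elim (fun p => chartMat B α γ i p.1 p.2)
    (chartVec B α γ i) n := fun n => by simp [Φ]
  -- the map back
  let ψ₀ : MvPolynomial ((σ × σ) ⊕ σ) k →+* ChartPoly k σ i := MvPolynomial.eval₂Hom
    ((MvPolynomial.C.comp (algebraMap (MvPolynomial (σ ⊕ σ) k) (ChartBase k σ i))).comp
      MvPolynomial.C)
    (Sum.elim (fun p => polyMat k i p.1 p.2) (fun b => MvPolynomial.C (baseVar k i (Sum.inr b))))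
  let ψ : A →+* ChartPoly k σ i := ψ₀.comp e.symm.toRingHom
  have hψα : ∀ a b, ψ (α a b) = polyMat k i a b := fun a b => by simp [ψ, ψ₀, ← hα]
  have hψγ : ∀ b, ψ (γ b) = MvPolynomial.C (baseVar k i (Sum.inr b)) := fun b => by
    simp [ψ, ψ₀, ← hγ]
  have hψu : IsUnit (ψ (γ i)) := by
    rw [hψγ]
    exact (IsUnit.of_mul_eq_one _ (baseVar_mul_inv k i)).map _
  let Ψ : B →+* ChartPoly k σ i := IsLocalization.Away.lift (γ i) hψu
  have hΨ : ∀ a, Ψ (algebraMap A B a) = ψ a := fun a => IsLocalization.Away.lift_eq _ hψu a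
  have hΨi : Ψ (IsLocalization.Away.invSelf (γ i)) = MvPolynomial.C (baseInv k i) := by
    apply hψu.mul_left_cancel
    have := congrArg Ψ hinvB
    rw [map_mul, hΨ, map_one] at this
    rw [this, hψγ, ← map_mul, baseVar_mul_inv, map_one]
  have hΨr : ∀ b, Ψ (chartRatio B γ i b) =
      MvPolynomial.C (baseVar k i (Sum.inr b) * baseInv k i) := fun b => by
    rw [chartRatio, map_mul, hΨ, hΨi, hψγ, map_mul]
  have hpi : ∀ a, polyMat k i a i = MvPolynomial.C (baseVar k i (Sum.inl a)) := fun a => by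
    simp [polyMat]
  have hΨM : ∀ a b : {j // j ≠ i}, Ψ (chartMat B α γ i a b) =
      MvPolynomial.X (Sum.inl (a, b)) := fun a b => by
    rw [chartMat, map_sub, map_mul, hΨ, hΨ, hΨr, hψα, hψα, hpi, polyMat, dif_neg b.2, dif_neg a.2]
    simp
  have hΨV : ∀ b : {j // j ≠ i}, Ψ (chartVec B α γ i b) = MvPolynomial.X (Sum.inr b) := fun b => by
    rw [chartVec_eq, map_add, map_mul, map_sub, map_mul, map_sum]
    simp only [map_mul, hΨM, hΨ, hΨr, hψα, hψγ, hpi]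
    rw [polyMat, dif_neg b.2, dif_pos rfl]
    have h1 : MvPolynomial.C (baseVar k i (Sum.inr i)) * MvPolynomial.C (baseInv k i) =
      (1 : ChartPoly k σ i) := by rw [← map_mul, baseVar_mul_inv, map_one]
    simp only [map_mul]
    linear_combination (MvPolynomial.X (Sum.inr b) - ∑ l : {j // j ≠ i},
        MvPolynomial.C (baseVar k i (Sum.inr l)) * MvPolynomial.X (Sum.inl (l, b))) * h1
  have h1 : Φ.comp Ψ = RingHom.id B := by
    apply IsLocalization.ringHom_ext (Submonoid.powers (γ i))
    have : ((Φ.comp Ψ).comp (algebraMap A B)).comp e.toRingHom =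
        ((RingHom.id B).comp (algebraMap A B)).comp e.toRingHom := by
      apply MvPolynomial.ringHom_ext
      · intro c
        simp [hΨ, ψ, ψ₀, hΦC, hφ₁, φ₀]
      · rintro (⟨a, b⟩ | b)
        · simp only [RingHom.comp_apply, RingEquiv.toRingHom_eq_coe, RingHom.coe_coe, hα, hΨ, hψα,
            RingHom.id_apply, polyMat]
          split_ifs with hb ha
          · rw [hΦC, hφ₁v, hb]; rfl
          · subst ha
            simp only [map_add, map_sub, map_mul, map_sum, hΦC, hφ₁v, hφ₁i, hΦX, Sum.elim_inl,
              Sum.elim_inr]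
            rw [chartVec_eq, chartRatio]
            linear_combination (algebraMap A B (α a b) - algebraMap A B (γ b) *
              IsLocalization.Away.invSelf (γ a) * algebraMap A B (α a a)) * hinvB
          · simp only [map_add, map_mul, hΦC, hφ₁v, hφ₁i, hΦX, Sum.elim_inl,
              Sum.elim_inr, chartMat, chartRatio]
            ring
        · simp [hγ, hΨ, hψγ, hΦC, hφ₁v]
    ext a
    obtain ⟨p, rfl⟩ := e.surjective a
    exact RingHom.congr_fun this p
  have h2 : Ψ.comp Φ = RingHom.id _ := by
    apply MvPolynomial.ringHom_ext
    · have : (Ψ.comp φ₁) = MvPolynomial.C := by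
        apply IsLocalization.ringHom_ext (Submonoid.powers
          (MvPolynomial.X (Sum.inr i) : MvPolynomial (σ ⊕ σ) k))
        apply MvPolynomial.ringHom_ext
        · intro c
          simp [hφ₁, φ₀, hΨ, ψ, ψ₀]
        · rintro (a | b)
          · simp [hφ₁, φ₀, hΨ, hψα, hpi, baseVar]
          · simp [hφ₁, φ₀, hΨ, hψγ, baseVar]
      intro c
      rw [RingHom.comp_apply, hΦC]
      exact RingHom.congr_fun this c
    · rintro (⟨a, b⟩ | b)
      · rw [RingHom.comp_apply, hΦX]; exact hΨM a b
      · rw [RingHom.comp_apply, hΦX]; exact hΨV b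
  refine ⟨ChartBase k σ i, inferInstance, hdom, inferInstance, hchar,
    RingEquiv.ofRingHom Φ Ψ h1 h2, fun a b => ?_, fun b => ?_⟩
  · exact hΦX _
  · exact hΦX _

namespace IsGen

variable {A : Type u} [CommRing A] {σ : Type} {α : Matrix σ σ A} {γ : σ → A}

lemma ne_zero (h : IsGen α γ) (i : σ) : γ i ≠ 0 := by
  obtain ⟨k, _, _, _, θ⟩ := h.exists_eval
  obtain ⟨θ, -, h2⟩ := θ 0 1
  intro h0
  have := h2 i
  simp [h0] at this

lemma injective_chart (h : IsGen α γ) (i : σ) (B : Type*) [CommRing B] [Algebra A B]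
    [IsLocalization.Away (γ i) B] : Function.Injective (algebraMap A B) := by
  have := h.isDomain
  exact IsLocalization.injective B
    (powers_le_nonZeroDivisors_of_noZeroDivisors (h.ne_zero i))

lemma depthGE_add (h : IsGen α γ) (I : Ideal A) {r : ℕ} [DecidableEq σ] (T : Finset σ) :
    ∀ Q : Finset σ, Disjoint T Q → (∀ j ∈ T, γ j ∈ I) →
    DepthGE I r (A ⧸ Ideal.span (γ '' (↑(T ∪ Q) : Set σ))) →
    DepthGE I (r + T.card) (A ⧸ Ideal.span (γ '' (Q : Set σ))) := by
  induction T using Finset.induction_on with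
  | empty =>
    intro Q _ _ h0
    rw [Finset.empty_union] at h0
    exact h0
  | insert j T hj ih =>
    intro Q hd hI h0
    rw [Finset.disjoint_insert_left] at hd
    have h1 := ih (insert j Q) (by
      rw [Finset.disjoint_insert_right]; exact ⟨hj, hd.2⟩)
      (fun l hl => hI l (Finset.mem_insert_of_mem hl)) (by
        rw [Finset.union_insert, ← Finset.insert_union]; exact h0)
    rw [Finset.card_insert_of_notMem hj, ← add_assoc]
    have hreg : IsSMulRegular (A ⧸ Ideal.span (γ '' (Q : Set σ))) (γ j) := by
      rw [isSMulRegular_iff_right_eq_zero_of_smul]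
      intro x hx
      obtain ⟨a, rfl⟩ := Ideal.Quotient.mk_surjective x
      rw [← Ideal.Quotient.mk_eq_mk, ← Submodule.Quotient.mk_smul,
        Submodule.Quotient.mk_eq_zero] at hx
      exact Ideal.Quotient.eq_zero_iff_mem.mpr (h.regular (by simpa using hd.1) hx)
    refine DepthGE.of_isSMulRegular (hI j (Finset.mem_insert_self _ _)) hreg (h1.equiv ?_)
    let p : (A ⧸ Ideal.span (γ '' (Q : Set σ))) →ₗ[A]
        (A ⧸ Ideal.span (γ '' (↑(insert j Q) : Set σ))) :=
      Submodule.factor (Ideal.span_mono (Set.image_mono (by simp)))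
    have hp : Function.Surjective p := Submodule.factor_surjective _
    have hker : LinearMap.ker p = γ j • ⊤ := by
      ext x
      obtain ⟨a, rfl⟩ := Ideal.Quotient.mk_surjective x
      have : p (Ideal.Quotient.mk _ a) = Ideal.Quotient.mk _ a := rfl
      rw [LinearMap.mem_ker, this, Ideal.Quotient.eq_zero_iff_mem, Finset.coe_insert,
        Set.image_insert_eq, Ideal.mem_span_insert, Submodule.mem_smul_pointwise_iff_exists]
      constructor
      · rintro ⟨b, z, hz, rfl⟩
        refine ⟨Ideal.Quotient.mk _ b, trivial, ?_⟩
        rw [map_add, Ideal.Quotient.eq_zero_iff_mem.mpr hz, add_zero, mul_comm]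
        rfl
      · rintro ⟨y, -, hy⟩
        obtain ⟨b, rfl⟩ := Ideal.Quotient.mk_surjective y
        have hy : Ideal.Quotient.mk (Ideal.span (γ '' (Q : Set σ))) (γ j * b) =
          Ideal.Quotient.mk _ a := hy
        rw [Ideal.Quotient.eq] at hy
        exact ⟨b, -(γ j * b - a), neg_mem hy, by ring⟩
    exact ((Submodule.quotEquivOfEq _ _ hker).symm.trans
      (p.quotKerEquivOfSurjective hp)).symm

lemma depthGE (h : IsGen α γ) (I : Ideal A) [DecidableEq σ] (T : Finset σ)
    (hI : ∀ j ∈ T, γ j ∈ I) : DepthGE I T.card A := by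
  have := h.depthGE_add I (r := 0) T ∅ (by simp) hI DepthGE.zero
  rw [zero_add] at this
  refine this.equiv ?_
  refine (Submodule.quotEquivOfEqBot _ ?_)
  simp

end IsGen

end

namespace SymA

lemma lmap_lmap_eq {A C D : Type*} [CommRing A] [AddCommGroup C] [Module A C]
    [AddCommGroup D] [Module A D] (e : C ≃ₗ[A] D) (x : SymA A C) :
    lmap e.symm.toLinearMap (lmap e.toLinearMap x) = x := by
  refine hom_ext (F := (lmap e.symm.toLinearMap).comp (lmap e.toLinearMap)) (G := RingHom.id _)
    (fun a => ?_) (fun c => ?_) x <;> simp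

/-- Graded pieces of isomorphic modules are isomorphic. -/
noncomputable def degCongr {A C D : Type*} [CommRing A] [AddCommGroup C] [Module A C]
    [AddCommGroup D] [Module A D] (e : C ≃ₗ[A] D) (u : ℕ) : deg A C u ≃ₗ[A] deg A D u :=
  LinearEquiv.ofBijective (degMap e.toLinearMap u) ⟨fun x y h => by
    have := congrArg (lmap e.symm.toLinearMap) (congrArg Subtype.val h)
    simp only [degMap_coe, lmap_lmap_eq] at this
    exact Subtype.ext this, degMap_surjective _ e.surjective u⟩

end SymA

section ObsCls

variable {A : Type u} [CommRing A] {σ : Type} [Fintype σ] [DecidableEq σ]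

/-- The class of `obsVec α γ m l` in an observability module. -/
def obsCls (α : Matrix σ σ A) (γ : σ → A) (m : ℕ) (T : Finset σ) (l : σ) : ObsMod α γ m T :=
  Submodule.Quotient.mk (obsVec α γ m l)

variable {α : Matrix σ σ A} {γ : σ → A} {m : ℕ} {T T₁ : Finset σ}

lemma obsCls_eq_zero {l : σ} (hl : l ∈ T) : obsCls α γ m T l = 0 :=
  (Submodule.Quotient.mk_eq_zero _).mpr (Submodule.subset_span ⟨l, hl, rfl⟩)

variable (α γ m) in
/-- The projection between observability modules. -/
def obsFactor (h : T₁ ⊆ T) : ObsMod α γ m T₁ →ₗ[A] ObsMod α γ m T :=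
  Submodule.factor (Submodule.span_mono (Set.image_mono (Finset.coe_subset.mpr h)))

lemma obsFactor_surjective (h : T₁ ⊆ T) : Function.Surjective (obsFactor α γ m h) :=
  Submodule.factor_surjective (Submodule.span_mono (Set.image_mono (Finset.coe_subset.mpr h)))

lemma obsFactor_obsCls (h : T₁ ⊆ T) (l : σ) :
    obsFactor α γ m h (obsCls α γ m T₁ l) = obsCls α γ m T l := rfl

lemma ker_obsFactor (h : T₁ ⊆ T) {l : σ} (hl : l ∈ T) (h' : T ⊆ insert l T₁) :
    LinearMap.ker (obsFactor α γ m h) = Submodule.span A {obsCls α γ m T₁ l} := by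
  apply le_antisymm
  · intro x hx
    obtain ⟨v, rfl⟩ := Submodule.Quotient.mk_surjective _ x
    have hv : v ∈ Submodule.span A (obsVec α γ m '' (T : Set σ)) :=
      (Submodule.Quotient.mk_eq_zero _).mp hx
    have hv := Submodule.span_mono (Set.image_mono (Finset.coe_subset.mpr h')) hv
    rw [Finset.coe_insert, Set.image_insert_eq, Submodule.mem_span_insert] at hv
    obtain ⟨a, z, hz, rfl⟩ := hv
    rw [Submodule.mem_span_singleton]
    refine ⟨a, ?_⟩
    rw [Submodule.Quotient.mk_add, (Submodule.Quotient.mk_eq_zero _).mpr hz, add_zero]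
    rfl
  · rw [Submodule.span_le, Set.singleton_subset_iff]
    exact obsCls_eq_zero hl

instance [h : Subsingleton (Fin m → A)] : Subsingleton (ObsMod α γ m T) :=
  (Submodule.Quotient.mk_surjective _).subsingleton

variable (α γ m) in
/-- The observability module with no relations is free. -/
noncomputable def obsModEmpty : ObsMod α γ m ∅ ≃ₗ[A] (Fin m → A) :=
  Submodule.quotEquivOfEqBot _ (by simp)

/-- Depth of graded pieces, assuming injectivity of multiplication by the observability classes. -/
lemma depthGE_deg_of_injective [IsDomain A] (I : Ideal A) (t : ℕ)
    (hinj : ∀ T : Finset σ, T.card < t → ∀ i ∉ T, ∀ u, T.card + 1 ≤ u + m →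
      ∀ x ∈ SymA.deg A (ObsMod α γ m T) u, SymA.ι A _ (obsCls α γ m T i) * x = 0 → x = 0)
    {c : ℕ} (hA : DepthGE I c A) (T : Finset σ) :
    T.card ≤ t → ∀ u, T.card + 1 ≤ u + m →
      DepthGE I (c - min T.card u) (SymA.deg A (ObsMod α γ m T) u) := by
  induction T using Finset.induction_on with
  | empty =>
    intro _ u _
    have := (SymA.depthGE_deg_free hA m u).equiv (SymA.degCongr (obsModEmpty α γ m).symm u)
    exact this.mono (by simp)
  | insert i T hi ih =>
    intro ht u hu
    rw [Finset.card_insert_of_notMem hi] at ht hu ⊢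
    rcases u with _ | u
    · exact (hA.equiv (SymA.degZeroEquiv _ _)).mono (by simp)
    · have hY := ih (by omega) (u + 1) (by omega)
      have hX := ih (by omega) u (by omega)
      rcases Nat.eq_zero_or_pos (c - min (T.card + 1) (u + 1)) with h0 | h0
      · rw [h0]; exact DepthGE.zero
      · have hsub : T ⊆ insert i T := Finset.subset_insert _ _
        refine DepthGE.of_exact_right (SymA.mulMap A (obsCls α γ m T i) u)
          (SymA.degMap (obsFactor α γ m hsub) (u + 1)) ?_
          (SymA.exact_mulMap_degMap _ (obsFactor_surjective hsub) _
            (ker_obsFactor hsub (Finset.mem_insert_self _ _) le_rfl) u)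
          (SymA.degMap_surjective _ (obsFactor_surjective hsub) _)
          (hX.mono (by omega)) (hY.mono (by omega))
        rw [← LinearMap.ker_eq_bot, LinearMap.ker_eq_bot']
        rintro ⟨x, hx⟩ h
        exact Subtype.ext (hinj T (by omega) i hi u (by omega) x hx (congrArg Subtype.val h))

end ObsCls

/-- Multiplication by an observability class is injective in the range where the dimension
count allows it. -/
theorem obs_mul_injective (n : ℕ) : ∀ {A : Type u} [CommRing A] {σ : Type} [Fintype σ]
    [DecidableEq σ] {α : Matrix σ σ A} {γ : σ → A}, Fintype.card σ = n → IsGen α γ →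
    ∀ (m t : ℕ) (T : Finset σ), T.card = t → ∀ i ∉ T, ∀ u, T.card + 1 ≤ u + m →
      ∀ x ∈ SymA.deg A (ObsMod α γ m T) u, SymA.ι A _ (obsCls α γ m T i) * x = 0 → x = 0 := by
  induction n with
  | zero =>
    intro A _ σ _ _ α γ hn h m t T _ i
    exact ((Fintype.card_eq_zero_iff.mp hn).false i).elim
  | succ n IH =>
    intro A _ σ _ _ α γ hn h m t
    have hdom := h.isDomain
    induction t using Nat.strong_induction_on with
    | _ t ih =>
    intro T hT i hi u hu x hx hix
    rcases m with _ | m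
    · exact SymA.deg_eq_bot (by omega) hx
    rcases T.eq_empty_or_nonempty with rfl | ⟨l, hl⟩
    · have : Module.Free A (ObsMod α γ (m + 1) ∅) := Module.Free.of_equiv (obsModEmpty α γ (m + 1)).symm
      rcases mul_eq_zero.mp hix with h0 | h0
      · exfalso
        have h1 : obsCls α γ (m + 1) ∅ i = 0 := SymA.ι_injective (h0.trans (map_zero _).symm)
        have h2 : obsVec α γ (m + 1) i = 0 :=
          by simpa using (Submodule.Quotient.mk_eq_zero _).mp h1
        have h3 := congrFun h2 0
        simp [obsVec] at h3
        exact h.ne_zero i h3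
      · exact h0
    have hcard : ∀ j : σ, Fintype.card {l // l ≠ j} = n := fun j => by
      rw [Fintype.card_subtype_compl, Fintype.card_subtype_eq, hn]; rfl
    have hsubcard : ∀ (S : Finset σ) (j : σ), j ∈ S →
        (S.subtype (· ≠ j)).card + 1 = S.card := fun S j hj => by
      rw [Finset.card_subtype, Finset.filter_ne', Finset.card_erase_add_one hj]
    have hdep := depthGE_deg_of_injective (α := α) (γ := γ) (m := m + 1)
      (Ideal.span (γ '' (↑(insert i T) : Set σ))) t
      (fun S hS => ih S.card hS S rfl)
      (h.depthGE _ (insert i T) (fun j hj => Ideal.subset_span ⟨j, hj, rfl⟩)) T hT.le u hu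
    rw [Finset.card_insert_of_notMem hi] at hdep
    have hzero : ∀ j ∈ insert i T, ∃ N, γ j ^ N • (⟨x, hx⟩ : SymA.deg A (ObsMod α γ (m + 1) T) u) = 0 := by
      intro j hj
      suffices hs : ∃ N, γ j ^ N • x = 0 by
        obtain ⟨N, hN⟩ := hs
        exact ⟨N, Subtype.ext hN⟩
      have hinj := h.injective_chart j (Localization.Away (γ j))
      have hchart := h.chart (B := Localization.Away (γ j)) j
      by_cases hjT : j ∈ T
      · have hij : i ≠ j := fun hij => hi (hij ▸ hjT)
        have h1 := congrArg (chartSym (Localization.Away (γ j)) α γ j m T) hix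
        rw [map_mul, map_zero, obsCls, chartSym_obs _ _ _ _ ⟨i, hij⟩] at h1
        have hc := hsubcard T j hjT
        exact exists_pow_smul_of_chartSym_eq_zero hinj hjT
          (IH (hcard j) hchart m _ _ rfl ⟨i, hij⟩ (by simpa using hi) u (by omega) _
            (chartSym_mem _ _ _ _ hx) h1)
      · have hji : j = i := by
          rcases Finset.mem_insert.mp hj with h | h
          · exact h
          · exact absurd h hjT
        subst hji
        have hlj : l ≠ j := fun hlj => hi (hlj ▸ hl)
        have hsub : T.erase l ⊆ T := Finset.erase_subset _ _
        have hsub2 : T ⊆ insert l (T.erase l) := by rw [Finset.insert_erase hl]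
        have hker := ker_obsFactor (α := α) (γ := γ) (m := m + 1) hsub hl hsub2
        have hlt : (T.erase l).card + 1 = t := by rw [Finset.card_erase_add_one hl, hT]
        have hnot : j ∉ T.erase l := fun hh => hjT (hsub hh)
        obtain ⟨x', hx', rfl⟩ := SymA.lmap_surj _ (obsFactor_surjective hsub) hx
        obtain ⟨y, hy, hxy⟩ := SymA.exists_mul_of_lmap_eq_zero_deg (obsFactor α γ (m + 1) hsub)
          (obsFactor_surjective hsub) _ hker.le
          (SymA.ι_mul_mem (obsCls α γ (m + 1) (T.erase l) j) hx')
          (by rw [map_mul, SymA.lmap_ι, obsFactor_obsCls]; exact hix)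
        have hsub3 : T.erase l ⊆ insert j (T.erase l) := Finset.subset_insert _ _
        have hker3 := ker_obsFactor (α := α) (γ := γ) (m := m + 1) hsub3
          (Finset.mem_insert_self _ _) le_rfl
        have h1 := congrArg (chartSym (Localization.Away (γ j)) α γ j m _)
          (congrArg (SymA.lmap (obsFactor α γ (m + 1) hsub3)) hxy)
        simp only [map_mul, SymA.lmap_ι, obsFactor_obsCls] at h1
        rw [obsCls_eq_zero (Finset.mem_insert_self _ _), map_zero, map_zero, zero_mul,
          obsCls, chartSym_obs _ _ _ _ ⟨l, hlj⟩] at h1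
        have hc := hsubcard (insert j (T.erase l)) j (Finset.mem_insert_self _ _)
        rw [Finset.card_insert_of_notMem hnot] at hc
        have h2 := IH (hcard j) hchart m _ _ rfl ⟨l, hlj⟩ (by simp [hlj]) u (by omega) _
            (chartSym_mem _ _ _ _ (SymA.lmap_mem _ hy)) h1.symm
        obtain ⟨N, hN⟩ := exists_pow_smul_of_chartSym_eq_zero hinj (Finset.mem_insert_self _ _) h2
        rw [← SymA.lmap_smul] at hN
        have hT1 := ih (T.erase l).card (by omega) (T.erase l) rfl j hnot u (by omega)
        refine ⟨N, ?_⟩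
        rcases u with _ | u
        · obtain ⟨w, hw⟩ := SymA.exists_mul_of_lmap_eq_zero _ (obsFactor_surjective hsub3) _
            hker3.le hN
          have hy0 := SymA.eq_zero_of_mem_deg_zero (Submodule.smul_mem _ _ hy) hw
          have := hT1 (γ j ^ N • x') (Submodule.smul_mem _ _ hx') (by
            rw [mul_smul_comm, hxy, ← mul_smul_comm, hy0, mul_zero])
          rw [← SymA.lmap_smul, this, map_zero]
        · obtain ⟨w, hwm, hw⟩ := SymA.exists_mul_of_lmap_eq_zero_deg _
            (obsFactor_surjective hsub3) _ hker3.le (Submodule.smul_mem _ _ hy) hN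
          have := hT1 (γ j ^ N • x' - SymA.ι A _ (obsCls α γ (m + 1) (T.erase l) l) * w)
            (Submodule.sub_mem _ (Submodule.smul_mem _ _ hx') (SymA.ι_mul_mem _ hwm)) (by
            rw [mul_sub, mul_smul_comm, hxy, ← mul_smul_comm, hw]; ring)
          rw [sub_eq_zero] at this
          rw [← SymA.lmap_smul, this, map_mul, SymA.lmap_ι, obsFactor_obsCls, obsCls_eq_zero hl,
            map_zero, zero_mul]
    have := DepthGE.eq_zero_of_pow (insert i T) γ (hdep.mono (by omega)) ⟨x, hx⟩ hzero
    exact congrArg Subtype.val this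

lemma IsGen.depthGE_deg {A : Type u} [CommRing A] {σ : Type} [Fintype σ]
    [DecidableEq σ] {α : Matrix σ σ A} {γ : σ → A} (h : IsGen α γ) {I : Ideal A} {c : ℕ}
    (hA : DepthGE I c A) (m : ℕ) (T : Finset σ) (u : ℕ) (hu : T.card + 1 ≤ u + m) :
    DepthGE I (c - min T.card u) (SymA.deg A (ObsMod α γ m T) u) := by
  have := h.isDomain
  exact depthGE_deg_of_injective I T.card
    (fun S _ => obs_mul_injective _ rfl h m S.card S rfl) hA T le_rfl u hu

section Eval

variable {A : Type u} [CommRing A] {σ : Type} [Fintype σ] [DecidableEq σ]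
  {α : Matrix σ σ A} {γ : σ → A}

lemma exists_obsEval {F : Type*} [CommRing F] (θ : A →+* F) {m : ℕ} {T : Finset σ}
    (w : Fin m → F) (h : ∀ j ∈ T, ∑ k : Fin m, θ ((γ ᵥ* α ^ (k : ℕ)) j) * w k = 0) :
    ∃ G : SymA A (ObsMod α γ m T) →+* F, (∀ a, G (algebraMap A _ a) = θ a) ∧
      ∀ v : Fin m → A, G (SymA.ι A _ (Submodule.Quotient.mk v)) = ∑ k, θ (v k) * w k := by
  let := Module.compHom F θ
  let f : (Fin m → A) →ₗ[A] F :=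
    { toFun := fun v => ∑ k, θ (v k) * w k
      map_add' := fun v v' => by simp [add_mul, Finset.sum_add_distrib]
      map_smul' := fun a v => by
        change _ = θ a * _
        simp [Finset.mul_sum, mul_assoc] }
  let g : ObsMod α γ m T →ₗ[A] F := Submodule.liftQ _ f (Submodule.span_le.mpr (by
    rintro _ ⟨j, hj, rfl⟩
    exact h j hj))
  obtain ⟨G, h1, h2⟩ := SymA.exists_lift θ g.toAddMonoidHom (fun a c => g.map_smul a c)
  exact ⟨G, h1, fun v => h2 _⟩

lemma map_vecMul_pow {F : Type*} [CommRing F] (θ : A →+* F) (k : ℕ) (j : σ) :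
    θ ((γ ᵥ* α ^ k) j) = ((θ ∘ γ) ᵥ* (α.map θ) ^ k) j := by
  rw [RingHom.map_vecMul, ← Matrix.map_pow]

lemma exists_obsEval_last {F : Type*} [CommRing F] (θ : A →+* F) {m : ℕ} {T : Finset σ}
    (h : ∀ j ∈ T, θ ((γ ᵥ* α ^ m) j) = 0) :
    ∃ G : SymA A (ObsMod α γ (m + 1) T) →+* F, (∀ a, G (algebraMap A _ a) = θ a) ∧
      G (SymA.ι A _ (obsLast α γ m T)) = 1 := by
  obtain ⟨G, h1, h2⟩ := exists_obsEval (α := α) (γ := γ) (T := T) θ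
    (Pi.single (Fin.last m) (1 : F)) (fun j hj => by
      rw [Finset.sum_eq_single (Fin.last m)]
      · simpa using h j hj
      · intro k _ hk; simp [hk]
      · simp)
  refine ⟨G, h1, ?_⟩
  rw [obsLast, h2, Finset.sum_eq_single (Fin.last m)]
  · simp
  · intro k _ hk; simp [hk]
  · simp

variable (α γ) in
/-- The power of the last basis vector, a generator of the degree `s` piece up to torsion. -/
noncomputable def obsPow (m s : ℕ) (T : Finset σ) : SymA A (ObsMod α γ (m + 1) T) :=
  SymA.ι A _ (obsLast α γ m T) ^ s

lemma obsPow_mem (m s : ℕ) (T : Finset σ) : obsPow α γ m s T ∈ SymA.deg A _ s :=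
  SymA.ι_pow_mem _ _

lemma chartSym_obsPow (B : Type*) [CommRing B] [Algebra A B] (i : σ)
    [IsLocalization.Away (γ i) B] (m s : ℕ) (T : Finset σ) :
    chartSym B α γ i (m + 1) T (obsPow α γ (m + 1) s T) =
      obsPow (chartMat B α γ i) (chartVec B α γ i) m s (T.subtype (· ≠ i)) := by
  rw [obsPow, map_pow, chartSym_last, obsPow]

lemma exists_smul_obsLast (T : Finset σ) (c : ObsMod α γ 1 T) :
    ∃ a : A, c = a • obsLast α γ 0 T := by
  obtain ⟨v, rfl⟩ := Submodule.Quotient.mk_surjective _ c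
  refine ⟨v 0, ?_⟩
  rw [obsLast, ← Submodule.Quotient.mk_smul]
  congr 1
  funext k
  fin_cases k
  simp

lemma exists_smul_obsPow {s : ℕ} {T : Finset σ} {x : SymA A (ObsMod α γ 1 T)}
    (hx : x ∈ SymA.deg A _ s) : ∃ a : A, x = a • obsPow α γ 0 s T := by
  induction s generalizing x with
  | zero =>
    obtain ⟨a, rfl⟩ := SymA.mem_deg_zero.mp hx
    exact ⟨a, by rw [obsPow, pow_zero, Algebra.algebraMap_eq_smul_one]⟩
  | succ s ih =>
    refine SymA.deg_succ_induction hx (fun c y hy => ?_) (fun y z hy hz => ?_)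
    · obtain ⟨a, rfl⟩ := exists_smul_obsLast T c
      obtain ⟨b, rfl⟩ := ih hy
      refine ⟨a * b, ?_⟩
      rw [map_smul, obsPow, obsPow, pow_succ', smul_mul_smul_comm]
    · obtain ⟨a, rfl⟩ := hy
      obtain ⟨b, rfl⟩ := hz
      exact ⟨a + b, (add_smul _ _ _).symm⟩

lemma smul_obsPow_eq_zero_of_mem {s : ℕ} (hs : s ≠ 0) {T : Finset σ} (hT : ∀ j, j ∈ T) {a : A}
    (ha : a ∈ Ideal.span (Set.range γ)) : a • obsPow α γ 0 s T = 0 := by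
  induction ha using Submodule.span_induction with
  | mem a ha =>
    obtain ⟨j, rfl⟩ := ha
    have h : γ j • obsLast α γ 0 T = 0 := by
      rw [← obsCls_eq_zero (α := α) (γ := γ) (m := 1) (hT j), obsLast,
        ← Submodule.Quotient.mk_smul, obsCls]
      congr 1
      funext k
      fin_cases k
      simp [obsVec]
    obtain ⟨s, rfl⟩ := Nat.exists_eq_succ_of_ne_zero hs
    rw [obsPow, pow_succ', ← smul_mul_assoc, ← map_smul, h, map_zero, zero_mul]
  | zero => exact zero_smul _ _
  | add x y _ _ hx hy => rw [add_smul, hx, hy, add_zero]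
  | smul b x _ hx => rw [smul_assoc, hx, smul_zero]

lemma IsGen.smul_obsPow_zero_iff (h : IsGen α γ) {s : ℕ} (hs : s ≠ 0) {T : Finset σ}
    (hT : ∀ j, j ∈ T) {a : A} :
    a • obsPow α γ 0 s T = 0 ↔ a ∈ Ideal.span (Set.range γ) := by
  refine ⟨fun ha => ?_, smul_obsPow_eq_zero_of_mem hs hT⟩
  obtain ⟨A₀, _, _, _, _, ρ, -, hker, -⟩ := h.exists_residue
  obtain ⟨G, h1, h2⟩ := exists_obsEval_last (α := α) (γ := γ) (m := 0) (T := T) ρ (fun j _ => by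
    have : γ j ∈ RingHom.ker ρ := hker ▸ Ideal.subset_span ⟨j, rfl⟩
    simpa using this)
  have := congrArg G ha
  rw [Algebra.smul_def, map_mul, h1, obsPow, map_pow, h2, one_pow, mul_one, map_zero] at this
  rw [← hker]; exact this

lemma IsGen.isPrime_span (h : IsGen α γ) : (Ideal.span (Set.range γ)).IsPrime := by
  obtain ⟨A₀, _, _, _, _, ρ, -, hker, -⟩ := h.exists_residue
  rw [← hker]
  exact RingHom.ker_isPrime ρ

lemma IsGen.pow_smul_obsPow_ne_zero (h : IsGen α γ) {m : ℕ} (hm : m ≠ 0) (s : ℕ) (T : Finset σ)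
    (i j : σ) (N M : ℕ) : (γ i ^ N * γ j ^ M) • obsPow α γ m s T ≠ 0 := by
  intro ha
  obtain ⟨k, _, _, _, hθ⟩ := h.exists_eval
  obtain ⟨θ, hα, hγ⟩ := hθ 0 1
  obtain ⟨G, h1, h2⟩ := exists_obsEval_last (α := α) (γ := γ) (m := m) (T := T) θ (fun j _ => by
    have : α.map θ = 0 := by ext a b; exact hα a b
    rw [map_vecMul_pow, this, zero_pow hm, vecMul_zero]; rfl)
  have := congrArg G ha
  rw [Algebra.smul_def, map_mul, h1, obsPow, map_pow, h2, one_pow, mul_one, map_zero] at this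
  simp [hγ] at this

end Eval

/-- The ideal generated by the entries of `γ`, in the form used for depth. -/
abbrev gamIdeal {A : Type u} [CommRing A] {σ : Type} [Fintype σ] (γ : σ → A) : Ideal A :=
  Ideal.span (γ '' ((Finset.univ : Finset σ) : Set σ))

section

variable {A : Type u} [CommRing A] {σ : Type} [Fintype σ] [DecidableEq σ]
  {α : Matrix σ σ A} {γ : σ → A}

lemma IsGen.depthGE_gam (h : IsGen α γ) : DepthGE (gamIdeal γ) (Fintype.card σ) A :=
  h.depthGE _ Finset.univ fun j hj => Ideal.subset_span ⟨j, hj, rfl⟩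

lemma IsGen.depthGE_deg_gam (h : IsGen α γ) (m s : ℕ) (T : Finset σ)
    (hT : ∀ j, j ∈ T) (hms : Fintype.card σ ≤ m + s) :
    DepthGE (gamIdeal γ) (Fintype.card σ - s) (SymA.deg A (ObsMod α γ (m + 1) T) s) := by
  have hT' : T.card = Fintype.card σ := by
    rw [Finset.eq_univ_iff_forall.mpr hT, Finset.card_univ]
  exact (h.depthGE_deg h.depthGE_gam (m + 1) T s (by omega)).mono (by omega)

lemma IsGen.eq_zero_of_pow_deg (h : IsGen α γ) {m s : ℕ} {T : Finset σ}
    (hT : ∀ j, j ∈ T) (hms : Fintype.card σ = m + s) (hm : m ≠ 0)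
    {x : SymA A (ObsMod α γ (m + 1) T)} (hx : x ∈ SymA.deg A _ s)
    (h0 : ∀ i, ∃ N : ℕ, γ i ^ N • x = 0) : x = 0 := by
  refine congrArg Subtype.val (DepthGE.eq_zero_of_pow Finset.univ γ
    ((h.depthGE_deg_gam m s T hT hms.le).mono (by omega)) ⟨x, hx⟩ (fun i _ => ?_))
  obtain ⟨N, hN⟩ := h0 i
  exact ⟨N, Subtype.ext hN⟩

lemma card_ne (j : σ) : Fintype.card {l // l ≠ j} + 1 = Fintype.card σ := by
  have : 0 < Fintype.card σ := Fintype.card_pos_iff.mpr ⟨j⟩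
  rw [Fintype.card_subtype_compl, Fintype.card_subtype_eq]
  omega

end

/-- The nonzero elements of the relevant graded pieces all have the same annihilator. -/
theorem obs_torsion (n : ℕ) : ∀ {A : Type u} [CommRing A] {σ : Type} [Fintype σ]
    [DecidableEq σ] {α : Matrix σ σ A} {γ : σ → A}, Fintype.card σ = n → IsGen α γ →
    ∀ (m s : ℕ) (T : Finset σ), (∀ j, j ∈ T) → m + s = n → s ≠ 0 →
      ∀ x ∈ SymA.deg A (ObsMod α γ (m + 1) T) s, ∀ a : A, a • x = 0 →
        x = 0 ∨ a • obsPow α γ m s T = 0 := by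
  induction n with
  | zero => intro A _ σ _ _ α γ _ _ m s T _ _ _; omega
  | succ n IH =>
    intro A _ σ _ _ α γ hn h m s T hT hms hs x hx a hax
    rcases m with _ | m
    · obtain ⟨b, rfl⟩ := exists_smul_obsPow hx
      rw [smul_smul, h.smul_obsPow_zero_iff hs hT] at hax
      rw [h.smul_obsPow_zero_iff hs hT, h.smul_obsPow_zero_iff hs hT]
      exact (h.isPrime_span.mem_or_mem hax).symm
    · have hch : ∀ (i : σ) (b : A), ∀ y ∈ SymA.deg A (ObsMod α γ (m + 1 + 1) T) s, b • y = 0 →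
          (∃ N : ℕ, γ i ^ N • y = 0) ∨ ∃ N : ℕ, γ i ^ N • b • obsPow α γ (m + 1) s T = 0 := by
        intro i b y hy hby
        have hinj := h.injective_chart i (Localization.Away (γ i))
        have hchart := h.chart (B := Localization.Away (γ i)) i
        have h1 := congrArg (chartSym (Localization.Away (γ i)) α γ i (m + 1) T) hby
        rw [chartSym_smul, map_zero] at h1
        have hc := card_ne i
        rcases IH (by omega) hchart m s (T.subtype (· ≠ i)) (by simp [hT]) (by omega) hs _
          (chartSym_mem _ _ _ _ hy) _ h1 with h2 | h2
        · exact Or.inl (exists_pow_smul_of_chartSym_eq_zero hinj (hT i) h2)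
        · right
          rw [← chartSym_obsPow, ← chartSym_smul] at h2
          exact exists_pow_smul_of_chartSym_eq_zero hinj (hT i) h2
      by_cases hex : ∃ i : σ, ∃ N : ℕ, γ i ^ N • a • obsPow α γ (m + 1) s T = 0
      · right
        obtain ⟨i, N, hN⟩ := hex
        refine h.eq_zero_of_pow_deg hT (by omega) (Nat.succ_ne_zero m)
          (Submodule.smul_mem _ _ (obsPow_mem _ _ _)) (fun j => ?_)
        rcases hch j _ _ (Submodule.smul_mem _ _ (obsPow_mem _ _ _)) hN with h1 | ⟨M, hM⟩
        · exact h1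
        · rw [smul_smul] at hM
          exact absurd hM (h.pow_smul_obsPow_ne_zero (Nat.succ_ne_zero m) s T j i M N)
      · left
        refine h.eq_zero_of_pow_deg hT (by omega) (Nat.succ_ne_zero m) hx (fun j => ?_)
        rcases hch j a x hx hax with h1 | h1
        · exact h1
        · exact absurd ⟨j, h1⟩ hex

lemma IsGen.obsPow_ne_zero {A : Type u} [CommRing A] {σ : Type} [Fintype σ]
    [DecidableEq σ] {α : Matrix σ σ A} {γ : σ → A} (h : IsGen α γ) (i : σ) (m : ℕ) {s : ℕ}
    (hs : s ≠ 0) {T : Finset σ} (hT : ∀ j, j ∈ T) : obsPow α γ m s T ≠ 0 := by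
  rcases Nat.eq_zero_or_pos m with rfl | hm
  · intro h0
    have h1 : (1 : A) ∈ Ideal.span (Set.range γ) :=
      (h.smul_obsPow_zero_iff hs hT).mp (by rw [h0, smul_zero])
    exact h.isPrime_span.ne_top ((Ideal.eq_top_iff_one _).mpr h1)
  · have := h.pow_smul_obsPow_ne_zero hm.ne' s T i i 0 0
    simpa using this

/-- The relevant graded pieces have rank one. -/
theorem obs_rank_one (n : ℕ) : ∀ {A : Type u} [CommRing A] {σ : Type} [Fintype σ]
    [DecidableEq σ] {α : Matrix σ σ A} {γ : σ → A}, Fintype.card σ = n → IsGen α γ →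
    ∀ (m s : ℕ) (T : Finset σ), (∀ j, j ∈ T) → m + s = n → s ≠ 0 →
      ∀ x ∈ SymA.deg A (ObsMod α γ (m + 1) T) s, ∃ b : A, b • obsPow α γ m s T ≠ 0 ∧
        ∃ a : A, b • x = a • obsPow α γ m s T := by
  induction n with
  | zero => intro A _ σ _ _ α γ _ _ m s T _ _ _; omega
  | succ n IH =>
    intro A _ σ _ _ α γ hn h m s T hT hms hs x hx
    obtain ⟨i⟩ : Nonempty σ := Fintype.card_pos_iff.mp (by omega)
    rcases m with _ | m
    · obtain ⟨a, rfl⟩ := exists_smul_obsPow hx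
      exact ⟨1, by rw [one_smul]; exact h.obsPow_ne_zero i 0 hs hT, a, one_smul _ _⟩
    · have hinj := h.injective_chart i (Localization.Away (γ i))
      have hchart := h.chart (B := Localization.Away (γ i)) i
      have hc := card_ne i
      obtain ⟨b', hb', a', ha'⟩ := IH (by omega) hchart m s (T.subtype (· ≠ i)) (by simp [hT])
        (by omega) hs _ (chartSym_mem _ _ _ _ hx)
      rw [← chartSym_obsPow] at hb' ha'
      obtain ⟨⟨b, ⟨_, N, rfl⟩⟩, hb⟩ := IsLocalization.surj (Submonoid.powers (γ i)) b'
      obtain ⟨⟨a, ⟨_, M, rfl⟩⟩, ha⟩ := IsLocalization.surj (Submonoid.powers (γ i)) a'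
      simp only [map_pow] at ha hb
      obtain ⟨L, hL⟩ := exists_pow_smul_of_chartSym_eq_zero hinj (hT i)
        (x := (γ i ^ M * b) • x - (γ i ^ N * a) • obsPow α γ (m + 1) s T) (by
          rw [map_sub, chartSym_smul, chartSym_smul, map_mul, map_mul, ← ha, ← hb, map_pow,
            map_pow, mul_comm b', ← mul_assoc, mul_smul, ha', smul_smul, sub_eq_zero]
          congr 1
          ring)
      refine ⟨γ i ^ L * (γ i ^ M * b), fun h0 => hb' ?_, γ i ^ L * (γ i ^ N * a), ?_⟩
      · have h1 := congrArg (chartSym (Localization.Away (γ i)) α γ i (m + 1) T) h0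
        rw [chartSym_smul, map_mul, map_mul, ← hb, map_pow, map_pow, map_zero] at h1
        have hu : IsUnit (algebraMap A (Localization.Away (γ i)) (γ i)) :=
          IsLocalization.Away.algebraMap_isUnit _
        have h2 : (algebraMap A (Localization.Away (γ i)) (γ i) ^ (L + M + N)) •
            (b' • chartSym (Localization.Away (γ i)) α γ i (m + 1) T
              (obsPow α γ (m + 1) s T)) = 0 := by
          rw [smul_smul, ← h1]
          congr 1
          ring
        exact ((hu.pow (L + M + N)).smul_eq_zero).mp h2
      · rw [smul_sub, sub_eq_zero, smul_smul, smul_smul] at hL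
        exact hL

section Restrict

variable {A : Type u} [CommRing A] {σ : Type} [Fintype σ] [DecidableEq σ]

variable (α : Matrix σ σ A) (γ : σ → A) (m : ℕ) (T : Finset σ)

/-- Forgetting the last coordinate. -/
def obsRes : ObsMod α γ (m + 1) T →ₗ[A] ObsMod α γ m T :=
  Submodule.mapQ _ _ (LinearMap.funLeft A A Fin.castSucc) (Submodule.span_le.mpr (by
    rintro _ ⟨j, hj, rfl⟩
    exact Submodule.subset_span ⟨j, hj, rfl⟩))

variable {α γ m T}

lemma obsRes_mk (v : Fin (m + 1) → A) :
    obsRes α γ m T (Submodule.Quotient.mk v) = Submodule.Quotient.mk (v ∘ Fin.castSucc) := rfl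

lemma obsRes_surjective : Function.Surjective (obsRes α γ m T) := by
  intro x
  obtain ⟨v, rfl⟩ := Submodule.Quotient.mk_surjective _ x
  exact ⟨Submodule.Quotient.mk (Fin.snoc (α := fun _ => A) v 0), by
    rw [obsRes_mk]; congr 1; funext k; simp⟩

lemma ker_obsRes : LinearMap.ker (obsRes α γ m T) = Submodule.span A {obsLast α γ m T} := by
  apply le_antisymm
  · intro x hx
    obtain ⟨v, rfl⟩ := Submodule.Quotient.mk_surjective _ x
    have hv : v ∘ Fin.castSucc ∈ Submodule.span A (obsVec α γ m '' (T : Set σ)) :=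
      (Submodule.Quotient.mk_eq_zero _).mp hx
    have himg : obsVec α γ m '' (T : Set σ) =
        LinearMap.funLeft A A Fin.castSucc '' (obsVec α γ (m + 1) '' (T : Set σ)) := by
      rw [Set.image_image]; rfl
    rw [himg, ← Submodule.map_span] at hv
    obtain ⟨w, hw, hwv⟩ := hv
    rw [Submodule.mem_span_singleton]
    refine ⟨v (Fin.last m) - w (Fin.last m), ?_⟩
    rw [obsLast, ← Submodule.Quotient.mk_smul, Submodule.Quotient.eq, ← neg_mem_iff]
    have heq : -((v (Fin.last m) - w (Fin.last m)) • Pi.single (Fin.last m) (1 : A) - v) = w := by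
     funext k
     refine Fin.lastCases ?_ (fun k => ?_) k
     · simp
     · have := congrFun hwv k
       simp only [LinearMap.funLeft_apply, Function.comp_apply] at this
       simp [this, Fin.castSucc_ne_last]
    rw [heq]
    exact hw
  · rw [Submodule.span_le, Set.singleton_subset_iff]
    refine (Submodule.Quotient.mk_eq_zero _).mpr ?_
    convert Submodule.zero_mem _
    funext k
    simp [LinearMap.funLeft_apply, Fin.castSucc_ne_last]

end Restrict

section Ann

open scoped Pointwise

variable {A : Type u} [CommRing A] {σ : Type} [Fintype σ] [DecidableEq σ]

/-- The annihilator of `obsPow`. -/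
noncomputable def obsAnn (α : Matrix σ σ A) (γ : σ → A) (m s : ℕ) (T : Finset σ) : Ideal A :=
  LinearMap.ker (LinearMap.toSpanSingleton A _ (obsPow α γ m s T))

variable {α : Matrix σ σ A} {γ : σ → A} {m s : ℕ} {T : Finset σ}

lemma mem_obsAnn {a : A} : a ∈ obsAnn α γ m s T ↔ a • obsPow α γ m s T = 0 := Iff.rfl

lemma IsGen.isPrime_obsAnn (h : IsGen α γ) (hT : ∀ j, j ∈ T) (hms : m + s = Fintype.card σ)
    (hs : s ≠ 0) : (obsAnn α γ m s T).IsPrime := by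
  obtain ⟨i⟩ : Nonempty σ := Fintype.card_pos_iff.mp (by omega)
  refine ⟨fun h1 => h.obsPow_ne_zero i m hs hT ?_, fun {a b} hab => ?_⟩
  · rw [← one_smul A (obsPow α γ m s T), ← mem_obsAnn, h1]; trivial
  · rw [mem_obsAnn, mul_smul] at hab
    exact (obs_torsion _ rfl h m s T hT hms hs _ (Submodule.smul_mem _ _ (obsPow_mem _ _ _)) _
      hab).symm

lemma depthGE_two {I : Ideal A} {p a : A} [IsDomain A] (hp : Prime p) (hpI : p ∈ I) (haI : a ∈ I)
    (hpa : ¬ p ∣ a) : DepthGE I 2 A := by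
  have hreg : IsSMulRegular A p := fun x y h => mul_left_cancel₀ hp.ne_zero h
  refine DepthGE.of_isSMulRegular hpI hreg (DepthGE.of_isSMulRegular haI ?_ DepthGE.zero)
  rw [isSMulRegular_iff_right_eq_zero_of_smul]
  intro x hx
  obtain ⟨x, rfl⟩ := Submodule.Quotient.mk_surjective _ x
  rw [← Submodule.Quotient.mk_smul, Submodule.Quotient.mk_eq_zero,
    Submodule.mem_smul_pointwise_iff_exists] at hx
  obtain ⟨y, -, hy⟩ := hx
  rw [Submodule.Quotient.mk_eq_zero, Submodule.mem_smul_pointwise_iff_exists]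
  have : p ∣ a * x := ⟨y, hy.symm⟩
  obtain ⟨z, rfl⟩ := (hp.dvd_or_dvd this).resolve_left hpa
  exact ⟨z, trivial, rfl⟩

lemma IsGen.depthGE_obsAnn_one (h : IsGen α γ) (hT : ∀ j, j ∈ T)
    (hms : m + 1 = Fintype.card σ) : DepthGE (gamIdeal γ) m (A ⧸ obsAnn α γ m 1 T) := by
  have hdom := h.isDomain
  have hufd := h.ufd
  have hprime := h.isPrime_obsAnn hT hms one_ne_zero
  obtain ⟨i⟩ : Nonempty σ := Fintype.card_pos_iff.mp (by omega)
  by_cases hbot : obsAnn α γ m 1 T = ⊥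
  · rw [hbot]
    exact (h.depthGE_gam.mono (by omega)).equiv (Submodule.quotEquivOfEqBot _ rfl).symm
  rcases Nat.eq_zero_or_pos m with rfl | hm
  · exact DepthGE.zero
  obtain ⟨p, hp, hpp⟩ := Ideal.IsPrime.exists_mem_prime_of_ne_bot hprime hbot
  have hspan : obsAnn α γ m 1 T = p • (⊤ : Submodule A A) := by
    ext a
    rw [Submodule.mem_smul_pointwise_iff_exists]
    constructor
    · intro ha
      by_contra hcon
      have hpa : ¬ p ∣ a := fun ⟨b, hb⟩ => hcon ⟨b, trivial, hb.symm⟩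
      have h2 := depthGE_two (I := Ideal.span {p, a}) hpp (Ideal.subset_span (by simp))
        (Ideal.subset_span (by simp)) hpa
      have hcard : T.card ≤ Fintype.card σ := Finset.card_le_univ T
      have h1 := (h.depthGE_deg h2 (m + 1) T 1 (by omega)).mono (r' := 1) (by omega)
      refine h.obsPow_ne_zero i m one_ne_zero hT (congrArg Subtype.val
        (h1.eq_zero_of_mem ⟨obsPow α γ m 1 T, obsPow_mem _ _ _⟩ fun b hb => Subtype.ext ?_))
      have hle : Ideal.span {p, a} ≤ obsAnn α γ m 1 T := by
        rw [Ideal.span_le]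
        rintro _ (rfl | rfl)
        · exact hp
        · exact ha
      exact hle hb
    · rintro ⟨b, -, rfl⟩
      exact Ideal.mul_mem_right _ _ hp
  have hreg : IsSMulRegular A p := fun x y h => mul_left_cancel₀ hpp.ne_zero h
  exact (DepthGE.quotSMulTop hreg (h.depthGE_gam.mono (by omega))).equiv
    (Submodule.quotEquivOfEq _ _ hspan.symm)

/-- Depth of the graded pieces just outside of the acyclic range. -/
lemma IsGen.depthGE_deg_sub_one (h : IsGen α γ) (hT : ∀ j, j ∈ T)
    (hinj : ∀ m s, m + 1 + s = Fintype.card σ → s ≠ 0 → DepthGE (gamIdeal γ) m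
      (SymA.deg A (ObsMod α γ (m + 1) T) s) →
      ∀ x ∈ SymA.deg A (ObsMod α γ (m + 1) T) s, SymA.ι A _ (obsLast α γ m T) * x = 0 → x = 0)
    (s : ℕ) : ∀ m, m + (s + 1) = Fintype.card σ →
    DepthGE (gamIdeal γ) (m - 1) (SymA.deg A (ObsMod α γ m T) (s + 1)) := by
  induction s with
  | zero =>
    intro m hm
    rcases m with _ | m
    · exact DepthGE.zero
    refine DepthGE.of_exact_right
      (X := A ⧸ obsAnn α γ (m + 1) 1 T)
      (Y := SymA.deg A (ObsMod α γ (m + 1 + 1) T) 1)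
      (Submodule.liftQ _ (LinearMap.toSpanSingleton A _
        (⟨obsPow α γ (m + 1) 1 T, obsPow_mem _ _ _⟩ : SymA.deg A _ 1)) (fun a ha => Subtype.ext ha))
      (SymA.degMap (obsRes α γ (m + 1) T) 1) ?_ ?_ (SymA.degMap_surjective _ obsRes_surjective _)
      (h.depthGE_obsAnn_one hT hm) ((h.depthGE_deg_gam (m + 1) 1 T hT (by omega)).mono (by omega))
    · rw [← LinearMap.ker_eq_bot, LinearMap.ker_eq_bot']
      intro x hx
      obtain ⟨a, rfl⟩ := Submodule.Quotient.mk_surjective _ x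
      rw [Submodule.Quotient.mk_eq_zero]
      exact congrArg Subtype.val hx
    · intro y
      rw [SymA.exact_mulMap_degMap _ obsRes_surjective _ ker_obsRes 0 y]
      constructor
      · rintro ⟨⟨w, hw⟩, rfl⟩
        obtain ⟨a, rfl⟩ := SymA.mem_deg_zero.mp hw
        refine ⟨Submodule.Quotient.mk a, Subtype.ext ?_⟩
        change a • obsPow α γ (m + 1) 1 T = _
        rw [SymA.mulMap_coe, obsPow, pow_one, Algebra.smul_def, mul_comm]
      · rintro ⟨x, rfl⟩
        obtain ⟨a, rfl⟩ := Submodule.Quotient.mk_surjective _ x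
        refine ⟨⟨algebraMap A _ a, SymA.mem_deg_zero.mpr ⟨a, rfl⟩⟩, Subtype.ext ?_⟩
        change _ = a • obsPow α γ (m + 1) 1 T
        rw [SymA.mulMap_coe, obsPow, pow_one, Algebra.smul_def, mul_comm]
  | succ s ih =>
    intro m hm
    rcases m with _ | m
    · exact DepthGE.zero
    have hX := ih (m + 1 + 1) (by omega)
    refine DepthGE.of_exact_right (SymA.mulMap A (obsLast α γ (m + 1) T) (s + 1))
      (SymA.degMap (obsRes α γ (m + 1) T) (s + 1 + 1)) ?_
      (SymA.exact_mulMap_degMap _ obsRes_surjective _ ker_obsRes (s + 1))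
      (SymA.degMap_surjective _ obsRes_surjective _) hX
      ((h.depthGE_deg_gam (m + 1) (s + 1 + 1) T hT (by omega)).mono (by omega))
    rw [← LinearMap.ker_eq_bot, LinearMap.ker_eq_bot']
    rintro ⟨x, hx⟩ hx0
    exact Subtype.ext (hinj (m + 1) (s + 1) (by omega) (Nat.succ_ne_zero s) hX x hx
      (congrArg Subtype.val hx0))

end Ann

/-- Multiplication by the last basis vector is injective. -/
theorem obsLast_mul_injective (n : ℕ) : ∀ {A : Type u} [CommRing A] {σ : Type} [Fintype σ]
    [DecidableEq σ] {α : Matrix σ σ A} {γ : σ → A}, Fintype.card σ = n → IsGen α γ →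
    ∀ (T : Finset σ), (∀ j, j ∈ T) → ∀ m s, m + 1 + s = n → s ≠ 0 →
      ∀ x ∈ SymA.deg A (ObsMod α γ (m + 1) T) s, SymA.ι A _ (obsLast α γ m T) * x = 0 → x = 0 := by
  induction n with
  | zero => intro A _ σ _ _ α γ _ _ T _ m s; omega
  | succ n IH =>
    intro A _ σ _ _ α γ hn h T hT
    have key : ∀ m s, m + 1 + s = Fintype.card σ → s ≠ 0 → DepthGE (gamIdeal γ) m
        (SymA.deg A (ObsMod α γ (m + 1) T) s) →
        ∀ x ∈ SymA.deg A (ObsMod α γ (m + 1) T) s,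
          SymA.ι A _ (obsLast α γ m T) * x = 0 → x = 0 := by
      intro m s hms hs hdep x hx hex
      rcases m with _ | m
      · obtain ⟨a, rfl⟩ := exists_smul_obsPow hx
        have h1 : a • obsPow α γ 0 (s + 1) T = 0 := by
          rw [obsPow, pow_succ', ← mul_smul_comm]; exact hex
        rw [h.smul_obsPow_zero_iff (Nat.succ_ne_zero s) hT] at h1
        exact (h.smul_obsPow_zero_iff hs hT).mpr h1
      · refine congrArg Subtype.val (DepthGE.eq_zero_of_pow Finset.univ γ
          (hdep.mono (by omega)) ⟨x, hx⟩ (fun i _ => ?_))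
        have hinj := h.injective_chart i (Localization.Away (γ i))
        have hchart := h.chart (B := Localization.Away (γ i)) i
        have h1 := congrArg (chartSym (Localization.Away (γ i)) α γ i (m + 1) T) hex
        rw [map_mul, chartSym_last, map_zero] at h1
        have hc := card_ne i
        have h2 := IH (by omega) hchart (T.subtype (· ≠ i)) (by simp [hT]) m s (by omega) hs _
          (chartSym_mem _ _ _ _ hx) h1
        obtain ⟨N, hN⟩ := exists_pow_smul_of_chartSym_eq_zero hinj (hT i) h2
        exact ⟨N, Subtype.ext hN⟩
    intro m s hms hs
    refine key m s (by omega) hs ?_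
    obtain ⟨s, rfl⟩ := Nat.exists_eq_succ_of_ne_zero hs
    exact h.depthGE_deg_sub_one hT key s (m + 1) (by omega)

section Rho

variable {A : Type u} [CommRing A] {σ : Type} [Fintype σ] [DecidableEq σ]
  {α : Matrix σ σ A} {γ : σ → A} {m s : ℕ} {T : Finset σ}

/-- The field of fractions of the quotient by `obsAnn`. -/
abbrev ObsFrac (α : Matrix σ σ A) (γ : σ → A) (m s : ℕ) (T : Finset σ) : Type u :=
  FractionRing (A ⧸ obsAnn α γ m s T)

lemma algebraMap_obsFrac_eq_zero {a : A} :
    algebraMap A (ObsFrac α γ m s T) a = 0 ↔ a • obsPow α γ m s T = 0 := by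
  rw [IsScalarTower.algebraMap_apply A (A ⧸ obsAnn α γ m s T),
    FaithfulSMul.algebraMap_eq_zero_iff, Ideal.Quotient.algebraMap_eq,
    Ideal.Quotient.eq_zero_iff_mem, mem_obsAnn]

lemma IsGen.exists_ratio (h : IsGen α γ) (hT : ∀ j, j ∈ T) (hms : m + s = Fintype.card σ)
    (hs : s ≠ 0) : ∃ r : SymA.deg A (ObsMod α γ (m + 1) T) s →ₗ[A] ObsFrac α γ m s T,
      r ⟨obsPow α γ m s T, obsPow_mem _ _ _⟩ = 1 := by
  have hprime := h.isPrime_obsAnn hT hms hs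
  have hex : ∀ x : SymA.deg A (ObsMod α γ (m + 1) T) s, ∃ p : A × A,
      p.1 • obsPow α γ m s T ≠ 0 ∧ p.1 • (x : SymA A _) = p.2 • obsPow α γ m s T := by
    intro x
    obtain ⟨b, hb, a, ha⟩ := obs_rank_one _ rfl h m s T hT hms hs x x.2
    exact ⟨(b, a), hb, ha⟩
  choose p hp1 hp2 using hex
  have hne : ∀ {b : A}, b • obsPow α γ m s T ≠ 0 → algebraMap A (ObsFrac α γ m s T) b ≠ 0 :=
    fun hb => mt algebraMap_obsFrac_eq_zero.mp hb
  have key : ∀ (x : SymA.deg A (ObsMod α γ (m + 1) T) s) (b a : A),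
      b • (x : SymA A _) = a • obsPow α γ m s T →
      algebraMap A (ObsFrac α γ m s T) b *
        (algebraMap A (ObsFrac α γ m s T) (p x).2 / algebraMap A _ (p x).1) =
          algebraMap A _ a := by
    intro x b a hba
    rw [mul_div_assoc', div_eq_iff (hne (hp1 x)), ← map_mul, ← map_mul, ← sub_eq_zero, ← map_sub,
      algebraMap_obsFrac_eq_zero, sub_smul, mul_smul, mul_comm a, mul_smul, ← hba, ← hp2,
      smul_comm, sub_self]
  refine ⟨{ toFun := fun x => algebraMap A _ (p x).2 / algebraMap A _ (p x).1
            map_add' := fun x y => ?_, map_smul' := fun c x => ?_ }, ?_⟩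
  · have h1 := key (x + y) ((p x).1 * (p y).1) ((p y).1 * (p x).2 + (p x).1 * (p y).2) (by
      rw [Submodule.coe_add, smul_add, add_smul, mul_smul _ _ (obsPow α γ m s T),
        mul_smul _ _ (obsPow α γ m s T), ← hp2, ← hp2, smul_smul, smul_smul, mul_comm (p y).1])
    rw [div_add_div _ _ (hne (hp1 x)) (hne (hp1 y)), eq_div_iff
      (mul_ne_zero (hne (hp1 x)) (hne (hp1 y))), mul_comm, ← map_mul, h1]
    simp only [map_add, map_mul]
    ring
  · have h1 := key (c • x) (p x).1 (c * (p x).2) (by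
      rw [Submodule.coe_smul, smul_comm, hp2, mul_smul])
    rw [RingHom.id_apply, Algebra.smul_def, mul_div_assoc', eq_div_iff (hne (hp1 x)), mul_comm,
      h1, map_mul]
  · have h1 := key ⟨obsPow α γ m s T, obsPow_mem _ _ _⟩ 1 1 rfl
    simpa using h1

/-- The evaluation of the symmetric algebra in the fraction field sending the last basis vector
to `1`; it is injective on the relevant graded piece. -/
theorem IsGen.exists_rho (h : IsGen α γ) (hT : ∀ j, j ∈ T) (hms : m + s = Fintype.card σ)
    (hs : s ≠ 0) : ∃ G : SymA A (ObsMod α γ (m + 1) T) →ₐ[A] ObsFrac α γ m s T,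
      G (SymA.ι A _ (obsLast α γ m T)) = 1 ∧
      ∀ x ∈ SymA.deg A (ObsMod α γ (m + 1) T) s, G x = 0 → x = 0 := by
  obtain ⟨r, hr⟩ := h.exists_ratio hT hms hs
  obtain ⟨s, rfl⟩ := Nat.exists_eq_succ_of_ne_zero hs
  have hmem : ∀ c : ObsMod α γ (m + 1) T,
      SymA.ι A _ c * obsPow α γ m s T ∈ SymA.deg A (ObsMod α γ (m + 1) T) (s + 1) :=
    fun c => SymA.ι_mul_mem c (obsPow_mem _ _ _)
  let f : ObsMod α γ (m + 1) T →ₗ[A] ObsFrac α γ m (s + 1) T :=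
    { toFun := fun c => r ⟨_, hmem c⟩
      map_add' := fun c c' => by
        rw [← map_add]; congr 1; ext; simp [add_mul]
      map_smul' := fun a c => by
        rw [RingHom.id_apply, ← map_smul]; congr 1; ext; simp }
  obtain ⟨G, h1, h2⟩ := SymA.exists_lift (algebraMap A (ObsFrac α γ m (s + 1) T))
    f.toAddMonoidHom (fun a c => by
      change f _ = _ * f _
      rw [map_smul, Algebra.smul_def])
  let G' : SymA A (ObsMod α γ (m + 1) T) →ₐ[A] ObsFrac α γ m (s + 1) T :=
    { G with commutes' := h1 }
  have hlast : G' (SymA.ι A _ (obsLast α γ m T)) = 1 := by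
    refine (h2 _).trans (Eq.trans ?_ hr)
    exact congrArg r (Subtype.ext (pow_succ' _ _).symm)
  refine ⟨G', hlast, fun x hx hx0 => ?_⟩
  obtain ⟨b, hb, a, ha⟩ := obs_rank_one _ rfl h m (s + 1) T hT hms hs x hx
  have h3 := congrArg G' ha
  rw [map_smul, map_smul, hx0, smul_zero, obsPow, map_pow, hlast, one_pow,
    Algebra.smul_def, mul_one, eq_comm, algebraMap_obsFrac_eq_zero] at h3
  rw [h3] at ha
  exact (obs_torsion _ rfl h m (s + 1) T hT hms hs x hx b ha).resolve_right hb

end Rho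

lemma dvd_of_eval_scaleRoots {R : Type*} [CommRing R] [IsDomain R] [IsIntegrallyClosed R]
    {p : Polynomial R} (hp : p.Monic) {a b : R} (hb : b ≠ 0)
    (h : (p.scaleRoots b).eval a = 0) : b ∣ a := by
  have hb' : algebraMap R (FractionRing R) b ≠ 0 := by simpa using hb
  have hintegral : IsIntegral R (algebraMap R (FractionRing R) a / algebraMap R _ b) := by
    refine ⟨p, hp, ?_⟩
    have h1 := Polynomial.scaleRoots_eval₂_mul (p := p) (algebraMap R (FractionRing R))
      (algebraMap R (FractionRing R) a / algebraMap R _ b) b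
    rw [mul_div_cancel₀ _ hb', Polynomial.eval₂_at_apply, h, map_zero, eq_comm] at h1
    exact (mul_eq_zero.mp h1).resolve_left (pow_ne_zero _ hb')
  obtain ⟨c, hc⟩ := IsIntegrallyClosed.isIntegral_iff.mp hintegral
  refine ⟨c, IsFractionRing.injective R (FractionRing R) ?_⟩
  rw [map_mul, hc, mul_div_cancel₀ _ hb']

lemma squarefree_of_map {R F : Type*} [CommRing R] [IsDomain R] [Field F] (θ : R →+* F)
    {q : Polynomial R} (hq : q.Monic) (h : Squarefree (q.map θ)) : Squarefree q := by
  rintro g ⟨r, hr⟩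
  have hlc : IsUnit g.leadingCoeff := by
    have h1 := congrArg Polynomial.leadingCoeff hr
    rw [hq.leadingCoeff, Polynomial.leadingCoeff_mul, Polynomial.leadingCoeff_mul, mul_assoc] at h1
    exact IsUnit.of_mul_eq_one _ h1.symm
  have h1 : IsUnit (g.map θ) := h _ ⟨r.map θ, by
    rw [hr, Polynomial.map_mul, Polynomial.map_mul]⟩
  have h2 := Polynomial.natDegree_eq_zero_of_isUnit h1
  rw [Polynomial.natDegree_map_eq_of_isUnit_leadingCoeff θ hlc] at h2
  rw [Polynomial.eq_C_of_natDegree_eq_zero h2]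
  rw [Polynomial.leadingCoeff, h2] at hlc
  exact hlc.map Polynomial.C

lemma exists_smul_eq_of_pow {A : Type u} [CommRing A] {E : Type u} [AddCommGroup E] [Module A E]
    {b : A} (hreg : IsSMulRegular E b) {τ : Type*} [Fintype τ] (g : τ → A)
    (h : DepthGE (Ideal.span (g '' ((Finset.univ : Finset τ) : Set τ))) 2 E) (y : E)
    (hy : ∀ j, ∃ N : ℕ, ∃ x : E, b • x = g j ^ N • y) : ∃ x : E, b • x = y := by
  have h1 := (DepthGE.quotSMulTop hreg h).eq_zero_of_pow Finset.univ g
    (Submodule.Quotient.mk y) (fun j _ => by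
      obtain ⟨N, x, hx⟩ := hy j
      refine ⟨N, ?_⟩
      rw [← Submodule.Quotient.mk_smul, ← hx]
      exact (Submodule.Quotient.mk_eq_zero _).mpr
        ((Submodule.mem_smul_pointwise_iff_exists _ _ _).mpr ⟨x, trivial, rfl⟩))
  obtain ⟨x, -, hx⟩ := (Submodule.mem_smul_pointwise_iff_exists _ _ _).mp
    ((Submodule.Quotient.mk_eq_zero _).mp h1)
  exact ⟨x, hx⟩

section Krylov

variable {A : Type u} [CommRing A] {σ : Type} [Fintype σ] [DecidableEq σ]

/-- The matrix with columns `α^l 𝟙`. -/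
noncomputable def kryMat (α : Matrix σ σ A) : Matrix (Fin (Fintype.card σ)) (Fin (Fintype.card σ)) A :=
  Matrix.of fun p l => (α ^ (l : ℕ) *ᵥ 1) ((Fintype.equivFin σ).symm p)

lemma vecMul_kryMat (α : Matrix σ σ A) (γ : σ → A) (l : Fin (Fintype.card σ)) :
    ((γ ∘ (Fintype.equivFin σ).symm) ᵥ* kryMat α) l = ∑ j, (γ ᵥ* α ^ (l : ℕ)) j := by
  have h1 : ∑ j, (γ ᵥ* α ^ (l : ℕ)) j = (γ ᵥ* α ^ (l : ℕ)) ⬝ᵥ 1 := by simp [dotProduct]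
  rw [h1, ← dotProduct_mulVec, vecMul, dotProduct, dotProduct,
    ← (Fintype.equivFin σ).symm.sum_comp]
  rfl

lemma det_kryMat_smul (α : Matrix σ σ A) (γ : σ → A) (j : σ) :
    (kryMat α).det * γ j = ∑ l : Fin (Fintype.card σ), (∑ i, (γ ᵥ* α ^ (l : ℕ)) i) *
      (kryMat α).adjugate l (Fintype.equivFin σ j) := by
  have h1 : ((γ ∘ (Fintype.equivFin σ).symm) ᵥ* kryMat α) ᵥ* (kryMat α).adjugate =
      (kryMat α).det • (γ ∘ (Fintype.equivFin σ).symm) := by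
    rw [vecMul_vecMul, mul_adjugate, vecMul_smul, vecMul_one]
  have h2 := congrFun h1 (Fintype.equivFin σ j)
  simp only [Pi.smul_apply, Function.comp_apply, Equiv.symm_apply_apply, smul_eq_mul] at h2
  rw [← h2, vecMul, dotProduct]
  simp_rw [vecMul_kryMat]

lemma map_kryMat {R : Type*} [CommRing R] (θ : A →+* R) (α : Matrix σ σ A) :
    θ (kryMat α).det = Matrix.det (Matrix.of fun p l : Fin (Fintype.card σ) =>
      ((α.map θ) ^ (l : ℕ) *ᵥ 1) ((Fintype.equivFin σ).symm p)) := by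
  rw [RingHom.map_det]
  congr 1
  ext p l
  simp only [RingHom.mapMatrix_apply, Matrix.map_apply, kryMat, Matrix.of_apply]
  rw [RingHom.map_mulVec, ← Matrix.map_pow]
  congr 1
  ext i
  simp

variable {α : Matrix σ σ A} {γ : σ → A}

lemma IsGen.exists_residue_squarefree (h : IsGen α γ) :
    ∃ (A₀ : Type u) (_ : CommRing A₀) (_ : IsDomain A₀)
    (_ : UniqueFactorizationMonoid A₀) (ρ : A →+* A₀),
    Function.Surjective ρ ∧ RingHom.ker ρ = Ideal.span (Set.range γ) ∧
    Squarefree (α.charpoly.map ρ) ∧ ρ (kryMat α).det ≠ 0 := by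
  obtain ⟨A₀, _, _, _, _, ρ, hρ, hker, k, _, _, _, hθ⟩ := h.exists_residue
  obtain ⟨θ, hθ⟩ := hθ (Matrix.diagonal fun j => ((Fintype.equivFin σ j : ℕ) : k))
  let θ' : A₀ →+* FractionRing k := (algebraMap k (FractionRing k)).comp θ
  have hchar := IsFractionRing.charZero k
  have hmap : (α.map ρ).map θ' =
      Matrix.diagonal fun j => ((Fintype.equivFin σ j : ℕ) : FractionRing k) := by
    ext i j
    simp only [Matrix.map_apply, θ', RingHom.comp_apply, hθ, Matrix.diagonal_apply]
    split_ifs <;> simp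
  have hinj : Function.Injective fun j => ((Fintype.equivFin σ j : ℕ) : FractionRing k) := by
    intro i j hij
    exact (Fintype.equivFin σ).injective (Fin.ext (Nat.cast_injective hij))
  refine ⟨A₀, inferInstance, inferInstance, inferInstance, ρ, hρ, hker, ?_, fun h0 => ?_⟩
  · rw [← Matrix.charpoly_map]
    refine squarefree_of_map θ' (Matrix.charpoly_monic _) ?_
    rw [← Matrix.charpoly_map, hmap, Matrix.charpoly_diagonal]
    exact (Polynomial.separable_prod_X_sub_C_iff.mpr hinj).squarefree
  · have h1 := congrArg θ' h0
    rw [← RingHom.comp_apply, map_zero, map_kryMat, RingHom.coe_comp, ← Matrix.map_map, hmap] at h1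
    have h2 : (Matrix.of fun p l : Fin (Fintype.card σ) =>
        ((Matrix.diagonal fun j => ((Fintype.equivFin σ j : ℕ) : FractionRing k)) ^ (l : ℕ) *ᵥ 1)
          ((Fintype.equivFin σ).symm p)) =
        Matrix.vandermonde fun p : Fin (Fintype.card σ) => ((p : ℕ) : FractionRing k) := by
      ext p l
      rw [Matrix.of_apply, Matrix.diagonal_pow, Matrix.mulVec_diagonal]
      simp [Matrix.vandermonde]
    rw [h2] at h1
    exact Matrix.det_vandermonde_ne_zero_iff.mpr
      (fun p q hpq => Fin.ext (Nat.cast_injective hpq)) h1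

end Krylov

section Normal

variable {A : Type u} [CommRing A] {σ : Type} [Fintype σ] [DecidableEq σ]
  {α : Matrix σ σ A} {γ : σ → A} {m s : ℕ} {T : Finset σ}

lemma IsGen.isSMulRegular_deg (h : IsGen α γ) (hT : ∀ j, j ∈ T)
    (hms : m + s = Fintype.card σ) (hs : s ≠ 0) {b : A} (hb : b • obsPow α γ m s T ≠ 0) :
    IsSMulRegular (SymA.deg A (ObsMod α γ (m + 1) T) s) b := by
  rintro ⟨x, hx⟩ ⟨y, hy⟩ hxy
  have hxy' : b • x = b • y := congrArg Subtype.val hxy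
  exact Subtype.ext (sub_eq_zero.mp ((obs_torsion _ rfl h m s T hT hms hs _
    (Submodule.sub_mem _ hx hy) b (by rw [smul_sub, hxy', sub_self])).resolve_right hb))

lemma IsGen.obs_normal_zero (h : IsGen α γ) (hT : ∀ j, j ∈ T) (hs : s ≠ 0) {a b : A}
    {p : Polynomial A} (hp : p.Monic) (hb : b • obsPow α γ 0 s T ≠ 0)
    (hab : (p.scaleRoots b).eval a • obsPow α γ 0 s T = 0) :
    ∃ x ∈ SymA.deg A (ObsMod α γ 1 T) s, b • x = a • obsPow α γ 0 s T := by
  obtain ⟨A₀, _, _, _, ρ, hρ, hker, -, -⟩ := h.exists_residue_squarefree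
  have hiff : ∀ a, a • obsPow α γ 0 s T = 0 ↔ ρ a = 0 := fun a => by
    rw [h.smul_obsPow_zero_iff hs hT, ← hker, RingHom.mem_ker]
  rw [Ne, hiff] at hb
  rw [hiff, ← Polynomial.eval₂_at_apply, ← Polynomial.eval_map,
    Polynomial.map_scaleRoots _ _ _ (by rw [hp.leadingCoeff, map_one]; exact one_ne_zero)] at hab
  obtain ⟨c, hc⟩ := dvd_of_eval_scaleRoots (hp.map ρ) hb hab
  obtain ⟨c, rfl⟩ := hρ c
  refine ⟨c • obsPow α γ 0 s T, Submodule.smul_mem _ _ (obsPow_mem _ _ _), ?_⟩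
  rw [smul_smul, ← sub_eq_zero, ← sub_smul, hiff, map_sub, map_mul, hc, sub_self]

/-- Depth of the graded piece just before the top one, with respect to a larger ideal. -/
lemma IsGen.depthGE_kry (h : IsGen α γ) (T : Finset σ) (hs : 1 + s = Fintype.card σ) :
    DepthGE (Ideal.span ((fun o : Option σ => o.elim (kryMat α).det γ) ''
      ((Finset.univ : Finset (Option σ)) : Set (Option σ)))) 2
      (SymA.deg A (ObsMod α γ 2 T) s) := by
  set I := Ideal.span ((fun o : Option σ => o.elim (kryMat α).det γ) ''
      ((Finset.univ : Finset (Option σ)) : Set (Option σ)))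
  obtain ⟨A₀, _, _, _, ρ, hρ, hker, -, hβ⟩ := h.exists_residue_squarefree
  have hset : (Set.range γ) = γ '' (↑((Finset.univ : Finset σ) ∪ ∅) : Set σ) := by simp
  have hmem : (kryMat α).det ∈ I := Ideal.subset_span ⟨none, by simp, rfl⟩
  have hreg : IsSMulRegular (A ⧸ Ideal.span (γ '' (↑((Finset.univ : Finset σ) ∪ ∅) : Set σ)))
      (kryMat α).det := by
    rw [isSMulRegular_iff_right_eq_zero_of_smul]
    intro x hx
    obtain ⟨x, rfl⟩ := Submodule.Quotient.mk_surjective _ x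
    rw [← Submodule.Quotient.mk_smul, Submodule.Quotient.mk_eq_zero, ← hset, ← hker,
      RingHom.mem_ker, smul_eq_mul, map_mul] at hx
    rw [Submodule.Quotient.mk_eq_zero, ← hset, ← hker, RingHom.mem_ker]
    exact (mul_eq_zero.mp hx).resolve_left hβ
  have h1 := h.depthGE_add I (r := 1) Finset.univ ∅ (by simp)
    (fun j _ => Ideal.subset_span ⟨some j, by simp, rfl⟩)
    (DepthGE.of_isSMulRegular hmem hreg DepthGE.zero)
  have h2 : DepthGE I (1 + Fintype.card σ) A :=
    h1.equiv (Submodule.quotEquivOfEqBot _ (by simp))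
  have hcard : T.card ≤ Fintype.card σ := Finset.card_le_univ T
  exact (h.depthGE_deg h2 2 T s (by omega)).mono (by omega)

end Normal

section Mu

open Polynomial

variable {A : Type u} [CommRing A] {σ : Type} [Fintype σ] [DecidableEq σ]
  {α : Matrix σ σ A} {γ : σ → A} {s : ℕ} {T : Finset σ}
  {F : Type u} [Field F] [Algebra A F] {μ : F}

lemma algebraMap_vecMul_pow (hμ : ∀ j, algebraMap A F ((γ ᵥ* α) j) = μ * algebraMap A F (γ j))
    (k : ℕ) (j : σ) :
    algebraMap A F ((γ ᵥ* α ^ k) j) = μ ^ k * algebraMap A F (γ j) := by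
  induction k generalizing j with
  | zero => simp
  | succ k ih =>
    rw [pow_succ, ← vecMul_vecMul, vecMul, dotProduct, map_sum]
    simp_rw [map_mul, ih]
    rw [pow_succ, mul_assoc, ← hμ, vecMul, dotProduct, map_sum, Finset.mul_sum]
    simp_rw [map_mul, mul_assoc]

lemma aeval_charpoly_eq_zero
    (hμ : ∀ j, algebraMap A F ((γ ᵥ* α) j) = μ * algebraMap A F (γ j))
    {i : σ} (hi : algebraMap A F (γ i) ≠ 0) : aeval μ α.charpoly = 0 := by
  rw [aeval_def, ← eval_map, ← Matrix.charpoly_map, Matrix.eval_charpoly,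
    ← Matrix.exists_vecMul_eq_zero_iff]
  refine ⟨algebraMap A F ∘ γ, fun h => hi (congrFun h i), ?_⟩
  funext j
  rw [vecMul_sub, Pi.sub_apply, Pi.zero_apply, sub_eq_zero, ← RingHom.map_vecMul, hμ,
    Matrix.scalar_apply, Matrix.vecMul_diagonal, mul_comm]
  rfl

lemma exists_kry_mul_aeval
    (hμ : ∀ j, algebraMap A F ((γ ᵥ* α) j) = μ * algebraMap A F (γ j)) {f : A[X]}
    (hf : f ∈ Ideal.map C (Ideal.span (Set.range γ))) :
    ∃ w : A[X], algebraMap A F (kryMat α).det * aeval μ f =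
      algebraMap A F (∑ j, γ j) * aeval μ w := by
  rw [Ideal.map_span] at hf
  induction hf using Submodule.span_induction with
  | mem f hf =>
    obtain ⟨_, ⟨j, rfl⟩, rfl⟩ := hf
    refine ⟨∑ l : Fin (Fintype.card σ), X ^ (l : ℕ) *
      C ((kryMat α).adjugate l (Fintype.equivFin σ j)), ?_⟩
    rw [aeval_C, ← map_mul, det_kryMat_smul α γ, map_sum (algebraMap A F),
      map_sum (aeval μ), Finset.mul_sum]
    refine Finset.sum_congr rfl fun l _ => ?_
    simp only [map_mul, map_sum, map_pow, aeval_X, aeval_C, algebraMap_vecMul_pow hμ]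
    rw [← Finset.mul_sum]
    ring
  | zero => exact ⟨0, by simp⟩
  | add f g _ _ hf hg =>
    obtain ⟨w, hw⟩ := hf
    obtain ⟨v, hv⟩ := hg
    exact ⟨w + v, by rw [map_add, mul_add, hw, hv, map_add, mul_add]⟩
  | smul r f _ hf =>
    obtain ⟨w, hw⟩ := hf
    exact ⟨r * w, by rw [smul_eq_mul, map_mul, mul_left_comm, hw, map_mul, mul_left_comm]⟩

lemma exists_aeval_mem {A₀ : Type u} [CommRing A₀] [IsDomain A₀] [UniqueFactorizationMonoid A₀]
    {ρ : A →+* A₀} (hρ : Function.Surjective ρ) (hker : RingHom.ker ρ = Ideal.span (Set.range γ))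
    (hsq : Squarefree (α.charpoly.map ρ)) (hχ : aeval μ α.charpoly = 0)
    (hdvd : ∀ f : A[X], aeval μ f = 0 → α.charpoly.map ρ ∣ f.map ρ)
    {g : A} (hg : ρ g = 0) {z : F} (hz : IsIntegral A z) {f : A[X]}
    (hf : algebraMap A F g * z = aeval μ f) :
    ∃ f' ∈ Ideal.map C (Ideal.span (Set.range γ)), aeval μ f = aeval μ f' := by
  obtain ⟨p, hp, hpz⟩ := hz
  have h1 : aeval μ (aeval f (p.scaleRoots g)) = 0 := by
    rw [← Polynomial.aeval_algHom_apply, ← hf, aeval_def, scaleRoots_eval₂_mul, hpz, mul_zero]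
  have h2 : (aeval f (p.scaleRoots g)).map ρ = f.map ρ ^ p.natDegree := by
    have h3 : (p.scaleRoots g).map ρ = X ^ p.natDegree := by
      rw [map_scaleRoots _ _ _ (by rw [hp.leadingCoeff, map_one]; exact one_ne_zero), hg,
        scaleRoots_zero, (hp.map ρ).leadingCoeff, hp.natDegree_map, one_smul]
    have h4 : (mapRingHom ρ).comp (algebraMap A A[X]) = (C : A₀ →+* A₀[X]).comp ρ := by
      ext; simp
    rw [aeval_def, ← coe_mapRingHom, hom_eval₂, h4, ← eval₂_map, h3, eval₂_X_pow]
  have h5 := hdvd _ h1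
  rw [h2] at h5
  obtain ⟨r, hr⟩ := hsq.isRadical _ _ h5
  obtain ⟨r, rfl⟩ := map_surjective ρ hρ r
  refine ⟨f - α.charpoly * r, ?_, by rw [map_sub, map_mul, hχ, zero_mul, sub_zero]⟩
  rw [← hker, ← Polynomial.ker_mapRingHom, RingHom.mem_ker, coe_mapRingHom, Polynomial.map_sub,
    Polynomial.map_mul, hr, sub_self]

lemma exists_kry_pow_mul
    (hμ : ∀ j, algebraMap A F ((γ ᵥ* α) j) = μ * algebraMap A F (γ j))
    (hg : algebraMap A F (∑ j, γ j) ≠ 0)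
    (h2 : ∀ z : F, IsIntegral A z → ∀ f : A[X],
      (∃ N : ℕ, algebraMap A F (∑ j, γ j) ^ (N + 1) * z = aeval μ f) →
      ∃ f' ∈ Ideal.map C (Ideal.span (Set.range γ)), aeval μ f = aeval μ f') (N : ℕ) :
    ∀ z : F, IsIntegral A z → ∀ f : A[X], algebraMap A F (∑ j, γ j) ^ N * z = aeval μ f →
      ∃ w : A[X], algebraMap A F (kryMat α).det ^ N * z = aeval μ w := by
  induction N with
  | zero => intro z _ f hf; exact ⟨f, by simpa using hf⟩
  | succ N ih =>
    intro z hz f hf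
    obtain ⟨f', hf', hff'⟩ := h2 z hz f ⟨N, hf⟩
    obtain ⟨w, hw⟩ := exists_kry_mul_aeval hμ hf'
    obtain ⟨v, hv⟩ := ih (algebraMap A F (kryMat α).det * z) (isIntegral_algebraMap.mul hz) w (by
      refine mul_left_cancel₀ hg ?_
      rw [← hw, ← hff', ← hf]
      ring)
    exact ⟨v, by rw [← hv]; ring⟩

end Mu

section MuObs

open Polynomial

variable {A : Type u} [CommRing A] {σ : Type} [Fintype σ] [DecidableEq σ]
  {α : Matrix σ σ A} {γ : σ → A} {s : ℕ} {T : Finset σ}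
  {F : Type u} [Field F] [Algebra A F]

variable (α γ T) in
/-- The class of the first basis vector. -/
def obsFst : ObsMod α γ (1 + 1) T := Submodule.Quotient.mk (Pi.single 0 1)

lemma obsMod_two_eq (v : Fin (1 + 1) → A) : (Submodule.Quotient.mk v : ObsMod α γ (1 + 1) T) =
    v 0 • obsFst α γ T + v 1 • obsLast α γ 1 T := by
  rw [obsFst, obsLast, ← Submodule.Quotient.mk_smul, ← Submodule.Quotient.mk_smul,
    ← Submodule.Quotient.mk_add]
  congr 1
  funext k
  fin_cases k <;> simp [Fin.last]

variable {G : SymA A (ObsMod α γ (1 + 1) T) →ₐ[A] F} {μ : F}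

lemma mu_relation (hT : ∀ j, j ∈ T) (hG : G (SymA.ι A _ (obsLast α γ 1 T)) = 1)
    (hμ : G (SymA.ι A _ (obsFst α γ T)) = -μ) (j : σ) :
    algebraMap A F ((γ ᵥ* α) j) = μ * algebraMap A F (γ j) := by
  have h1 := obsCls_eq_zero (α := α) (γ := γ) (m := 1 + 1) (hT j)
  rw [obsCls, obsMod_two_eq] at h1
  have h2 := congrArg (fun c => G (SymA.ι A _ c)) h1
  simp only [map_add, _root_.map_smul, map_zero, hG, hμ, obsVec] at h2
  simp only [Algebra.smul_def, Fin.val_zero, pow_zero, vecMul_one, mul_neg, Fin.val_one, pow_one,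
    mul_one] at h2
  linear_combination h2

lemma exists_aeval_eq (hG : G (SymA.ι A _ (obsLast α γ 1 T)) = 1)
    (hμ : G (SymA.ι A _ (obsFst α γ T)) = -μ) (x : SymA A (ObsMod α γ (1 + 1) T)) :
    ∃ f : A[X], G x = aeval μ f := by
  induction x using SymA.induction with
  | algebraMap r => exact ⟨C r, by simp⟩
  | ι c =>
    obtain ⟨v, rfl⟩ := Submodule.Quotient.mk_surjective _ c
    refine ⟨C (v 1) - C (v 0) * X, ?_⟩
    rw [obsMod_two_eq]
    simp only [map_add, _root_.map_smul, hG, hμ, map_sub, map_mul, aeval_C, aeval_X]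
    simp only [Algebra.smul_def]
    ring
  | mul a b ha hb =>
    obtain ⟨f, hf⟩ := ha
    obtain ⟨g, hg⟩ := hb
    exact ⟨f * g, by rw [map_mul, hf, hg, map_mul]⟩
  | add a b ha hb =>
    obtain ⟨f, hf⟩ := ha
    obtain ⟨g, hg⟩ := hb
    exact ⟨f + g, by rw [map_add, hf, hg, map_add]⟩

variable (α γ T) in
/-- Homogenization of a polynomial in degree `s`. -/
noncomputable def obsHomog (s : ℕ) (f : A[X]) : SymA A (ObsMod α γ (1 + 1) T) :=
  ∑ k ∈ Finset.range (s + 1), f.coeff k •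
    ((-SymA.ι A _ (obsFst α γ T)) ^ k * SymA.ι A _ (obsLast α γ 1 T) ^ (s - k))

lemma obsHomog_mem (f : A[X]) : obsHomog α γ T s f ∈ SymA.deg A _ s := by
  refine Submodule.sum_mem _ fun k hk => Submodule.smul_mem _ _ ?_
  have hk' := Finset.mem_range.mp hk
  have h1 := SymA.mul_mem (SymA.ι_pow_mem (A := A) k (-obsFst α γ T))
    (SymA.ι_pow_mem (A := A) (s - k) (obsLast α γ 1 T))
  rwa [map_neg, Nat.add_sub_cancel' (by omega)] at h1

lemma map_obsHomog {R : Type*} [CommRing R] (H : SymA A (ObsMod α γ (1 + 1) T) →+* R) {ν : R}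
    (hH : H (SymA.ι A _ (obsLast α γ 1 T)) = 1) (hν : H (SymA.ι A _ (obsFst α γ T)) = -ν)
    (f : A[X]) : H (obsHomog α γ T s f) =
      ∑ k ∈ Finset.range (s + 1), H (algebraMap A _ (f.coeff k)) * ν ^ k := by
  rw [obsHomog, map_sum]
  refine Finset.sum_congr rfl fun k _ => ?_
  rw [Algebra.smul_def, map_mul, map_mul, map_pow, map_pow, map_neg, hH, hν, one_pow, neg_neg,
    mul_one]

lemma aeval_eq_obsHomog (hG : G (SymA.ι A _ (obsLast α γ 1 T)) = 1)
    (hμ : G (SymA.ι A _ (obsFst α γ T)) = -μ) {f : A[X]} (hf : f.natDegree < s + 1) :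
    G (obsHomog α γ T s f) = aeval μ f := by
  have := map_obsHomog (s := s) (G : SymA A (ObsMod α γ (1 + 1) T) →+* F) hG hμ f
  rw [aeval_eq_sum_range' hf]
  refine this.trans (Finset.sum_congr rfl fun k _ => ?_)
  rw [Algebra.smul_def]
  exact congrArg (· * μ ^ k) (G.commutes _)

lemma exists_mem_deg_eq_aeval [Nontrivial A] (hs : 1 + s = Fintype.card σ)
    (hG : G (SymA.ι A _ (obsLast α γ 1 T)) = 1)
    (hμ : G (SymA.ι A _ (obsFst α γ T)) = -μ) (hχ : aeval μ α.charpoly = 0) (f : A[X]) :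
    ∃ x ∈ SymA.deg A (ObsMod α γ (1 + 1) T) s, G x = aeval μ f := by
  have hne : α.charpoly ≠ 1 := by
    intro h1
    have := Matrix.charpoly_natDegree_eq_dim α
    rw [h1, natDegree_one] at this
    omega
  refine ⟨obsHomog α γ T s (f %ₘ α.charpoly), obsHomog_mem _, ?_⟩
  have h1 := natDegree_modByMonic_lt f (Matrix.charpoly_monic α) hne
  rw [Matrix.charpoly_natDegree_eq_dim] at h1
  rw [aeval_eq_obsHomog hG hμ (by omega)]
  conv_rhs => rw [← modByMonic_add_div f α.charpoly]
  rw [map_add, map_mul, hχ, zero_mul, add_zero]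

lemma charpoly_map_dvd [Nontrivial A] (hs : 1 + s = Fintype.card σ)
    (hG : G (SymA.ι A _ (obsLast α γ 1 T)) = 1)
    (hμ : G (SymA.ι A _ (obsFst α γ T)) = -μ) (hχ : aeval μ α.charpoly = 0)
    (hinj : ∀ x ∈ SymA.deg A (ObsMod α γ (1 + 1) T) s, G x = 0 → x = 0)
    {A₀ : Type u} [CommRing A₀] {ρ : A →+* A₀}
    (hker : RingHom.ker ρ = Ideal.span (Set.range γ)) {f : A[X]} (hf : aeval μ f = 0) :
    α.charpoly.map ρ ∣ f.map ρ := by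
  have hne : α.charpoly ≠ 1 := by
    intro h1
    have := Matrix.charpoly_natDegree_eq_dim α
    rw [h1, natDegree_one] at this
    omega
  have h1 := natDegree_modByMonic_lt f (Matrix.charpoly_monic α) hne
  rw [Matrix.charpoly_natDegree_eq_dim] at h1
  set r := f %ₘ α.charpoly with hr
  have hfr := modByMonic_add_div f α.charpoly
  rw [← hr] at hfr
  have h2 : aeval μ r = 0 := by
    have := congrArg (aeval μ) hfr
    rwa [map_add, map_mul, hχ, zero_mul, add_zero, hf] at this
  rw [← aeval_eq_obsHomog (s := s) hG hμ (by omega)] at h2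
  have h3 := hinj _ (obsHomog_mem _) h2
  have hγ : ∀ j, ρ (γ j) = 0 := fun j => by
    rw [← RingHom.mem_ker, hker]; exact Ideal.subset_span ⟨j, rfl⟩
  obtain ⟨H, hH1, hH2⟩ := exists_obsEval (α := α) (γ := γ) (T := T) (m := 1 + 1)
    ((C : A₀ →+* A₀[X]).comp ρ) ![-X, 1] (fun j _ => by
      refine Finset.sum_eq_zero fun k _ => ?_
      have : ρ ∘ γ = 0 := funext hγ
      rw [RingHom.comp_apply, map_vecMul_pow ρ, this, zero_vecMul]
      simp)
  have h4 := congrArg H h3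
  rw [map_obsHomog (ν := X) H (by rw [obsLast, hH2]; simp [Fin.sum_univ_succ, Fin.last])
    (by rw [obsFst, hH2]; simp [Fin.sum_univ_succ]), map_zero] at h4
  simp only [hH1, RingHom.comp_apply] at h4
  have h5 : r.map ρ = 0 := by
    rw [← h4, as_sum_range_C_mul_X_pow' (r.map ρ) (lt_of_le_of_lt natDegree_map_le
      (show r.natDegree < s + 1 by omega))]
    simp
  rw [← hfr, Polynomial.map_add, Polynomial.map_mul, h5, zero_add]
  exact dvd_mul_right _ _

lemma IsGen.sum_smul_obsPow_ne_zero (h : IsGen α γ) {m : ℕ} (hm : m ≠ 0) (s : ℕ) (T : Finset σ)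
    (i : σ) : (∑ j, γ j) • obsPow α γ m s T ≠ 0 := by
  intro ha
  obtain ⟨k, _, _, _, hθ⟩ := h.exists_eval
  obtain ⟨θ, hα, hγ⟩ := hθ 0 (Pi.single i 1)
  obtain ⟨G, h1, h2⟩ := exists_obsEval_last (α := α) (γ := γ) (m := m) (T := T) θ (fun j _ => by
    have : α.map θ = 0 := by ext a b; exact hα a b
    rw [map_vecMul_pow, this, zero_pow hm, vecMul_zero]; rfl)
  have := congrArg G ha
  rw [Algebra.smul_def, map_mul, h1, obsPow, map_pow, h2, one_pow, mul_one, map_zero] at this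
  simp [hγ] at this

lemma isIntegral_div_of_scaleRoots {a b : A} {p : A[X]} (hp : p.Monic)
    (hb : algebraMap A F b ≠ 0) (hab : algebraMap A F ((p.scaleRoots b).eval a) = 0) :
    IsIntegral A (algebraMap A F a / algebraMap A F b) := by
  refine ⟨p, hp, ?_⟩
  have h1 := scaleRoots_eval₂_mul (p := p) (algebraMap A F)
    (algebraMap A F a / algebraMap A F b) b
  rw [mul_div_cancel₀ _ hb, eval₂_at_apply, hab, eq_comm] at h1
  exact (mul_eq_zero.mp h1).resolve_left (pow_ne_zero _ hb)

lemma IsGen.exists_kry_smul (h : IsGen α γ) (hT : ∀ j, j ∈ T) (hms : 1 + s = Fintype.card σ)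
    (hs : s ≠ 0) {a b : A} {p : A[X]} (hp : p.Monic) (hb : b • obsPow α γ 1 s T ≠ 0)
    (hab : (p.scaleRoots b).eval a • obsPow α γ 1 s T = 0)
    (hx : ∀ i, ∃ N : ℕ, ∃ x ∈ SymA.deg A (ObsMod α γ (1 + 1) T) s,
      b • x = γ i ^ N • a • obsPow α γ 1 s T) :
    ∃ N : ℕ, ∃ x ∈ SymA.deg A (ObsMod α γ (1 + 1) T) s,
      b • x = (kryMat α).det ^ N • a • obsPow α γ 1 s T := by
  have hprime := h.isPrime_obsAnn hT hms hs
  have hdom := h.isDomain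
  obtain ⟨i⟩ : Nonempty σ := Fintype.card_pos_iff.mp (by omega)
  obtain ⟨G, hG, hinj⟩ := h.exists_rho hT hms hs
  obtain ⟨A₀, _, _, _, ρ, hρ, hker, hsq, -⟩ := h.exists_residue_squarefree
  have hFne : ∀ {c : A}, c • obsPow α γ 1 s T ≠ 0 → algebraMap A (ObsFrac α γ 1 s T) c ≠ 0 :=
    fun hc => mt algebraMap_obsFrac_eq_zero.mp hc
  have hF0 : ∀ {c : A}, c • obsPow α γ 1 s T = 0 → algebraMap A (ObsFrac α γ 1 s T) c = 0 :=
    fun hc => algebraMap_obsFrac_eq_zero.mpr hc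
  have hGpow : G (obsPow α γ 1 s T) = 1 := by rw [obsPow, map_pow, hG, one_pow]
  obtain ⟨μ, hμ⟩ : ∃ μ, G (SymA.ι A _ (obsFst α γ T)) = -μ := ⟨-_, (neg_neg _).symm⟩
  have hrel := mu_relation hT hG hμ
  have hγi : algebraMap A (ObsFrac α γ 1 s T) (γ i) ≠ 0 :=
    hFne (by simpa using h.pow_smul_obsPow_ne_zero one_ne_zero s T i i 1 0)
  have hχ := aeval_charpoly_eq_zero hrel hγi
  have hg := hFne (h.sum_smul_obsPow_ne_zero one_ne_zero s T i)
  have hρg : ρ (∑ j, γ j) = 0 := by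
    rw [← RingHom.mem_ker, hker]
    exact Ideal.sum_mem _ fun j _ => Ideal.subset_span ⟨j, rfl⟩
  have hb' := hFne hb
  have hz := isIntegral_div_of_scaleRoots hp hb' (hF0 hab)
  set z := algebraMap A (ObsFrac α γ 1 s T) a / algebraMap A _ b with hzdef
  have hbz : algebraMap A _ b * z = algebraMap A (ObsFrac α γ 1 s T) a := mul_div_cancel₀ _ hb'
  let J : Ideal A :=
    { carrier := {c | ∃ f : A[X], algebraMap A (ObsFrac α γ 1 s T) c * z = aeval μ f}
      add_mem' := by
        rintro c c' ⟨f, hf⟩ ⟨f', hf'⟩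
        exact ⟨f + f', by rw [map_add, add_mul, hf, hf', map_add]⟩
      zero_mem' := ⟨0, by simp⟩
      smul_mem' := by
        rintro c c' ⟨f, hf⟩
        exact ⟨C c * f, by rw [smul_eq_mul, map_mul, mul_assoc, hf, map_mul, aeval_C]⟩ }
  have hJ : ∑ j, γ j ∈ J.radical := by
    refine Ideal.sum_mem _ fun j _ => ?_
    obtain ⟨N, x, -, hx⟩ := hx j
    obtain ⟨f, hf⟩ := exists_aeval_eq hG hμ x
    refine ⟨N, f, mul_left_cancel₀ hb' ?_⟩
    have h1 := congrArg G hx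
    rw [_root_.map_smul, _root_.map_smul, _root_.map_smul, hGpow, hf] at h1
    simp only [Algebra.smul_def, mul_one] at h1
    rw [h1, mul_left_comm, hbz]
  obtain ⟨N, f, hf⟩ := hJ
  rw [map_pow] at hf
  obtain ⟨w, hw⟩ := exists_kry_pow_mul hrel hg (fun z hz f ⟨N, hN⟩ =>
    exists_aeval_mem (g := (∑ j, γ j) ^ (N + 1)) hρ hker hsq hχ
      (fun f hf => charpoly_map_dvd hms hG hμ hχ hinj hker hf)
      (by rw [map_pow, hρg, zero_pow (Nat.succ_ne_zero N)]) hz (by rw [map_pow, hN])) N z hz f hf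
  obtain ⟨x, hx, hxw⟩ := exists_mem_deg_eq_aeval hms hG hμ hχ w
  refine ⟨N, x, hx, sub_eq_zero.mp (hinj _ (Submodule.sub_mem _ (Submodule.smul_mem _ _ hx)
    (Submodule.smul_mem _ _ (Submodule.smul_mem _ _ (obsPow_mem _ _ _)))) ?_)⟩
  rw [map_sub, _root_.map_smul, _root_.map_smul, _root_.map_smul, hGpow, hxw, ← hw]
  simp only [Algebra.smul_def, mul_one, map_pow]
  rw [mul_left_comm, hbz, sub_self]

end MuObs

lemma map_eval_scaleRoots {A B : Type*} [CommRing A] [CommRing B] [Nontrivial B] (f : A →+* B)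
    {p : Polynomial A} (hp : p.Monic) (a b : A) :
    ((p.map f).scaleRoots (f b)).eval (f a) = f ((p.scaleRoots b).eval a) := by
  rw [← Polynomial.map_scaleRoots _ _ _ (by rw [hp.leadingCoeff, map_one]; exact one_ne_zero),
    Polynomial.eval_map, Polynomial.eval₂_at_apply]

/-- Fractions of the generator which are integral lie in the graded piece. -/
theorem obs_normal (n : ℕ) : ∀ {A : Type u} [CommRing A] {σ : Type} [Fintype σ]
    [DecidableEq σ] {α : Matrix σ σ A} {γ : σ → A}, Fintype.card σ = n → IsGen α γ →
    ∀ (m s : ℕ) (T : Finset σ), (∀ j, j ∈ T) → m + s = n → s ≠ 0 →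
      ∀ (a b : A) (p : Polynomial A), p.Monic → b • obsPow α γ m s T ≠ 0 →
      (p.scaleRoots b).eval a • obsPow α γ m s T = 0 →
      ∃ x ∈ SymA.deg A (ObsMod α γ (m + 1) T) s, b • x = a • obsPow α γ m s T := by
  induction n with
  | zero => intro A _ σ _ _ α γ _ _ m s T _ _ _; omega
  | succ n IH =>
    intro A _ σ _ _ α γ hn h m s T hT hms hs a b p hp hb hab
    rcases m with _ | m
    · exact h.obs_normal_zero hT hs hp hb hab
    have hy0 := obsPow_mem (α := α) (γ := γ) (m + 1) s T
    have key : ∀ i, ∃ N : ℕ, ∃ x ∈ SymA.deg A (ObsMod α γ (m + 1 + 1) T) s,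
        b • x = γ i ^ N • a • obsPow α γ (m + 1) s T := by
      intro i
      have hinj := h.injective_chart i (Localization.Away (γ i))
      have hchart := h.chart (B := Localization.Away (γ i)) i
      have hdomB := hchart.isDomain
      have hc := card_ne i
      set f := algebraMap A (Localization.Away (γ i)) with hf
      have hφ : ∀ c : A, chartSym (Localization.Away (γ i)) α γ i (m + 1) T
          (c • obsPow α γ (m + 1) s T) = f c • obsPow _ _ m s _ := fun c => by
        rw [chartSym_smul, chartSym_obsPow]
      have hb' : f b • obsPow (chartMat (Localization.Away (γ i)) α γ i)
          (chartVec (Localization.Away (γ i)) α γ i) m s (T.subtype (· ≠ i)) ≠ 0 := by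
        rw [← hφ]
        intro h0
        obtain ⟨N, hN⟩ := exists_pow_smul_of_chartSym_eq_zero hinj (hT i) h0
        rcases obs_torsion _ rfl h (m + 1) s T hT (by omega) hs _
          (Submodule.smul_mem _ b hy0) _ hN with h1 | h1
        · exact hb h1
        · exact h.pow_smul_obsPow_ne_zero (Nat.succ_ne_zero m) s T i i N 0 (by simpa using h1)
      obtain ⟨y, hy, hyb⟩ := IH (by omega) hchart m s (T.subtype (· ≠ i)) (by simp [hT])
        (by omega) hs (f a) (f b) (p.map f) (hp.map f) hb' (by
          rw [map_eval_scaleRoots f hp, ← hφ, hab, map_zero])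
      obtain ⟨N, x, hx, hxy⟩ := exists_chartSym_eq_pow_smul hinj (hT i) hy
      have h0 : chartSym (Localization.Away (γ i)) α γ i (m + 1) T
          (b • x - γ i ^ N • a • obsPow α γ (m + 1) s T) = 0 := by
        rw [map_sub, chartSym_smul, hxy, chartSym_smul, hφ, ← hyb, smul_comm, map_pow, sub_self]
      obtain ⟨L, hL⟩ := exists_pow_smul_of_chartSym_eq_zero hinj (hT i) h0
      refine ⟨L + N, γ i ^ L • x, Submodule.smul_mem _ _ hx, ?_⟩
      rw [smul_sub, sub_eq_zero] at hL
      rw [smul_comm, hL, pow_add, mul_smul]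
    have hreg := h.isSMulRegular_deg (m := m + 1) hT (by omega) hs hb
    rcases m with _ | m
    · have hkry := h.exists_kry_smul hT (by omega) hs hp hb hab key
      obtain ⟨x, hx⟩ := exists_smul_eq_of_pow hreg _ (h.depthGE_kry T (by omega))
        (a • ⟨obsPow α γ 1 s T, hy0⟩) (fun o => by
          rcases o with _ | i
          · obtain ⟨N, x, hx, hbx⟩ := hkry
            exact ⟨N, ⟨x, hx⟩, Subtype.ext hbx⟩
          · obtain ⟨N, x, hx, hbx⟩ := key i
            exact ⟨N, ⟨x, hx⟩, Subtype.ext hbx⟩)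
      exact ⟨x, x.2, congrArg Subtype.val hx⟩
    · obtain ⟨x, hx⟩ := exists_smul_eq_of_pow hreg γ
        ((h.depthGE_deg_gam (m + 1 + 1) s T hT (by omega)).mono (by omega))
        (a • ⟨obsPow α γ (m + 1 + 1) s T, hy0⟩) (fun i => by
          obtain ⟨N, x, hx, hbx⟩ := key i
          exact ⟨N, ⟨x, hx⟩, Subtype.ext hbx⟩)
      exact ⟨x, x.2, congrArg Subtype.val hx⟩

section Integral

open Polynomial

variable {A : Type u} [CommRing A] {σ : Type} [Fintype σ] [DecidableEq σ]
  {α : Matrix σ σ A} {γ : σ → A} {m s : ℕ} {T : Finset σ}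

lemma map_smul_obsPow_eq {F : Type*} [CommRing F] [Algebra A F]
    {G : SymA A (ObsMod α γ (m + 1) T) →ₐ[A] F} (hG : G (SymA.ι A _ (obsLast α γ m T)) = 1)
    (a : A) : G (a • obsPow α γ m s T) = algebraMap A F a := by
  rw [_root_.map_smul, obsPow, map_pow, hG, one_pow, Algebra.smul_def, mul_one]

lemma natDegree_le_of_degree_lt_succ {R : Type*} [Semiring R] {f : R[X]}
    (hf : f.degree < (m + 1 : ℕ)) : f.natDegree ≤ m :=
  natDegree_le_iff_coeff_eq_zero.mpr fun k hk =>
    coeff_eq_zero_of_degree_lt (hf.trans_le (by exact_mod_cast hk))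

lemma vecMul_aeval {F : Type*} [CommRing F] (θ : A →+* F) {f : F[X]} (hf : f.degree < (m + 1 : ℕ))
    (j : σ) : ((θ ∘ γ) ᵥ* aeval (α.map θ) f) j =
      ∑ k : Fin (m + 1), θ ((γ ᵥ* α ^ (k : ℕ)) j) * f.coeff k := by
  rw [aeval_eq_sum_range' (n := m + 1) (Nat.lt_succ_iff.mpr (natDegree_le_of_degree_lt_succ hf)), Finset.sum_range,
    vecMul_sum, Finset.sum_apply]
  refine Finset.sum_congr rfl fun k _ => ?_
  rw [vecMul_smul, Pi.smul_apply, map_vecMul_pow, smul_eq_mul, mul_comm]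

lemma IsGen.eq_zero_of_vecMul_aeval (h : IsGen α γ) (hT : ∀ j, j ∈ T)
    (hms : m + s = Fintype.card σ) (hs : s ≠ 0) {f : (ObsFrac α γ m s T)[X]} (hf : f.degree < m)
    (h0 : (algebraMap A (ObsFrac α γ m s T) ∘ γ) ᵥ*
      aeval (α.map (algebraMap A (ObsFrac α γ m s T))) f = 0) : f = 0 := by
  have hprime := h.isPrime_obsAnn hT hms hs
  obtain ⟨H, h1, h2⟩ := exists_obsEval (α := α) (γ := γ) (T := T) (m := m + 1)
    (algebraMap A (ObsFrac α γ m s T)) (fun k => f.coeff k) (fun j _ => by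
      rw [← vecMul_aeval _ (hf.trans (by exact_mod_cast Nat.lt_succ_self m)), h0, Pi.zero_apply])
  have hsingle : ∀ k, H (SymA.ι A _ (Submodule.Quotient.mk (Pi.single k 1))) = f.coeff k := by
    intro k
    rw [h2, Finset.sum_eq_single k (fun l _ hl => by simp [hl]) (by simp)]
    simp
  have hH : H (obsPow α γ m s T) = 0 := by
    rw [obsPow, map_pow, obsLast, hsingle, Fin.val_last, coeff_eq_zero_of_degree_lt hf, zero_pow hs]
  have hall : ∀ x ∈ SymA.deg A (ObsMod α γ (m + 1) T) s, H x = 0 := by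
    intro x hx
    obtain ⟨b, hb, a, hab⟩ := obs_rank_one _ rfl h m s T hT hms hs x hx
    have h3 := congrArg H hab
    rw [Algebra.smul_def, Algebra.smul_def, map_mul, map_mul, hH, mul_zero, h1] at h3
    exact (mul_eq_zero.mp h3).resolve_left (mt algebraMap_obsFrac_eq_zero.mp hb)
  ext k
  rw [coeff_zero]
  by_cases hk : k < m + 1
  · have h3 := hall _ (SymA.ι_pow_mem s (Submodule.Quotient.mk (Pi.single ⟨k, hk⟩ 1)))
    rw [map_pow, hsingle] at h3
    exact pow_eq_zero_iff hs |>.mp h3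
  · exact coeff_eq_zero_of_degree_lt (hf.trans (by exact_mod_cast (by omega : m < k)))

lemma IsGen.isIntegral_of_last_eq_one (h : IsGen α γ) (hT : ∀ j, j ∈ T)
    (hms : m + s = Fintype.card σ) (hs : s ≠ 0)
    {G : SymA A (ObsMod α γ (m + 1) T) →ₐ[A] ObsFrac α γ m s T}
    (hG : G (SymA.ι A _ (obsLast α γ m T)) = 1) (x : SymA A (ObsMod α γ (m + 1) T)) :
    IsIntegral A (G x) := by
  have hprime := h.isPrime_obsAnn hT hms hs
  set F := ObsFrac α γ m s T
  let q : F[X] := ∑ k : Fin (m + 1),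
    C (G (SymA.ι A _ (Submodule.Quotient.mk (Pi.single k 1)))) * X ^ (k : ℕ)
  have hcoeff : ∀ k : Fin (m + 1),
      q.coeff k = G (SymA.ι A _ (Submodule.Quotient.mk (Pi.single k 1))) := by
    intro k
    rw [finsetSum_coeff, Finset.sum_eq_single k]
    · simp
    · intro l _ hl
      rw [coeff_C_mul_X_pow, if_neg (fun h => hl (Fin.ext h.symm))]
    · simp
  have hdeg : q.degree < (m + 1 : ℕ) := by
    refine (degree_sum_le _ _).trans_lt ((Finset.sup_lt_iff (WithBot.bot_lt_coe _)).mpr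
      fun k _ => (degree_C_mul_X_pow_le _ _).trans_lt (by exact_mod_cast k.2))
  have hmon : q.Monic := by
    refine monic_of_degree_le m (natDegree_le_iff_degree_le.mp
      (natDegree_le_of_degree_lt_succ hdeg)) ?_
    exact (hcoeff (Fin.last m)).trans hG
  have hqdeg : q.degree = m := by
    refine le_antisymm (natDegree_le_iff_degree_le.mp
      (natDegree_le_of_degree_lt_succ hdeg)) (le_degree_of_ne_zero ?_)
    exact ((hcoeff (Fin.last m)).trans hG).trans_ne one_ne_zero
  have hmk : ∀ v : Fin (m + 1) → A, G (SymA.ι A _ (Submodule.Quotient.mk v)) =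
      ∑ k, algebraMap A F (v k) * q.coeff k := by
    intro v
    have hv : (Submodule.Quotient.mk v : ObsMod α γ (m + 1) T) =
        ∑ k, v k • Submodule.Quotient.mk (Pi.single k 1) := by
      conv_lhs => rw [pi_eq_sum_univ' v]
      rw [← Submodule.mkQ_apply, map_sum]
      refine Finset.sum_congr rfl fun k _ => ?_
      rw [_root_.map_smul, Submodule.mkQ_apply]
    rw [hv, map_sum, map_sum]
    refine Finset.sum_congr rfl fun k _ => ?_
    rw [_root_.map_smul, _root_.map_smul, hcoeff, Algebra.smul_def]
  have hann : (algebraMap A F ∘ γ) ᵥ* aeval (α.map (algebraMap A F)) q = 0 := by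
    funext j
    rw [vecMul_aeval _ hdeg, Pi.zero_apply]
    have h1 := hmk (obsVec α γ (m + 1) j)
    have h2 := obsCls_eq_zero (α := α) (γ := γ) (m := m + 1) (hT j)
    rw [obsCls] at h2
    rw [h2, map_zero, map_zero] at h1
    exact h1.symm
  have hdvd : q ∣ α.charpoly.map (algebraMap A F) := by
    rw [← Matrix.charpoly_map, ← modByMonic_eq_zero_iff_dvd hmon]
    refine h.eq_zero_of_vecMul_aeval hT hms hs ((degree_modByMonic_lt _ hmon).trans_eq hqdeg) ?_
    have h1 := modByMonic_add_div (α.map (algebraMap A F)).charpoly q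
    rw [← eq_sub_iff_add_eq] at h1
    rw [h1, map_sub, map_mul, Matrix.aeval_self_charpoly, vecMul_sub, vecMul_zero,
      ← vecMul_vecMul, hann, zero_vecMul, sub_zero]
  have hintegral : ∀ k, IsIntegral A (q.coeff k) := by
    intro k
    obtain ⟨y, hy⟩ := (lifts_iff_coeff_lifts _).mp
      (integralClosure.mem_lifts_of_monic_of_dvd_map F α.charpoly_monic hmon hdvd) k
    rw [← hy]
    exact y.2
  induction x using SymA.induction with
  | algebraMap r => rw [AlgHom.commutes]; exact isIntegral_algebraMap
  | ι c =>
    obtain ⟨v, rfl⟩ := Submodule.Quotient.mk_surjective _ c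
    rw [hmk]
    exact IsIntegral.sum _ fun k _ => isIntegral_algebraMap.mul (hintegral k)
  | mul a b ha hb => rw [map_mul]; exact ha.mul hb
  | add a b ha hb => rw [map_add]; exact ha.add hb

/-- The graded pieces are the integral closures of the quotients by the annihilators. -/
theorem IsGen.exists_normalization (h : IsGen α γ) (hT : ∀ j, j ∈ T)
    (hms : m + s = Fintype.card σ) (hs : s ≠ 0) {I : Ideal A} (hI : I = obsAnn α γ m s T) :
    ∃ φ : SymA.deg A (ObsMod α γ (m + 1) T) s →ₗ[A] FractionRing (A ⧸ I),
      Function.Injective φ ∧ φ ⟨obsPow α γ m s T, obsPow_mem _ _ _⟩ = 1 ∧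
      ∀ z, IsIntegral (A ⧸ I) z ↔ ∃ x, φ x = z := by
  subst hI
  have hprime := h.isPrime_obsAnn hT hms hs
  obtain ⟨G, hG, hinj⟩ := h.exists_rho hT hms hs
  refine ⟨G.toLinearMap ∘ₗ (SymA.deg A (ObsMod α γ (m + 1) T) s).subtype, ?_, ?_, fun z => ⟨?_, ?_⟩⟩
  · rw [← LinearMap.ker_eq_bot, LinearMap.ker_eq_bot']
    exact fun x hx => Subtype.ext (hinj x x.2 hx)
  · have := map_smul_obsPow_eq (s := s) hG 1
    rwa [one_smul, map_one] at this
  · intro hz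
    obtain ⟨a, b, hb, rfl⟩ := IsFractionRing.div_surjective (A := A ⧸ obsAnn α γ m s T) z
    obtain ⟨a, rfl⟩ := Ideal.Quotient.mk_surjective a
    obtain ⟨b, rfl⟩ := Ideal.Quotient.mk_surjective b
    have hintegral : Algebra.IsIntegral A (A ⧸ obsAnn α γ m s T) :=
      Algebra.IsIntegral.of_surjective (Algebra.ofId _ _) Ideal.Quotient.mk_surjective
    have hzA := isIntegral_trans (R := A) _ hz
    obtain ⟨p, hp, hpz⟩ := hzA
    have hb0 : algebraMap A (ObsFrac α γ m s T) b ≠ 0 := by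
      rw [IsScalarTower.algebraMap_apply A (A ⧸ obsAnn α γ m s T)]
      exact IsFractionRing.to_map_ne_zero_of_mem_nonZeroDivisors hb
    change eval₂ _ (algebraMap A (ObsFrac α γ m s T) a / algebraMap A _ b) p = 0 at hpz
    have h1 := scaleRoots_eval₂_mul (p := p) (algebraMap A (ObsFrac α γ m s T))
      (algebraMap A _ a / algebraMap A _ b) b
    rw [mul_div_cancel₀ _ hb0, hpz, mul_zero, eval₂_at_apply, algebraMap_obsFrac_eq_zero] at h1
    obtain ⟨x, hx, hbx⟩ := obs_normal _ rfl h m s T hT hms hs a b p hp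
      (mt algebraMap_obsFrac_eq_zero.mpr hb0) h1
    refine ⟨⟨x, hx⟩, ?_⟩
    have h2 := congrArg G hbx
    rw [map_smul_obsPow_eq hG, _root_.map_smul, Algebra.smul_def] at h2
    exact eq_div_of_mul_eq hb0 (by rw [mul_comm]; exact h2)
  · rintro ⟨x, rfl⟩
    exact (h.isIntegral_of_last_eq_one hT hms hs hG x).tower_top

end Integral

section Invariant

open Polynomial

lemma exists_invariant_finrank {K : Type*} [Field K] [IsAlgClosed K] {V : Type*} [AddCommGroup V]
    [Module K V] [FiniteDimensional K V] (f : Module.End K V) {s : ℕ}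
    (hs : s ≤ Module.finrank K V) :
    ∃ U : Submodule K V, Module.finrank K U = s ∧ ∀ v ∈ U, f v ∈ U := by
  induction s with
  | zero => exact ⟨⊥, finrank_bot K V, fun v hv => by
      rw [(Submodule.mem_bot K).mp hv, map_zero]; exact Submodule.zero_mem _⟩
  | succ s ih =>
    obtain ⟨U, hU, hfU⟩ := ih (by omega)
    have h1 := Submodule.finrank_quotient_add_finrank U
    have : Nontrivial (V ⧸ U) := Module.nontrivial_of_finrank_pos (R := K) (by omega)
    obtain ⟨c, hc⟩ := Module.End.exists_eigenvalue (U.mapQ U f hfU)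
    obtain ⟨y, hy⟩ := hc.exists_hasEigenvector
    obtain ⟨x, rfl⟩ := Submodule.Quotient.mk_surjective U y
    have hx : x ∉ U := fun h => hy.2 ((Submodule.Quotient.mk_eq_zero U).mpr h)
    have hfx : f x - c • x ∈ U := by
      rw [← Submodule.Quotient.mk_eq_zero, Submodule.Quotient.mk_sub, Submodule.Quotient.mk_smul,
        sub_eq_zero]
      exact hy.apply_eq_smul
    refine ⟨U ⊔ Submodule.span K {x}, by rw [Submodule.finrank_sup_span_singleton hx, hU], fun v hv => ?_⟩
    obtain ⟨u, hu, w, hw, rfl⟩ := Submodule.mem_sup.mp hv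
    obtain ⟨a, rfl⟩ := Submodule.mem_span_singleton.mp hw
    have h2 : f (u + a • x) = (f u + a • (f x - c • x)) + (a * c) • x := by
      rw [map_add, _root_.map_smul, smul_sub, mul_smul]; abel
    rw [h2]
    exact Submodule.add_mem_sup (U.add_mem (hfU u hu) (U.smul_mem a hfx))
      (Submodule.smul_mem _ _ (Submodule.mem_span_singleton_self x))

variable {K : Type*} [Field K] {σ : Type*} [Fintype σ] [DecidableEq σ]

lemma exists_monic_vecMul_aeval {α : Matrix σ σ K} {γ : σ → K} {U : Submodule K (σ → K)}
    (hα : ∀ v ∈ U, α *ᵥ v ∈ U) (hγ : ∀ v ∈ U, γ ⬝ᵥ v = 0) :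
    ∃ q : K[X], q.Monic ∧ q.natDegree + Module.finrank K U = Fintype.card σ ∧
      γ ᵥ* aeval α q = 0 := by
  have hα' : U ≤ U.comap (toLin' α) := hα
  set g := U.mapQ U (toLin' α) hα' with hg
  have key : ∀ (q : K[X]) (v : σ → K), aeval g q (U.mkQ v) = U.mkQ (aeval α q *ᵥ v) := by
    intro q
    induction q using Polynomial.induction_on' with
    | add p q hp hq =>
      intro v
      rw [map_add, map_add, LinearMap.add_apply, hp, hq, add_mulVec, map_add]
    | monomial n a =>
      intro v
      have hpow : ∀ v, (g ^ n) (U.mkQ v) = U.mkQ (α ^ n *ᵥ v) := by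
        clear v
        induction n with
        | zero => intro v; simp
        | succ n ih =>
          intro v
          rw [pow_succ, Module.End.mul_apply, hg, Submodule.mkQ_apply, Submodule.mapQ_apply,
            ← Submodule.mkQ_apply, ← hg, ih, toLin'_apply, mulVec_mulVec, ← pow_succ]
      rw [aeval_monomial, aeval_monomial, ← Algebra.smul_def, ← Algebra.smul_def,
        LinearMap.smul_apply, hpow, smul_mulVec, _root_.map_smul]
  refine ⟨g.charpoly, g.charpoly_monic, ?_, ?_⟩
  · rw [LinearMap.charpoly_natDegree, Submodule.finrank_quotient_add_finrank,
      Module.finrank_fintype_fun_eq_card]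
  · funext j
    have h1 := key g.charpoly (Pi.single j 1)
    rw [LinearMap.aeval_self_charpoly, LinearMap.zero_apply, eq_comm, Submodule.mkQ_apply,
      Submodule.Quotient.mk_eq_zero] at h1
    have h2 := hγ _ h1
    rwa [dotProduct_mulVec, dotProduct_single_one] at h2

lemma exists_invariant_of_vecMul_aeval [IsAlgClosed K] {α : Matrix σ σ K} {γ : σ → K} {f : K[X]}
    (hf : f ≠ 0) (h0 : γ ᵥ* aeval α f = 0) {s : ℕ} (hs : f.natDegree + s ≤ Fintype.card σ) :
    ∃ U : Submodule K (σ → K), Module.finrank K U = s ∧ (∀ v ∈ U, α *ᵥ v ∈ U) ∧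
      ∀ v ∈ U, γ ⬝ᵥ v = 0 := by
  let obs : (σ → K) →ₗ[K] (Fin f.natDegree → K) :=
    LinearMap.pi fun k => (dotProductBilin K K (γ ᵥ* α ^ (k : ℕ)))
  have hobs : ∀ v k, obs v k = (γ ᵥ* α ^ (k : ℕ)) ⬝ᵥ v := fun v k => rfl
  have hker : ∀ v ∈ LinearMap.ker obs, ∀ p : K[X], (γ ᵥ* aeval α p) ⬝ᵥ v = 0 := by
    intro v hv p
    have h1 := EuclideanDomain.div_add_mod p f
    rw [← h1, map_add, map_mul, vecMul_add, ← vecMul_vecMul, h0, zero_vecMul, zero_add]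
    have hdeg : (p % f).degree < f.natDegree := by
      rw [← degree_eq_natDegree hf]; exact EuclideanDomain.mod_lt p hf
    rcases eq_or_ne (p % f) 0 with h2 | h2
    · rw [h2, map_zero, vecMul_zero, zero_dotProduct]
    rw [as_sum_range_C_mul_X_pow' (p % f) ((natDegree_lt_iff_degree_lt h2).mpr hdeg), map_sum,
      vecMul_sum, sum_dotProduct]
    refine Finset.sum_eq_zero fun k hk => ?_
    rw [map_mul, map_pow, aeval_X, aeval_C, ← Algebra.smul_def, vecMul_smul, smul_dotProduct]
    have h3 := congrFun (LinearMap.mem_ker.mp hv) ⟨k, Finset.mem_range.mp hk⟩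
    rw [hobs] at h3
    change _ = (0 : K) at h3
    rw [h3, smul_zero]
  have hinv : ∀ v ∈ LinearMap.ker obs, toLin' α v ∈ LinearMap.ker obs := by
    intro v hv
    rw [LinearMap.mem_ker]
    funext k
    have h1 := hker v hv (X ^ ((k : ℕ) + 1))
    rw [map_pow, aeval_X, pow_succ, ← vecMul_vecMul, ← dotProduct_mulVec] at h1
    exact h1
  have hrank := LinearMap.finrank_range_add_finrank_ker obs
  rw [Module.finrank_fintype_fun_eq_card] at hrank
  have hle := Submodule.finrank_le (LinearMap.range obs)
  rw [Module.finrank_fintype_fun_eq_card, Fintype.card_fin] at hle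
  obtain ⟨U, hU, hfU⟩ := exists_invariant_finrank ((toLin' α).restrict hinv) (s := s) (by omega)
  refine ⟨U.map (Submodule.subtype _), ?_, ?_, ?_⟩
  · rw [Submodule.finrank_map_subtype_eq, hU]
  · rintro _ ⟨v, hv, rfl⟩
    exact ⟨_, hfU v hv, rfl⟩
  · rintro _ ⟨v, hv, rfl⟩
    have := hker v v.2 1
    rwa [map_one, vecMul_one] at this

end Invariant

/-- A matrix over a field with linearly independent rows has a right inverse. -/
lemma exists_right_inverse_or_vecMul_eq_zero {K : Type*} [Field K] {σ : Type*} [Fintype σ]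
    {m : ℕ} (O : Matrix (Fin m) σ K) :
    (∃ W : Matrix σ (Fin m) K, O * W = 1) ∨ ∃ w : Fin m → K, w ≠ 0 ∧ w ᵥ* O = 0 := by
  rw [or_iff_not_imp_right]
  intro h
  push Not at h
  rw [← mulVec_surjective_iff_exists_right_inverse]
  have hli : LinearIndependent K O.row := by
    rw [← vecMul_injective_iff]
    refine (injective_iff_map_eq_zero O.vecMulLinear).mpr fun w hw => ?_
    by_contra hne
    exact h w hne hw
  have hr := hli.rank_matrix
  rw [Fintype.card_fin] at hr
  have : LinearMap.range O.mulVecLin = ⊤ := Submodule.eq_top_of_finrank_eq (by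
    rw [Module.finrank_fintype_fun_eq_card, Fintype.card_fin]; exact hr)
  exact LinearMap.range_eq_top.mp this

section Fitting

variable {A : Type u} [CommRing A] {σ : Type} [Fintype σ] [DecidableEq σ]
  {α : Matrix σ σ A} {γ : σ → A} {m s : ℕ} {T : Finset σ}

lemma det_smul_obsMod (hT : ∀ j, j ∈ T) (W : Matrix σ (Fin m) A) (c : ObsMod α γ m T) :
    ((Matrix.of fun (k : Fin m) j => (γ ᵥ* α ^ (k : ℕ)) j) * W).det • c = 0 := by
  obtain ⟨v, rfl⟩ := Submodule.Quotient.mk_surjective _ c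
  set O : Matrix (Fin m) σ A := Matrix.of fun (k : Fin m) j => (γ ᵥ* α ^ (k : ℕ)) j with hO
  have h1 : (O * W).det • v = ∑ j, ((W * (O * W).adjugate) *ᵥ v) j • obsVec α γ m j := by
    have h2 : (O * W).det • v = O *ᵥ ((W * (O * W).adjugate) *ᵥ v) := by
      rw [mulVec_mulVec, ← Matrix.mul_assoc, mul_adjugate, smul_mulVec, one_mulVec]
    rw [h2]
    funext k
    rw [Finset.sum_apply]
    exact Finset.sum_congr rfl fun j _ => mul_comm _ _
  rw [← Submodule.Quotient.mk_smul, h1, ← Submodule.mkQ_apply, map_sum]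
  refine Finset.sum_eq_zero fun j _ => ?_
  have h3 := obsCls_eq_zero (α := α) (γ := γ) (m := m) (hT j)
  rw [obsCls] at h3
  rw [_root_.map_smul, Submodule.mkQ_apply, h3, smul_zero]

lemma det_mem_obsAnn (hT : ∀ j, j ∈ T) (hs : s ≠ 0) (W : Matrix σ (Fin (m + 1)) A) :
    ((Matrix.of fun (k : Fin (m + 1)) j => (γ ᵥ* α ^ (k : ℕ)) j) * W).det ∈ obsAnn α γ m s T := by
  obtain ⟨s, rfl⟩ := Nat.exists_eq_succ_of_ne_zero hs
  rw [mem_obsAnn, obsPow, pow_succ', ← smul_mul_assoc, ← _root_.map_smul, det_smul_obsMod hT,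
    map_zero, zero_mul]

lemma map_eq_zero_of_mem_obsAnn {F : Type*} [Field F] (θ : A →+* F) {q : Polynomial F}
    (hq : q.Monic) (hm : q.natDegree = m) (h0 : (θ ∘ γ) ᵥ* Polynomial.aeval (α.map θ) q = 0)
    {a : A} (ha : a ∈ obsAnn α γ m s T) : θ a = 0 := by
  obtain ⟨H, h1, h2⟩ := exists_obsEval (α := α) (γ := γ) (T := T) (m := m + 1) θ
    (fun k => q.coeff k) (fun j _ => by
      rw [← vecMul_aeval _ (Polynomial.degree_le_natDegree.trans_lt
        (by rw [hm]; exact_mod_cast Nat.lt_succ_self m)), h0, Pi.zero_apply])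
  have h3 : H (SymA.ι A _ (obsLast α γ m T)) = 1 := by
    rw [obsLast, h2, Finset.sum_eq_single (Fin.last m) (fun l _ hl => by simp [hl]) (by simp),
      Pi.single_eq_same, map_one, one_mul, Fin.val_last, ← hm]
    exact hq
  have h4 := congrArg H (mem_obsAnn.mp ha)
  rwa [Algebra.smul_def, map_mul, h1, obsPow, map_pow, h3, one_pow, mul_one, map_zero] at h4

end Fitting

section Kalman

variable (K : Type u) [Field K] (d : ℕ)

/-- The generic upper left block. -/
noncomputable def genAlpha : Matrix (Fin d) (Fin d) (MatCoordRing K (d + 1)) :=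
  Matrix.of fun i j => MvPolynomial.X (i.castSucc, j.castSucc)

/-- The generic lower left row. -/
noncomputable def genGamma : Fin d → MatCoordRing K (d + 1) :=
  fun j => MvPolynomial.X (Fin.last d, j.castSucc)

/-- The variables, split into the blocks of the matrix. -/
def blockIndex : ((Fin d × Fin d) ⊕ Fin d) ⊕ Fin (d + 1) → Fin (d + 1) × Fin (d + 1)
  | Sum.inl (Sum.inl p) => (p.1.castSucc, p.2.castSucc)
  | Sum.inl (Sum.inr j) => (Fin.last d, j.castSucc)
  | Sum.inr i => (i, Fin.last d)

lemma blockIndex_bijective : Function.Bijective (blockIndex d) := by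
  constructor
  · rintro ((⟨a, b⟩ | a) | a) ((⟨a', b'⟩ | a') | a') h <;>
      simp only [blockIndex, Prod.mk.injEq, Fin.castSucc_inj, Fin.castSucc_ne_last,
        (Fin.castSucc_ne_last _).symm, and_false, false_and, and_true, true_and] at h <;>
      simp_all
  · rintro ⟨i, j⟩
    induction j using Fin.lastCases with
    | last => exact ⟨Sum.inr i, rfl⟩
    | cast j =>
      induction i using Fin.lastCases with
      | last => exact ⟨Sum.inl (Sum.inr j), rfl⟩
      | cast i => exact ⟨Sum.inl (Sum.inl (i, j)), rfl⟩

lemma isGen_genAlpha [CharZero K] : IsGen (genAlpha K d) (genGamma K d) := by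
  refine ⟨MvPolynomial (Fin (d + 1)) K, inferInstance, inferInstance, inferInstance, inferInstance,
    ((MvPolynomial.sumAlgEquiv K ((Fin d × Fin d) ⊕ Fin d) (Fin (d + 1))).symm.trans
      (MvPolynomial.renameEquiv K (Equiv.ofBijective _ (blockIndex_bijective d)))).toRingEquiv,
    fun i j => ?_, fun j => ?_⟩
  · simp [genAlpha, blockIndex]
  · simp [genGamma, blockIndex]

variable {K d}

/-- The inclusion of the first coordinates. -/
def snocZero (K : Type*) [Field K] (d : ℕ) : (Fin d → K) →ₗ[K] (Fin (d + 1) → K) where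
  toFun v := Fin.snoc v 0
  map_add' v w := by
    funext i
    induction i using Fin.lastCases <;> simp
  map_smul' c v := by
    funext i
    induction i using Fin.lastCases <;> simp

@[simp] lemma snocZero_castSucc (v : Fin d → K) (i : Fin d) : snocZero K d v i.castSucc = v i :=
  Fin.snoc_castSucc (α := fun _ => K) _ _ _

@[simp] lemma snocZero_last (v : Fin d → K) : snocZero K d v (Fin.last d) = 0 :=
  Fin.snoc_last (α := fun _ => K) _ _

lemma snocZero_injective : Function.Injective (snocZero K d) := fun v w h => by
  funext i
  simpa using congrFun h i.castSucc

lemma range_snocZero : LinearMap.range (snocZero K d) = firstCoordsSubspace K (d + 1) d := by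
  apply le_antisymm
  · rintro _ ⟨v, rfl⟩ i hi
    obtain rfl : i = Fin.last d := Fin.ext (by have := i.isLt; simp; omega)
    simp
  · intro w hw
    refine ⟨fun i => w i.castSucc, ?_⟩
    funext i
    induction i using Fin.lastCases with
    | last => simpa using (hw (Fin.last d) (by simp)).symm
    | cast i => simp

lemma mulVec_snocZero_castSucc (M : Matrix (Fin (d + 1)) (Fin (d + 1)) K) (v : Fin d → K)
    (i : Fin d) : (M *ᵥ snocZero K d v) i.castSucc =
      (M.submatrix Fin.castSucc Fin.castSucc *ᵥ v) i := by
  simp [mulVec, dotProduct, Fin.sum_univ_castSucc]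

lemma mulVec_snocZero_last (M : Matrix (Fin (d + 1)) (Fin (d + 1)) K) (v : Fin d → K) :
    (M *ᵥ snocZero K d v) (Fin.last d) = (fun j => M (Fin.last d) (Fin.castSucc j)) ⬝ᵥ v := by
  simp [mulVec, dotProduct, Fin.sum_univ_castSucc]

/-- Membership in the Kalman variety in terms of blocks. -/
lemma mem_kalmanSet_iff {M : Matrix (Fin (d + 1)) (Fin (d + 1)) K} {s : ℕ} :
    M ∈ kalmanSet K (d + 1) d s ↔ ∃ U : Submodule K (Fin d → K), Module.finrank K U = s ∧
      (∀ v ∈ U, M.submatrix Fin.castSucc Fin.castSucc *ᵥ v ∈ U) ∧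
      ∀ v ∈ U, (fun j => M (Fin.last d) (Fin.castSucc j)) ⬝ᵥ v = 0 := by
  have hM : ∀ v, (fun j => M (Fin.last d) (Fin.castSucc j)) ⬝ᵥ v = 0 →
      M *ᵥ snocZero K d v = snocZero K d (M.submatrix Fin.castSucc Fin.castSucc *ᵥ v) := by
    intro v hv
    funext i
    induction i using Fin.lastCases with
    | last => rw [mulVec_snocZero_last, hv, snocZero_last]
    | cast i => rw [mulVec_snocZero_castSucc, snocZero_castSucc]
  constructor
  · rintro ⟨U, hUL, hU, hMU⟩
    have hmap : (U.comap (snocZero K d)).map (snocZero K d) = U :=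
      Submodule.map_comap_eq_of_le (by rwa [range_snocZero])
    have h0 : ∀ v ∈ U.comap (snocZero K d), (fun j => M (Fin.last d) (Fin.castSucc j)) ⬝ᵥ v = 0 :=
      fun v hv => by
        rw [← mulVec_snocZero_last]
        exact hUL (hMU _ hv) (Fin.last d) (by simp)
    refine ⟨U.comap (snocZero K d), ?_, fun v hv => ?_, h0⟩
    · rw [← hU, (Submodule.equivMapOfInjective (snocZero K d) snocZero_injective
        (U.comap (snocZero K d))).finrank_eq, hmap]
    · rw [Submodule.mem_comap, ← hM v (h0 v hv)]
      exact hMU _ hv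
  · rintro ⟨U, hU, hαU, hγU⟩
    refine ⟨U.map (snocZero K d), ?_, ?_, ?_⟩
    · rw [← range_snocZero]; exact LinearMap.map_le_range
    · rw [← hU, ← (Submodule.equivMapOfInjective (snocZero K d) snocZero_injective U).finrank_eq]
    · rintro _ ⟨v, hv, rfl⟩
      rw [hM v (hγU v hv)]
      exact ⟨_, hαU v hv, rfl⟩

/-- The vanishing ideal of the Kalman variety. -/
theorem kalmanIdeal_eq_obsAnn [IsAlgClosed K] [CharZero K] {m s : ℕ} (hms : m + s = d)
    (hs : s ≠ 0) :
    kalmanIdeal K (d + 1) d s = obsAnn (genAlpha K d) (genGamma K d) m s Finset.univ := by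
  have hgen := isGen_genAlpha K d
  have hα : ∀ M : Matrix (Fin (d + 1)) (Fin (d + 1)) K, (genAlpha K d).map
      (MvPolynomial.eval fun p => M p.1 p.2) = M.submatrix Fin.castSucc Fin.castSucc := fun M => by
    ext i j; simp [genAlpha]
  have hγ : ∀ M : Matrix (Fin (d + 1)) (Fin (d + 1)) K,
      (MvPolynomial.eval fun p => M p.1 p.2) ∘ genGamma K d =
        fun j => M (Fin.last d) (Fin.castSucc j) := fun M => by
    ext j; simp [genGamma]
  apply le_antisymm
  · have hprime := hgen.isPrime_obsAnn (m := m) (s := s) (T := Finset.univ) (by simp)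
      (by simpa using hms) hs
    rw [← hprime.radical, ← MvPolynomial.vanishingIdeal_zeroLocus_eq_radical (K := K)]
    intro f hf x hx
    refine (DFunLike.congr_fun (MvPolynomial.coe_aeval_eq_eval x) f).trans ?_
    let M : Matrix (Fin (d + 1)) (Fin (d + 1)) K := fun i j => x (i, j)
    suffices h : M ∈ kalmanSet K (d + 1) d s from hf M h
    have hx' : ∀ p ∈ obsAnn (genAlpha K d) (genGamma K d) m s Finset.univ,
        MvPolynomial.eval (fun p => M p.1 p.2) p = 0 := fun p hp =>
      (DFunLike.congr_fun (MvPolynomial.coe_aeval_eq_eval x) p).symm.trans (hx p hp)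
    rw [mem_kalmanSet_iff]
    set θ : MatCoordRing K (d + 1) →+* K := MvPolynomial.eval (fun p => M p.1 p.2) with hθ
    set O : Matrix (Fin (m + 1)) (Fin d) (MatCoordRing K (d + 1)) :=
      Matrix.of fun (k : Fin (m + 1)) j => (genGamma K d ᵥ* genAlpha K d ^ (k : ℕ)) j with hO
    rcases exists_right_inverse_or_vecMul_eq_zero (O.map θ) with ⟨W, hW⟩ | ⟨w, hw, hw0⟩
    · have h1 := hx' _ (det_mem_obsAnn (α := genAlpha K d) (γ := genGamma K d) (m := m) (s := s)
        (T := Finset.univ) (by simp) hs (W.map MvPolynomial.C))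
      rw [← hO, RingHom.map_det, RingHom.mapMatrix_apply, Matrix.map_mul, Matrix.map_map] at h1
      have h2 : (θ ∘ MvPolynomial.C : K → K) = id := by funext c; simp [hθ]
      rw [h2, Matrix.map_id, hW, det_one] at h1
      exact absurd h1 one_ne_zero
    · let f : Polynomial K := ∑ k : Fin (m + 1), Polynomial.C (w k) * Polynomial.X ^ (k : ℕ)
      have hcoeff : ∀ k : Fin (m + 1), f.coeff k = w k := by
        intro k
        rw [Polynomial.finsetSum_coeff, Finset.sum_eq_single k]
        · simp
        · intro l _ hl
          rw [Polynomial.coeff_C_mul_X_pow, if_neg (fun h => hl (Fin.ext h.symm))]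
        · simp
      have hf0 : f ≠ 0 := fun h0 => hw (funext fun k => by rw [← hcoeff, h0]; rfl)
      have hdeg : f.degree < (m + 1 : ℕ) := by
        refine (Polynomial.degree_sum_le _ _).trans_lt
          ((Finset.sup_lt_iff (WithBot.bot_lt_coe _)).mpr
            fun k _ => (Polynomial.degree_C_mul_X_pow_le _ _).trans_lt (by exact_mod_cast k.2))
      refine exists_invariant_of_vecMul_aeval hf0 ?_ (by
        have := natDegree_le_of_degree_lt_succ hdeg
        rw [Fintype.card_fin]; omega)
      rw [← hα, ← hγ]
      funext j
      rw [vecMul_aeval _ hdeg, Pi.zero_apply, ← Pi.zero_apply (M := fun _ => K) j, ← hw0]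
      refine Finset.sum_congr rfl fun k _ => ?_
      rw [hcoeff, mul_comm]
      rfl
  · intro a ha M hM
    obtain ⟨U, hU, hαU, hγU⟩ := mem_kalmanSet_iff.mp hM
    obtain ⟨q, hq, hdeg, h0⟩ := exists_monic_vecMul_aeval hαU hγU
    rw [Fintype.card_fin] at hdeg
    refine map_eq_zero_of_mem_obsAnn (MvPolynomial.eval fun p => M p.1 p.2) hq (by omega) ?_ ha
    rw [hα, hγ, h0]

end Kalman

section Step

variable {A : Type u} [CommRing A] {σ : Type} [Fintype σ] [DecidableEq σ]

/-- Restriction to a shorter chain of observations, followed by multiplication by its last one. -/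
noncomputable def obsStep (α : Matrix σ σ A) (γ : σ → A) (m s : ℕ) (T : Finset σ) :
    SymA.deg A (ObsMod α γ (m + 1 + 1) T) s →ₗ[A] SymA.deg A (ObsMod α γ (m + 1) T) (s + 1) :=
  SymA.mulMap A (obsLast α γ m T) s ∘ₗ SymA.degMap (obsRes α γ (m + 1) T) s

variable {α : Matrix σ σ A} {γ : σ → A} {m s : ℕ} {T : Finset σ}

lemma ker_degMap_obsRes : LinearMap.ker (SymA.degMap (obsRes α γ m T) (s + 1)) =
    LinearMap.range (SymA.mulMap A (obsLast α γ m T) s) :=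
  LinearMap.exact_iff.mp (SymA.exact_mulMap_degMap _ obsRes_surjective _ ker_obsRes s)

lemma range_obsStep : LinearMap.range (obsStep α γ m s T) =
    LinearMap.range (SymA.mulMap A (obsLast α γ m T) s) :=
  LinearMap.range_comp_of_range_eq_top _
    (LinearMap.range_eq_top.mpr (SymA.degMap_surjective _ obsRes_surjective s))

lemma IsGen.ker_obsStep (h : IsGen α γ) (hT : ∀ j, j ∈ T) (hms : m + 1 + s = Fintype.card σ)
    (hs : s ≠ 0) : LinearMap.ker (obsStep α γ m s T) =
      LinearMap.ker (SymA.degMap (obsRes α γ (m + 1) T) s) :=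
  LinearMap.ker_comp_of_ker_eq_bot _ <| (LinearMap.ker_eq_bot').mpr fun x hx =>
    Subtype.ext <| obsLast_mul_injective _ rfl h T hT m s hms hs x x.2 (congrArg Subtype.val hx)

lemma IsGen.ker_obsStep_eq_range (h : IsGen α γ) (hT : ∀ j, j ∈ T)
    (hms : m + 1 + 1 + s = Fintype.card σ) :
    LinearMap.ker (obsStep α γ m (s + 1) T) = LinearMap.range (obsStep α γ (m + 1) s T) := by
  rw [range_obsStep, h.ker_obsStep hT (by omega) s.succ_ne_zero, ker_degMap_obsRes]

lemma IsGen.ker_obsStep_one (h : IsGen α γ) (hT : ∀ j, j ∈ T)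
    (hm : m + 1 + 1 = Fintype.card σ) : LinearMap.ker (obsStep α γ m 1 T) =
      Submodule.span A {⟨obsPow α γ (m + 1) 1 T, obsPow_mem _ _ _⟩} := by
  rw [h.ker_obsStep hT hm one_ne_zero, ker_degMap_obsRes]
  ext x
  rw [LinearMap.mem_range, Submodule.mem_span_singleton]
  constructor
  · rintro ⟨y, rfl⟩
    obtain ⟨a, ha⟩ := SymA.mem_deg_zero.mp y.2
    refine ⟨a, Subtype.ext ?_⟩
    rw [SymA.mulMap_coe, ← ha, Submodule.coe_smul, Algebra.smul_def, mul_comm]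
    exact congrArg (· * _) (pow_one _)
  · rintro ⟨a, rfl⟩
    refine ⟨⟨algebraMap A _ a, SymA.mem_deg_zero.mpr ⟨a, rfl⟩⟩, Subtype.ext ?_⟩
    rw [SymA.mulMap_coe, Submodule.coe_smul, Algebra.smul_def, mul_comm]
    exact congrArg (_ * ·) (pow_one _).symm

lemma exists_smul_obsPow_eq (x : SymA.deg A (ObsMod α γ 1 T) s) :
    ∃ a : A, a • (⟨obsPow α γ 0 s T, obsPow_mem _ _ _⟩ : SymA.deg A (ObsMod α γ 1 T) s) = x := by
  obtain ⟨a, ha⟩ := exists_smul_obsPow x.2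
  exact ⟨a, Subtype.ext ha.symm⟩

lemma obsStep_zero_surjective : Function.Surjective (obsStep α γ 0 s T) := by
  rw [← LinearMap.range_eq_top, range_obsStep, LinearMap.range_eq_top]
  intro x
  obtain ⟨a, rfl⟩ := exists_smul_obsPow_eq x
  refine ⟨a • ⟨obsPow α γ 0 s T, obsPow_mem _ _ _⟩, ?_⟩
  rw [_root_.map_smul]
  refine congrArg _ (Subtype.ext ?_)
  rw [SymA.mulMap_coe]
  exact (pow_succ' _ _).symm

end Step

section Resolution

variable {K : Type u} [Field K] {d : ℕ}

lemma exists_equiv_kalmanNormalization [IsAlgClosed K] [CharZero K] (m s : ℕ) (hms : m + s = d)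
    (hs : s ≠ 0) :
    ∃ e : SymA.deg (MatCoordRing K (d + 1))
          (ObsMod (genAlpha K d) (genGamma K d) (m + 1) Finset.univ) s
        ≃ₗ[MatCoordRing K (d + 1)] KalmanNormalization K (d + 1) d s,
      e ⟨obsPow _ _ m s _, obsPow_mem _ _ _⟩ = 1 := by
  obtain ⟨φ, hφ, h1, hintegral⟩ := (isGen_genAlpha K d).exists_normalization (T := Finset.univ)
    (by simp) (by simpa using hms) hs (kalmanIdeal_eq_obsAnn hms hs)
  let g : SymA.deg (MatCoordRing K (d + 1))
      (ObsMod (genAlpha K d) (genGamma K d) (m + 1) Finset.univ) s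
      →ₗ[MatCoordRing K (d + 1)] KalmanNormalization K (d + 1) d s :=
    { toFun := fun x => ⟨φ x, (hintegral _).mpr ⟨x, rfl⟩⟩
      map_add' := fun x y => Subtype.ext (map_add φ x y)
      map_smul' := fun a x => Subtype.ext <|
        (_root_.map_smul φ a x).trans (Algebra.smul_def a (φ x)) }
  refine ⟨LinearEquiv.ofBijective g ⟨fun x y hxy => hφ (congrArg Subtype.val hxy), fun z => ?_⟩,
    Subtype.ext h1⟩
  obtain ⟨x, hx⟩ := (hintegral z.1).mp z.2
  exact ⟨x, Subtype.ext hx⟩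

lemma range_kalmanNormInclusion (n s : ℕ) : LinearMap.range (kalmanNormInclusion K n d s) =
    Submodule.span (MatCoordRing K n) {1} := by
  ext z
  rw [LinearMap.mem_range, Submodule.mem_span_singleton]
  constructor
  · rintro ⟨x, rfl⟩
    obtain ⟨a, rfl⟩ := Ideal.Quotient.mk_surjective x
    exact ⟨a, by rw [Algebra.smul_def, mul_one]; rfl⟩
  · rintro ⟨a, rfl⟩
    exact ⟨Ideal.Quotient.mk _ a, by rw [Algebra.smul_def, mul_one]; rfl⟩

lemma kalmanNormInclusion_injective (n s : ℕ) :
    Function.Injective (kalmanNormInclusion K n d s) := fun _ _ h =>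
  IsFractionRing.injective (KalmanCoordRing K n d s) (FractionRing (KalmanCoordRing K n d s))
    (congrArg Subtype.val h)

end Resolution

theorem stmt18 (K : Type*) [Field K] [IsAlgClosed K] [CharZero K]
    (d : ℕ) (hd : 1 ≤ d) :
    ∃ f : ∀ s : ℕ, KalmanNormalization K (d + 1) d s →ₗ[MatCoordRing K (d + 1)]
        KalmanNormalization K (d + 1) d (s + 1),
      Function.Injective (kalmanNormInclusion K (d + 1) d 1) ∧
      (d = 1 → Function.Surjective (kalmanNormInclusion K (d + 1) d 1)) ∧
      (2 ≤ d →
        LinearMap.ker (f 1) = LinearMap.range (kalmanNormInclusion K (d + 1) d 1) ∧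
        (∀ s : ℕ, 1 ≤ s → s ≤ d - 2 →
          LinearMap.ker (f (s + 1)) = LinearMap.range (f s)) ∧
        Function.Surjective (f (d - 1))) := by
  have hgen := isGen_genAlpha K d
  choose e he using exists_equiv_kalmanNormalization (K := K) (d := d)
  let f : ∀ s : ℕ, KalmanNormalization K (d + 1) d s →ₗ[MatCoordRing K (d + 1)]
      KalmanNormalization K (d + 1) d (s + 1) := fun s =>
    if h : d - 1 - s + 1 + s = d ∧ s ≠ 0 then
      (e (d - 1 - s) (s + 1) (by omega) s.succ_ne_zero).toLinearMap ∘ₗ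
        obsStep (genAlpha K d) (genGamma K d) (d - 1 - s) s Finset.univ ∘ₗ
        (e (d - 1 - s + 1) s h.1 h.2).symm.toLinearMap
    else 0
  have hf : ∀ (m s : ℕ) (h : m + 1 + s = d) (hs : s ≠ 0), f s =
      (e m (s + 1) (by omega) s.succ_ne_zero).toLinearMap ∘ₗ
        obsStep (genAlpha K d) (genGamma K d) m s Finset.univ ∘ₗ
        (e (m + 1) s h hs).symm.toLinearMap := by
    intro m s h hs
    obtain rfl : m = d - 1 - s := by omega
    exact dif_pos ⟨h, hs⟩
  have hker : ∀ (m s : ℕ) (h : m + 1 + s = d) (hs : s ≠ 0), LinearMap.ker (f s) =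
      (LinearMap.ker (obsStep (genAlpha K d) (genGamma K d) m s Finset.univ)).map
        (e (m + 1) s h hs).toLinearMap := by
    intro m s h hs
    rw [hf m s h hs, LinearEquiv.ker_comp, LinearMap.ker_comp]
    exact (Submodule.map_equiv_eq_comap_symm (e (m + 1) s h hs) _).symm
  have hrange : ∀ (m s : ℕ) (h : m + 1 + s = d) (hs : s ≠ 0), LinearMap.range (f s) =
      (LinearMap.range (obsStep (genAlpha K d) (genGamma K d) m s Finset.univ)).map
        (e m (s + 1) (by omega) s.succ_ne_zero).toLinearMap := by
    intro m s h hs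
    rw [hf m s h hs, LinearMap.range_comp, LinearEquiv.range_comp]
  refine ⟨f, kalmanNormInclusion_injective _ _, ?_, fun hd2 => ⟨?_, fun s hs hsd => ?_, ?_⟩⟩
  · rintro rfl
    rw [← LinearMap.range_eq_top, range_kalmanNormInclusion, eq_top_iff]
    intro z _
    obtain ⟨x, rfl⟩ := (e 0 1 rfl one_ne_zero).surjective z
    obtain ⟨a, rfl⟩ := exists_smul_obsPow_eq x
    rw [_root_.map_smul, he]
    exact Submodule.smul_mem _ _ (Submodule.mem_span_singleton_self _)
  · obtain ⟨m, rfl⟩ := Nat.exists_eq_add_of_le' hd2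
    rw [hker m 1 rfl one_ne_zero, range_kalmanNormInclusion,
      hgen.ker_obsStep_one (by simp) (by simp), Submodule.map_span, Set.image_singleton]
    exact congrArg (fun z => Submodule.span _ {z}) (he _ _ _ _)
  · obtain ⟨m, rfl⟩ : ∃ m, d = m + 1 + 1 + s := ⟨d - 2 - s, by omega⟩
    rw [hker m (s + 1) (by omega) s.succ_ne_zero, hrange (m + 1) s rfl (by omega),
      hgen.ker_obsStep_eq_range (by simp) (by simp)]
  · have h : 0 + 1 + (d - 1) = d := by omega
    rw [hf 0 (d - 1) h (by omega)]
    exact (LinearEquiv.surjective _).comp (obsStep_zero_surjective.comp (LinearEquiv.surjective _))
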